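/- Assume the local multiplier setup with g of the standard form, let ε be the ball exponent of g with ε ≥ 1/2, and suppose at least one unit direction has strip exponent less than 1/2. Let δ = min over all unit vectors v of δ_v (so δ < 1/2) and let e be the maximum of e_v over unit vectors v with δ_v = δ. Then, provided the support of φ is sufficiently small, there is a constant C' such that |K_φ(t,u)| ≤ C' (2+|(t,u)|)^{−δ} (ln(2+|(t,u)|))^{e} for all (t,u) ∈ ℝ². -/

import Mathlib

open MeasureTheory Real Set Filter Metric
open scoped Topology ENNReal

noncomputable section

/-- The Euclidean magnitude `|(x,y)| = √(x²+y²)` of a point of `ℝ²`. -/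
def nrm2 (p : ℝ × ℝ) : ℝ := Real.sqrt (p.1 ^ 2 + p.2 ^ 2)

/-- The open Euclidean disk `{(x,y) : x²+y² < r²}` centered at the origin. -/
def disk2 (r : ℝ) : Set (ℝ × ℝ) := {p : ℝ × ℝ | p.1 ^ 2 + p.2 ^ 2 < r ^ 2}

/-- The closed Euclidean disk `{(x,y) : x²+y² ≤ r²}` centered at the origin. -/
def closedDisk2 (r : ℝ) : Set (ℝ × ℝ) := {p : ℝ × ℝ | p.1 ^ 2 + p.2 ^ 2 ≤ r ^ 2}

/-- The circle `{(x,y) : x²+y² = r²}` centered at the origin. -/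
def circle2 (r : ℝ) : Set (ℝ × ℝ) := {p : ℝ × ℝ | p.1 ^ 2 + p.2 ^ 2 = r ^ 2}

/-- Dot product on `ℝ²`. -/
def dot2 (p q : ℝ × ℝ) : ℝ := p.1 * q.1 + p.2 * q.2

/-- The perpendicular vector `v^⊥ = (v₂, −v₁)`. -/
def perp2 (v : ℝ × ℝ) : ℝ × ℝ := (v.2, -v.1)

/-- The function `g = χ_E · ∏ᵢ |fᵢ|^(γᵢ)`. -/
def stdFun (n : ℕ) (f : Fin n → ℝ × ℝ → ℝ) (γ : Fin n → ℝ) (E : Set (ℝ × ℝ)) :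
    ℝ × ℝ → ℝ :=
  E.indicator fun p => ∏ i, |f i p| ^ (γ i)

/-- A boundary curve for the region `E`: one half of a graph `y = h(|x|^{1/N})` or
`x = h(|y|^{1/N})` with `h` real analytic, `h 0 = 0`, joining the origin to the circle
of radius `r₀`. -/
def IsPuiseuxBdryCurve (r₀ : ℝ) (C : Set (ℝ × ℝ)) : Prop :=
  ∃ (N : ℕ) (h : ℝ → ℝ) (I : Set ℝ) (σ : ℝ),
    0 < N ∧ (σ = 1 ∨ σ = -1) ∧ IsOpen I ∧ Icc (0:ℝ) (r₀ ^ ((N:ℝ)⁻¹)) ⊆ I ∧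
    AnalyticOnNhd ℝ h I ∧ h 0 = 0 ∧
    (C = {p : ℝ × ℝ | p ∈ closedDisk2 r₀ ∧ 0 ≤ σ * p.1 ∧
            p.2 = h (|p.1| ^ ((N:ℝ)⁻¹))} ∨
     C = {p : ℝ × ℝ | p ∈ closedDisk2 r₀ ∧ 0 ≤ σ * p.2 ∧
            p.1 = h (|p.2| ^ ((N:ℝ)⁻¹))}) ∧
    (0:ℝ×ℝ) ∈ C ∧ ∃ p ∈ C, nrm2 p = r₀

/-- The admissible form of the set `E`: either a disk centered at the origin, or a finite
disjoint union of open regions, each bounded by two Puiseux boundary curves joining the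
origin to the circle of radius `r₀` together with an arc of that circle, where all the
boundary curves are pairwise disjoint in the closed disk minus the origin. -/
def IsStdDomain (E : Set (ℝ × ℝ)) : Prop :=
  (∃ r₀ > (0:ℝ), E = disk2 r₀) ∨
  (∃ r₀ > (0:ℝ), ∃ m : ℕ, ∃ Es : Fin m → Set (ℝ × ℝ), ∃ Cs : Fin m → Fin 2 → Set (ℝ × ℝ),
    E = Set.iUnion Es ∧
    (Pairwise fun i j => Disjoint (Es i) (Es j)) ∧
    (∀ i, IsOpen (Es i) ∧ Es i ⊆ disk2 r₀ ∧ (0:ℝ×ℝ) ∈ closure (Es i) ∧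
      frontier (Es i) ⊆ Cs i 0 ∪ Cs i 1 ∪ circle2 r₀) ∧
    (∀ i j, IsPuiseuxBdryCurve r₀ (Cs i j)) ∧
    (Pairwise fun (q q' : Fin m × Fin 2) =>
      Disjoint (Cs q.1 q.2 ∩ (closedDisk2 r₀ \ {0}))
               (Cs q'.1 q'.2 ∩ (closedDisk2 r₀ \ {0}))))

/-- The standard form of the paper: the `fᵢ` are real analytic and not identically zero
near the origin, `g = χ_E ∏ |fᵢ|^(γᵢ)` is integrable near the origin, and `E` is an
admissible domain. -/
structure StandardForm (n : ℕ) (f : Fin n → ℝ × ℝ → ℝ) (γ : Fin n → ℝ)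
    (E : Set (ℝ × ℝ)) : Prop where
  analytic : ∃ U ∈ 𝓝 (0 : ℝ × ℝ), ∀ i, AnalyticOnNhd ℝ (f i) U
  nontriv : ∀ i, ¬ (∀ᶠ p in 𝓝 (0 : ℝ × ℝ), f i p = 0)
  integ : ∃ U ∈ 𝓝 (0 : ℝ × ℝ), IntegrableOn (stdFun n f γ E) U
  domain : IsStdDomain E

/-- The two-sided bound `c₁ rᵉ |log r|^d ≤ ∫_{x²+y²<r²} g ≤ c₂ rᵉ |log r|^d` for all small
`r` ("ball exponents" `ε`, `d` of `g`, as in Lemma 1.1). -/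
def BallBound (g : ℝ × ℝ → ℝ) (ε : ℝ) (d : ℕ) : Prop :=
  0 < ε ∧ d ≤ 1 ∧ ∃ c₁ > (0:ℝ), ∃ c₂ > (0:ℝ), ∃ c₃ > (0:ℝ), ∀ r : ℝ, 0 < r → r < c₃ →
    c₁ * r ^ ε * |Real.log r| ^ d ≤ (∫ p in disk2 r, g p) ∧
    (∫ p in disk2 r, g p) ≤ c₂ * r ^ ε * |Real.log r| ^ d

/-- The strip `{(x,y) : |(x,y)·v| < r, |(x,y)·v^⊥| < c}`. -/
def strip2 (v : ℝ × ℝ) (r c : ℝ) : Set (ℝ × ℝ) :=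
  {p : ℝ × ℝ | |dot2 p v| < r ∧ |dot2 p (perp2 v)| < c}

/-- The two-sided bound `a r^δ |log r|^e ≤ ∫_{strip} g ≤ b r^δ |log r|^e` for all small `r`,
for every small `c` ("strip exponents" `δ_v`, `e_v` of `g` in the direction `v`, as in
Lemma 1.2). -/
def StripBound (g : ℝ × ℝ → ℝ) (v : ℝ × ℝ) (δ : ℝ) (e : ℕ) : Prop :=
  0 < δ ∧ e ≤ 1 ∧ ∃ cv > (0:ℝ), ∀ c : ℝ, 0 < c → c < cv →
    ∃ a > (0:ℝ), ∃ b > (0:ℝ), ∀ r : ℝ, 0 < r → r < c →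
      a * r ^ δ * |Real.log r| ^ e ≤ (∫ p in strip2 v r c, g p) ∧
      (∫ p in strip2 v r c, g p) ≤ b * r ^ δ * |Real.log r| ^ e

/-- The order of vanishing of `f` at the origin. -/
def vanishingOrder (f : ℝ × ℝ → ℝ) : ℕ :=
  sInf {k : ℕ | iteratedFDeriv ℝ k f 0 ≠ 0}

/-- (A constant multiple of) the sum of the terms of lowest total degree in the Taylor
expansion of `f` at the origin, as a homogeneous function on `ℝ²`. -/
def lowestPart (f : ℝ × ℝ → ℝ) (p : ℝ × ℝ) : ℝ :=
  iteratedFDeriv ℝ (vanishingOrder f) f 0 (fun _ => p)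

/-- `w` is a tangent direction of the set `C` at the origin. -/
def IsTangentDirAt (C : Set (ℝ × ℝ)) (w : ℝ × ℝ) : Prop :=
  ∃ p : ℕ → ℝ × ℝ, (∀ k, p k ∈ C ∧ p k ≠ 0) ∧
    Tendsto p atTop (𝓝 (0:ℝ×ℝ)) ∧
    (Tendsto (fun k => (nrm2 (p k))⁻¹ • p k) atTop (𝓝 w) ∨
     Tendsto (fun k => (nrm2 (p k))⁻¹ • p k) atTop (𝓝 (-w)))

/-- `w` is the direction of one of the lines `l₁, …, l_p`: a line through the origin in the
zero set of the lowest-degree Taylor part of some `fᵢ`, or a tangent line at the origin to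
one of the boundary curves of `E`. -/
def ExceptionalDir (n : ℕ) (f : Fin n → ℝ × ℝ → ℝ) (E : Set (ℝ × ℝ)) (w : ℝ × ℝ) : Prop :=
  (∃ i, lowestPart (f i) w = 0) ∨ IsTangentDirAt (frontier E) w

/-- Conditions (1.2)-(1.3) on the factor `α`: `C¹` away from the origin, bounded by `A`,
with gradient bounded by `A (x²+y²)^{-1/2}`. -/
def AlphaBound (α : ℝ × ℝ → ℝ) (A : ℝ) : Prop :=
  ContDiffOn ℝ 1 α {(0:ℝ×ℝ)}ᶜ ∧ (∀ p, |α p| ≤ A) ∧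
  ∀ p : ℝ × ℝ, p ≠ 0 → ‖fderiv ℝ α p‖ ≤ A * (nrm2 p)⁻¹

/-- A smooth bump function equal to `1` near `(x₀, y₀)`, supported within (Euclidean)
distance `r` of `(x₀, y₀)`. -/
def IsBump (φ : ℝ × ℝ → ℝ) (x₀ y₀ : ℝ) (r : ℝ) : Prop :=
  ContDiff ℝ (⊤ : ℕ∞) φ ∧ HasCompactSupport φ ∧ (∀ᶠ p in 𝓝 ((x₀, y₀) : ℝ × ℝ), φ p = 1) ∧
    tsupport φ ⊆ {p : ℝ × ℝ | (p.1 - x₀) ^ 2 + (p.2 - y₀) ^ 2 < r ^ 2}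

/-- The oscillatory integral `∫_S h(x,y) e^{i(tx+uy)} dx dy`. -/
def oscInt (h : ℝ × ℝ → ℝ) (S : Set (ℝ × ℝ)) (t u : ℝ) : ℂ :=
  ∫ p in S, (h p : ℂ) * Complex.exp (Complex.I * ((t : ℂ) * (p.1 : ℂ) + (u : ℂ) * (p.2 : ℂ)))

/-- The convolution kernel `K(t,u) = ∫ m(x,y) e^{i(tx+uy)} dx dy`. -/
def Kfull (m : ℝ × ℝ → ℝ) (t u : ℝ) : ℂ :=
  oscInt m Set.univ t u

/-- The localized kernel `K_φ(t,u) = ∫ φ(x,y) m(x,y) e^{i(tx+uy)} dx dy`. -/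
def Kphi (φ m : ℝ × ℝ → ℝ) (t u : ℝ) : ℂ :=
  oscInt (fun p => φ p * m p) Set.univ t u

/-- `k` is a Puiseux function of index `N` on `[0,a]`: `k(x) = k'(x^{1/N})` for a function
`k'` real analytic on an open set containing `[0, a^{1/N}]`; equivalently `x ↦ k(x^N)` is
real analytic. -/
def PuiseuxOn (N : ℕ) (a : ℝ) (k : ℝ → ℝ) : Prop :=
  ∃ (k' : ℝ → ℝ) (I : Set ℝ), IsOpen I ∧ Icc (0:ℝ) (a ^ ((N:ℝ)⁻¹)) ⊆ I ∧
    AnalyticOnNhd ℝ k' I ∧ ∀ x ∈ Icc (0:ℝ) a, k x = k' (x ^ ((N:ℝ)⁻¹))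

/-- `k(x) = l·x^s + higher order terms` as `x → 0⁺`. -/
def LeadingTerm (k : ℝ → ℝ) (l s : ℝ) : Prop :=
  Tendsto (fun x => k x / x ^ s) (𝓝[>] (0:ℝ)) (𝓝 l)

/-- The mixed partial derivative `∂_x^l ∂_y^m F`. -/
def pderiv2 (l m : ℕ) (F : ℝ × ℝ → ℝ) (p : ℝ × ℝ) : ℝ :=
  iteratedDeriv l (fun x => iteratedDeriv m (fun y => F (x, y)) p.2) p.1

/-- The descending product `α(α−1)⋯(α−l+1)`. -/
def descProd (α : ℝ) (l : ℕ) : ℝ := ∏ j ∈ Finset.range l, (α - (j : ℝ))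

/-- The sliver `{(x,y) : 0 < x < a, g(x) < y < G(x)}`. -/
def sliverSet (a : ℝ) (g G : ℝ → ℝ) : Set (ℝ × ℝ) :=
  {q : ℝ × ℝ | 0 < q.1 ∧ q.1 < a ∧ g q.1 < q.2 ∧ q.2 < G q.1}

/-- A wedge of radius `r₀` at the origin: a region bounded by two lines through the origin
and the circle of radius `r₀`. -/
def IsWedge (r₀ : ℝ) (W : Set (ℝ × ℝ)) : Prop :=
  ∃ θ₁ θ₂ : ℝ, θ₁ < θ₂ ∧ θ₂ ≤ θ₁ + 2 * π ∧
    W = {p : ℝ × ℝ | ∃ ρ θ : ℝ, 0 < ρ ∧ ρ < r₀ ∧ θ₁ < θ ∧ θ < θ₂ ∧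
      p = (ρ * Real.cos θ, ρ * Real.sin θ)}

local notation "Q2" => ℝ × ℝ

local notation "RR" => ℝ

def ee (θ : RR) : ℂ := Complex.exp (Complex.I * θ)

lemma norm_ee (θ : RR) : ‖ee θ‖ = 1 := by
  unfold ee; rw [mul_comm]; exact Complex.norm_exp_ofReal_mul_I θ

lemma ee_add (a b : RR) : ee (a + b) = ee a * ee b := by
  unfold ee; rw [← Complex.exp_add]; push_cast; ring_nf

lemma continuous_ee : Continuous ee := by unfold ee; fun_prop

lemma conj_ee (θ : RR) : (starRingEnd ℂ) (ee θ) = ee (-θ) := by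
  unfold ee; rw [← Complex.exp_conj]; simp

lemma hasDerivAt_ee {Φ : RR → RR} {d x : RR} (h : HasDerivAt Φ d x) :
    HasDerivAt (fun x => ee (Φ x)) (Complex.I * d * ee (Φ x)) x := by
  unfold ee
  have := ((h.ofReal_comp).const_mul Complex.I).cexp
  convert this using 1; ring

lemma vdc1 {Φ Φ' Φ'' : RR → RR} {a b m : RR} (hab : a ≤ b) (hm : 0 < m)
    (h1 : ∀ x ∈ Icc a b, HasDerivAt Φ (Φ' x) x) (h2 : ∀ x ∈ Icc a b, HasDerivAt Φ' (Φ'' x) x)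
    (hc : ContinuousOn Φ'' (Icc a b)) (hs : ∀ x ∈ Icc a b, 0 ≤ Φ'' x)
    (hl : ∀ x ∈ Icc a b, m ≤ |Φ' x|) : ‖∫ x in a..b, ee (Φ x)‖ ≤ 4 / m := by
  have hne : ∀ x ∈ Icc a b, Φ' x ≠ 0 := fun x hx h0 => by
    have := hl x hx; rw [h0, abs_zero] at this; linarith
  have hneC : ∀ x ∈ Icc a b, (Φ' x : ℂ) ≠ 0 := fun x hx => by exact_mod_cast hne x hx
  have hcΦ : ContinuousOn Φ (Icc a b) := fun x hx => (h1 x hx).continuousAt.continuousWithinAt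
  have hcΦ' : ContinuousOn Φ' (Icc a b) := fun x hx => (h2 x hx).continuousAt.continuousWithinAt
  have huI : uIcc a b = Icc a b := uIcc_of_le hab
  have hinv : ∀ x ∈ Icc a b, HasDerivAt (fun x => (Φ' x)⁻¹) (-(Φ'' x) / (Φ' x)^2) x :=
    fun x hx => (h2 x hx).fun_inv (hne x hx)
  have hcint : ContinuousOn (fun x => -(Φ'' x) / (Φ' x)^2) (Icc a b) :=
    (hc.neg).div (hcΦ'.pow 2) (fun x hx => pow_ne_zero 2 (hne x hx))
  have hu : ∀ x ∈ uIcc a b, HasDerivAt (fun x => -Complex.I * ((Φ' x)⁻¹ : RR))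
      (-Complex.I * ((-(Φ'' x) / (Φ' x)^2 : RR) : ℂ)) x := fun x hx =>
    ((hinv x (huI ▸ hx)).ofReal_comp).const_mul _
  have hv : ∀ x ∈ uIcc a b, HasDerivAt (fun x => ee (Φ x)) (Complex.I * Φ' x * ee (Φ x)) x :=
    fun x hx => hasDerivAt_ee (h1 x (huI ▸ hx))
  have hcee : ContinuousOn (fun x => ee (Φ x)) (Icc a b) := continuous_ee.comp_continuousOn hcΦ
  have hui : IntervalIntegrable (fun x => -Complex.I * ((-(Φ'' x) / (Φ' x)^2 : RR) : ℂ)) volume a b := by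
    apply ContinuousOn.intervalIntegrable; rw [huI]
    exact continuousOn_const.mul (Complex.continuous_ofReal.comp_continuousOn hcint)
  have hvi : IntervalIntegrable (fun x => Complex.I * Φ' x * ee (Φ x)) volume a b := by
    apply ContinuousOn.intervalIntegrable; rw [huI]
    exact (continuousOn_const.mul (Complex.continuous_ofReal.comp_continuousOn hcΦ')).mul hcee
  have key := intervalIntegral.integral_mul_deriv_eq_deriv_mul hu hv hui hvi
  have e1 : ∫ x in a..b, (-Complex.I * ((Φ' x)⁻¹ : RR)) * (Complex.I * Φ' x * ee (Φ x)) =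
      ∫ x in a..b, ee (Φ x) := by
    apply intervalIntegral.integral_congr
    intro x hx
    have := hneC x (huI ▸ hx)
    simp only
    push_cast
    field_simp
    rw [show (Complex.I)^2 = -1 from Complex.I_sq]; ring
  rw [e1] at key
  rw [key]
  have hbnd : ∀ x ∈ Icc a b, |(Φ' x)⁻¹| ≤ 1 / m := fun x hx => by
    rw [abs_inv, ← one_div]; exact one_div_le_one_div_of_le hm (hl x hx)
  have e2 : ‖∫ x in a..b, (-Complex.I * ((-(Φ'' x) / (Φ' x)^2 : RR) : ℂ)) * ee (Φ x)‖ ≤ 2 / m := by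
    have : ‖∫ x in a..b, (-Complex.I * ((-(Φ'' x) / (Φ' x)^2 : RR) : ℂ)) * ee (Φ x)‖ ≤
      ∫ x in a..b, -(-(Φ'' x) / (Φ' x)^2) := by
      apply intervalIntegral.norm_integral_le_of_norm_le hab
      · refine ae_of_all _ fun x hx => ?_
        have hx' : x ∈ Icc a b := ⟨hx.1.le, hx.2⟩
        rw [norm_mul, norm_ee, norm_mul, norm_neg, Complex.norm_I, one_mul, mul_one,
          Complex.norm_real, norm_eq_abs, abs_of_nonpos]
        exact div_nonpos_of_nonpos_of_nonneg (by linarith [hs x hx']) (sq_nonneg _)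
      · apply ContinuousOn.intervalIntegrable; rw [huI]; exact hcint.neg
    refine this.trans ?_
    rw [intervalIntegral.integral_neg, intervalIntegral.integral_eq_sub_of_hasDerivAt
      (fun x hx => hinv x (huI ▸ hx)) (by
        apply ContinuousOn.intervalIntegrable; rw [huI]; exact hcint)]
    have ha := abs_le.1 (hbnd a ⟨le_rfl, hab⟩)
    have hb := abs_le.1 (hbnd b ⟨hab, le_rfl⟩)
    have : 2 / m = 1 / m + 1 / m := by ring
    linarith [ha.2, hb.1]
  have e3 : ∀ x ∈ Icc a b, ‖-Complex.I * ((Φ' x)⁻¹ : RR) * ee (Φ x)‖ ≤ 1 / m := fun x hx => by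
    rw [norm_mul, norm_ee, norm_mul, norm_neg, Complex.norm_I, one_mul, mul_one,
      Complex.norm_real, norm_eq_abs]; exact hbnd x hx
  have ha := e3 a ⟨le_rfl, hab⟩
  have hb := e3 b ⟨hab, le_rfl⟩
  refine (norm_sub_le _ _).trans ?_
  have := (norm_sub_le (-Complex.I * ((Φ' b)⁻¹ : RR) * ee (Φ b)) (-Complex.I * ((Φ' a)⁻¹ : RR) * ee (Φ a)))
  have h4 : 4 / m = 1 / m + 1 / m + 2 / m := by ring
  linarith

lemma norm_int_ee_neg (Φ : RR → RR) (a b : RR) :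
    ‖∫ x in a..b, ee (-(Φ x))‖ = ‖∫ x in a..b, ee (Φ x)‖ := by
  rw [← Complex.norm_conj (∫ x in a..b, ee (Φ x))]
  congr 1
  rw [intervalIntegral, intervalIntegral, map_sub, ← integral_conj, ← integral_conj]
  simp only [conj_ee]

lemma vdc1' {Φ Φ' Φ'' : RR → RR} {a b m : RR} (hab : a ≤ b) (hm : 0 < m)
    (h1 : ∀ x ∈ Icc a b, HasDerivAt Φ (Φ' x) x) (h2 : ∀ x ∈ Icc a b, HasDerivAt Φ' (Φ'' x) x)
    (hc : ContinuousOn Φ'' (Icc a b))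
    (hs : (∀ x ∈ Icc a b, 0 ≤ Φ'' x) ∨ (∀ x ∈ Icc a b, Φ'' x ≤ 0))
    (hl : ∀ x ∈ Icc a b, m ≤ |Φ' x|) : ‖∫ x in a..b, ee (Φ x)‖ ≤ 4 / m := by
  rcases hs with hs | hs
  · exact vdc1 hab hm h1 h2 hc hs hl
  · rw [← norm_int_ee_neg]
    exact vdc1 (Φ' := fun x => -Φ' x) (Φ'' := fun x => -Φ'' x) hab hm (fun x hx => (h1 x hx).neg)
      (fun x hx => (h2 x hx).neg) hc.neg (fun x hx => by linarith [hs x hx])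
      (fun x hx => by rw [abs_neg]; exact hl x hx)

lemma norm_int_ee_le (Φ : RR → RR) {a b : RR} (hab : a ≤ b) : ‖∫ x in a..b, ee (Φ x)‖ ≤ b - a := by
  have := intervalIntegral.norm_integral_le_of_norm_le_const (a := a) (b := b) (C := 1)
    (f := fun x => ee (Φ x)) (fun x _ => (norm_ee _).le)
  rwa [one_mul, abs_of_nonneg (by linarith)] at this

lemma vdc2 {Φ Φ' Φ'' : RR → RR} {a b κ : RR} (hab : a ≤ b) (hκ : 0 < κ)
    (h1 : ∀ x ∈ Icc a b, HasDerivAt Φ (Φ' x) x) (h2 : ∀ x ∈ Icc a b, HasDerivAt Φ' (Φ'' x) x)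
    (hc : ContinuousOn Φ'' (Icc a b))
    (hs : ∀ x ∈ Icc a b, κ ≤ Φ'' x) : ‖∫ x in a..b, ee (Φ x)‖ ≤ 10 / √κ := by
  have hcΦ : ContinuousOn Φ (Icc a b) := fun x hx => (h1 x hx).continuousAt.continuousWithinAt
  have hcΦ' : ContinuousOn Φ' (Icc a b) := fun x hx => (h2 x hx).continuousAt.continuousWithinAt
  have hs0 : 0 < √κ := sqrt_pos.2 hκ
  have hss : √κ * √κ = κ := mul_self_sqrt hκ.le
  -- monotone growth
  have grow : ∀ x ∈ Icc a b, ∀ y ∈ Icc a b, x ≤ y → κ * (y - x) ≤ Φ' y - Φ' x := by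
    apply (convex_Icc a b).mul_sub_le_image_sub_of_le_deriv hcΦ'
    · intro x hx
      exact (h2 x (interior_subset hx)).differentiableAt.differentiableWithinAt
    · intro x hx
      rw [(h2 x (interior_subset hx)).deriv]; exact hs x (interior_subset hx)
  obtain ⟨c, hcI, hcr, hcl⟩ : ∃ c ∈ Icc a b, (∀ x ∈ Icc a b, c < x → κ * (x - c) ≤ Φ' x) ∧
      (∀ x ∈ Icc a b, x < c → Φ' x ≤ -(κ * (c - x))) := by
    by_cases hA : 0 ≤ Φ' a
    · refine ⟨a, ⟨le_rfl, hab⟩, fun x hx hlt => ?_, fun x hx hlt => absurd hx.1 (not_le.2 hlt)⟩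
      have := grow a ⟨le_rfl, hab⟩ x hx hlt.le; linarith
    by_cases hB : Φ' b ≤ 0
    · refine ⟨b, ⟨hab, le_rfl⟩, fun x hx hlt => absurd hx.2 (not_le.2 hlt), fun x hx hlt => ?_⟩
      have := grow x hx b ⟨hab, le_rfl⟩ hlt.le; linarith
    push Not at hA hB
    obtain ⟨c, hc, hc0⟩ := intermediate_value_Icc hab hcΦ' (show (0:RR) ∈ Icc (Φ' a) (Φ' b) from ⟨hA.le, hB.le⟩)
    refine ⟨c, hc, fun x hx hlt => ?_, fun x hx hlt => ?_⟩
    · have := grow c hc x hx hlt.le; linarith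
    · have := grow x hx c hc hlt.le; linarith
  set ρ := 1 / √κ with hρ
  have hρ0 : 0 < ρ := by positivity
  have hκρ : κ * ρ = √κ := by rw [hρ]; field_simp; nlinarith
  set c1 := max a (c - ρ)
  set c2 := min b (c + ρ)
  have hac1 : a ≤ c1 := le_max_left _ _
  have hc1c : c1 ≤ c := max_le hcI.1 (by linarith)
  have hcc2 : c ≤ c2 := le_min hcI.2 (by linarith)
  have hc2b : c2 ≤ b := min_le_left _ _
  have hint : ∀ x y, a ≤ x → x ≤ y → y ≤ b → IntervalIntegrable (fun x => ee (Φ x)) volume x y := by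
    intro x y hx hxy hy
    apply ContinuousOn.intervalIntegrable
    rw [uIcc_of_le hxy]
    exact (continuous_ee.comp_continuousOn hcΦ).mono (Icc_subset_Icc hx hy)
  have I1 : ‖∫ x in a..c1, ee (Φ x)‖ ≤ 4 / √κ := by
    have hsub : Icc a c1 ⊆ Icc a b := Icc_subset_Icc_right (by linarith)
    rcases le_total (c - ρ) a with h | h
    · have : c1 = a := max_eq_left h
      rw [this]; simp; positivity
    · have hc1e : c1 = c - ρ := max_eq_right h
      refine vdc1 hac1 hs0 (fun x hx => h1 x (hsub hx)) (fun x hx => h2 x (hsub hx)) (hc.mono hsub)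
        (fun x hx => hκ.le.trans (hs x (hsub hx))) (fun x hx => ?_)
      have hx2 := hx.2
      have := hcl x (hsub hx) (by linarith)
      have h3 : κ * ρ ≤ κ * (c - x) := mul_le_mul_of_nonneg_left (by linarith) hκ.le
      exact le_abs.2 (Or.inr (by linarith))
  have I3 : ‖∫ x in c2..b, ee (Φ x)‖ ≤ 4 / √κ := by
    have hsub : Icc c2 b ⊆ Icc a b := Icc_subset_Icc_left (by linarith)
    rcases le_total b (c + ρ) with h | h
    · have : c2 = b := min_eq_left h
      rw [this]; simp; positivity
    · have hc1e : c2 = c + ρ := min_eq_right h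
      refine vdc1 hc2b hs0 (fun x hx => h1 x (hsub hx)) (fun x hx => h2 x (hsub hx)) (hc.mono hsub)
        (fun x hx => hκ.le.trans (hs x (hsub hx))) (fun x hx => ?_)
      have hx2 := hx.1
      have := hcr x (hsub hx) (by linarith)
      have h3 : κ * ρ ≤ κ * (x - c) := mul_le_mul_of_nonneg_left (by linarith) hκ.le
      exact le_abs.2 (Or.inl (by linarith))
  have I2 : ‖∫ x in c1..c2, ee (Φ x)‖ ≤ 2 / √κ := by
    refine (norm_int_ee_le Φ (by linarith)).trans ?_
    have h1 : c - ρ ≤ c1 := le_max_right _ _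
    have h2 : c2 ≤ c + ρ := min_le_right _ _
    have : 2 / √κ = 2 * ρ := by rw [hρ]; ring
    linarith
  have e : ∫ x in a..b, ee (Φ x) = (∫ x in a..c1, ee (Φ x)) + (∫ x in c1..c2, ee (Φ x)) +
      ∫ x in c2..b, ee (Φ x) := by
    rw [intervalIntegral.integral_add_adjacent_intervals (hint _ _ le_rfl hac1 (by linarith))
      (hint _ _ hac1 (by linarith) hc2b), intervalIntegral.integral_add_adjacent_intervals
      (hint _ _ le_rfl (by linarith) hc2b) (hint _ _ (by linarith) hc2b le_rfl)]
  rw [e]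
  have h10 : 10 / √κ = 4 / √κ + 2 / √κ + 4 / √κ := by ring
  rw [h10]
  exact (norm_add₃_le).trans (by linarith)

lemma vdc2' {Φ Φ' Φ'' : RR → RR} {a b κ : RR} (hab : a ≤ b) (hκ : 0 < κ)
    (h1 : ∀ x ∈ Icc a b, HasDerivAt Φ (Φ' x) x) (h2 : ∀ x ∈ Icc a b, HasDerivAt Φ' (Φ'' x) x)
    (hc : ContinuousOn Φ'' (Icc a b))
    (hs : (∀ x ∈ Icc a b, κ ≤ Φ'' x) ∨ (∀ x ∈ Icc a b, Φ'' x ≤ -κ)) :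
    ‖∫ x in a..b, ee (Φ x)‖ ≤ 10 / √κ := by
  rcases hs with hs | hs
  · exact vdc2 hab hκ h1 h2 hc hs
  · rw [← norm_int_ee_neg]
    exact vdc2 (Φ' := fun x => -Φ' x) (Φ'' := fun x => -Φ'' x) hab hκ (fun x hx => (h1 x hx).neg)
      (fun x hx => (h2 x hx).neg) hc.neg (fun x hx => by linarith [hs x hx])

/-- sup bound by average and total variation -/
lemma endpoint_bound {h h' G : RR → RR} {a b C : RR} (hab : a < b)
    (hd : ∀ x ∈ Icc a b, HasDerivAt h (h' x) x) (hG : IntervalIntegrable G volume a b)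
    (hh : ∀ x ∈ Icc a b, |h x| ≤ C * (b - a) * G x) (hh' : ∀ x ∈ Icc a b, |h' x| ≤ C * G x)
    (hi : IntervalIntegrable h' volume a b) :
    ∀ y ∈ Icc a b, |h y| ≤ 2 * (C * ∫ x in a..b, G x) := by
  intro y hy
  have hba : 0 < b - a := by linarith
  have hab' := hab.le
  have hCG : IntervalIntegrable (fun x => C * G x) volume a b := hG.const_mul C
  have hvar : ∀ x ∈ Icc a b, |h y| ≤ |h x| + C * ∫ x in a..b, G x := by
    intro x hx
    have e : h y - h x = ∫ s in x..y, h' s := by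
      rw [intervalIntegral.integral_eq_sub_of_hasDerivAt]
      · intro s hs
        exact hd s (uIcc_subset_Icc hx hy hs)
      · exact hi.mono_set (by rw [uIcc_of_le hab']; exact uIcc_subset_Icc hx hy)
    have e2 : |∫ s in x..y, h' s| ≤ ∫ x in a..b, C * G x := by
      rw [← norm_eq_abs]
      refine (intervalIntegral.norm_integral_le_integral_norm_uIoc).trans ?_
      rw [intervalIntegral.integral_of_le hab']
      have hsub : uIoc x y ⊆ Ioc a b := by
        rw [uIoc]; exact Ioc_subset_Ioc (le_min hx.1 hy.1) (max_le hx.2 hy.2)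
      refine (setIntegral_mono_on ?_ ?_ measurableSet_uIoc (g := fun x => C * G x) ?_).trans ?_
      · exact IntegrableOn.mono_set (Integrable.norm ((intervalIntegrable_iff_integrableOn_Ioc_of_le hab').1 hi)) hsub
      · exact ((intervalIntegrable_iff_integrableOn_Ioc_of_le hab').1 hCG).mono_set hsub
      · intro s hs
        exact hh' s (Ioc_subset_Icc_self (hsub hs))
      · refine setIntegral_mono_set ((intervalIntegrable_iff_integrableOn_Ioc_of_le hab').1 hCG) ?_
          hsub.eventuallyLE
        filter_upwards [ae_restrict_mem measurableSet_Ioc] with s hs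
        exact (abs_nonneg _).trans (hh' s (Ioc_subset_Icc_self hs))
    rw [intervalIntegral.integral_const_mul] at e2
    have : |h y| ≤ |h x| + |h y - h x| := by
      have := abs_add_le (h x) (h y - h x); simpa using this
    rw [e] at this; linarith
  have hint : ∫ x in a..b, |h y| ≤ ∫ x in a..b, ((b - a) * (C * G x) + C * ∫ x in a..b, G x) := by
    apply intervalIntegral.integral_mono_on hab' (by simp) ((hCG.const_mul _).add (by simp))
    intro x hx
    have := hvar x hx
    have h2 := hh x hx
    calc _ ≤ _ := this
      _ ≤ _ := by gcongr; linarith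
  rw [intervalIntegral.integral_add (hCG.const_mul _) (by simp), intervalIntegral.integral_const_mul,
    intervalIntegral.integral_const_mul, intervalIntegral.integral_const,
    intervalIntegral.integral_const, smul_eq_mul, smul_eq_mul, ← mul_add] at hint
  have := le_of_mul_le_mul_left hint hba
  linarith

lemma amp_bound {h h' G Φ : RR → RR} {a b C M : RR} (hab : a < b)
    (hd : ∀ x ∈ Icc a b, HasDerivAt h (h' x) x) (hG : IntervalIntegrable G volume a b)
    (hh : ∀ x ∈ Icc a b, |h x| ≤ C * (b - a) * G x) (hh' : ∀ x ∈ Icc a b, |h' x| ≤ C * G x)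
    (hi : IntervalIntegrable h' volume a b) (hΦ : ContinuousOn Φ (Icc a b))
    (hM : ∀ x ∈ Icc a b, ‖∫ s in a..x, ee (Φ s)‖ ≤ M) :
    ‖∫ x in a..b, (h x : ℂ) * ee (Φ x)‖ ≤ 3 * (C * M * ∫ x in a..b, G x) := by
  have hab' := hab.le
  have hM0 : 0 ≤ M := (norm_nonneg _).trans (hM a ⟨le_rfl, hab'⟩)
  have huI : uIcc a b = Icc a b := uIcc_of_le hab'
  have hcee : ContinuousOn (fun x => ee (Φ x)) (Icc a b) := continuous_ee.comp_continuousOn hΦ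
  have hiee : IntervalIntegrable (fun x => ee (Φ x)) volume a b :=
    ContinuousOn.intervalIntegrable (by rwa [huI])
  have hcE : ContinuousOn (fun x => ∫ s in a..x, ee (Φ s)) (uIcc a b) :=
    intervalIntegral.continuousOn_primitive_interval
      (by rw [huI]; exact (hcee.integrableOn_Icc))
  have key := intervalIntegral.integral_mul_deriv_eq_deriv_mul_of_hasDerivAt
    (u := fun x => (h x : ℂ)) (u' := fun x => (h' x : ℂ)) (v := fun x => ∫ s in a..x, ee (Φ s))
    (v' := fun x => ee (Φ x)) (a := a) (b := b)
    (by rw [huI]; exact fun x hx => (hd x hx).ofReal_comp.continuousAt.continuousWithinAt) hcE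
    (by
      rw [min_eq_left hab', max_eq_right hab']
      exact fun x hx => (hd x (Ioo_subset_Icc_self hx)).ofReal_comp)
    (by
      rw [min_eq_left hab', max_eq_right hab']
      intro x hx
      have hn : Icc a b ∈ 𝓝 x := Icc_mem_nhds hx.1 hx.2
      apply intervalIntegral.integral_hasDerivAt_right
      · apply hiee.mono_set; rw [huI, uIcc_of_le hx.1.le]; exact Icc_subset_Icc_right hx.2.le
      · exact hcee.stronglyMeasurableAtFilter_nhdsWithin measurableSet_Icc x |>.filter_mono
          (by rw [nhdsWithin_eq_nhds.2 hn])
      · exact (hcee x (Ioo_subset_Icc_self hx)).continuousAt hn)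
    (by
      constructor
      · exact hi.1.ofReal
      · exact hi.2.ofReal) hiee
  rw [key]
  simp only [intervalIntegral.integral_same, mul_zero, sub_zero]
  have hb := endpoint_bound hab hd hG hh hh' hi b ⟨hab', le_rfl⟩
  have hbM := hM b ⟨hab', le_rfl⟩
  have e1 : ‖(h b : ℂ) * ∫ s in a..b, ee (Φ s)‖ ≤ 2 * (C * ∫ x in a..b, G x) * M := by
    rw [norm_mul, Complex.norm_real, norm_eq_abs]
    exact mul_le_mul hb hbM (norm_nonneg _) ((abs_nonneg _).trans hb)
  have e2 : ‖∫ x in a..b, (h' x : ℂ) * ∫ s in a..x, ee (Φ s)‖ ≤ ∫ x in a..b, C * M * G x := by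
    apply intervalIntegral.norm_integral_le_of_norm_le hab'
    · refine ae_of_all _ fun x hx => ?_
      have hx' : x ∈ Icc a b := ⟨hx.1.le, hx.2⟩
      rw [norm_mul, Complex.norm_real, norm_eq_abs]
      have := mul_le_mul (hh' x hx') (hM x hx') (norm_nonneg _) ((abs_nonneg _).trans (hh' x hx'))
      linarith
    · exact hG.const_mul _
  rw [intervalIntegral.integral_const_mul] at e2
  refine (norm_sub_le _ _).trans ?_
  linarith

/-- the weight -/
def Wt (l s : RR) : RR := (√(max 1 (l * |s|)))⁻¹

lemma Wt_pos (l s : RR) : 0 < Wt l s :=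
  inv_pos.2 (sqrt_pos.2 (lt_of_lt_of_le one_pos (le_max_left _ _)))

lemma Wt_le_one (l s : RR) : Wt l s ≤ 1 := by
  apply inv_le_one_of_one_le₀
  rw [one_le_sqrt]; exact le_max_left _ _

lemma continuous_Wt (l : RR) : Continuous (Wt l) := by
  unfold Wt
  apply Continuous.inv₀ (by fun_prop)
  intro s
  exact (sqrt_pos.2 (lt_of_lt_of_le one_pos (le_max_left _ _))).ne'

lemma Wt_lower {l s c T : RR} (hc : 1 ≤ c) (hT : 1 ≤ T) (h : l * |s| ≤ c * T) :
    1 / (c * √T) ≤ Wt l s := by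
  have hsT : 0 < √T := sqrt_pos.2 (by linarith)
  unfold Wt
  rw [one_div]
  apply inv_anti₀ (sqrt_pos.2 (lt_of_lt_of_le one_pos (le_max_left _ _)))
  rw [sqrt_le_left (by positivity)]
  have e : (c * √T)^2 = c^2 * T := by rw [mul_pow, sq_sqrt (by linarith)]
  rw [e]
  apply max_le
  · nlinarith
  · nlinarith

lemma Wt_lower' {l s c T : RR} (hc : 1 ≤ c) (hT : 1 ≤ T) (h : l * |s| ≤ c * T) :
    1 / (c * T) ≤ Wt l s := by
  refine le_trans ?_ (Wt_lower hc hT h)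
  have hsT : 0 < √T := sqrt_pos.2 (by linarith)
  apply one_div_le_one_div_of_le (by positivity)
  gcongr
  rw [sqrt_le_left (by linarith)]; nlinarith

lemma tail_bound {h G : RR → RR} {Z R C μ : RR} (hZ : 0 < Z) (hμ : μ ≠ 0) (hC : 0 ≤ C)
    (hG0 : ∀ z, 0 ≤ G z) (hG : IntegrableOn G (Ioi Z))
    (hd : ∀ z, Z ≤ z → DifferentiableAt RR h z) (hh : ∀ z, Z ≤ z → |h z| ≤ C * G z)
    (hh' : ∀ z, Z ≤ z → |deriv h z| ≤ C * (G z / z)) (hR : ∀ z, R < z → h z = 0) :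
    ‖∫ z in Ioi Z, (h z : ℂ) * ee (μ * z)‖ ≤ 5 * C / |μ| * ∫ z in Ioi Z, G z / z := by
  set R' := max R (2 * Z) + 1 with hR'
  have hRR : R < R' := by have := le_max_left R (2*Z); linarith
  have h2Z : 2 * Z < R' := by have := le_max_right R (2*Z); linarith
  have hZR : Z ≤ R' := by linarith
  have hGz : IntegrableOn (fun z => G z / z) (Ioi Z) := by
    refine Integrable.mono' (hG.const_mul (1 / Z)) ?_ ?_
    · exact (hG.aestronglyMeasurable.aemeasurable.div aemeasurable_id').aestronglyMeasurable
    · filter_upwards [ae_restrict_mem measurableSet_Ioi] with z hz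
      have hz' : Z < z := hz
      have hz0 : 0 < z := hZ.trans hz'
      rw [norm_eq_abs, abs_of_nonneg (div_nonneg (hG0 z) hz0.le), div_eq_mul_one_div, mul_comm]
      apply mul_le_mul_of_nonneg_right _ (hG0 z)
      exact one_div_le_one_div_of_le hZ hz'.le
  have hGzi : ∀ b, Z ≤ b → IntervalIntegrable (fun z => G z / z) volume Z b := fun b hb =>
    (intervalIntegrable_iff_integrableOn_Ioc_of_le hb).2 (hGz.mono_set Ioc_subset_Ioi_self)
  have hdi : ∀ b, Z ≤ b → IntervalIntegrable (deriv h) volume Z b := fun b hb => by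
    rw [intervalIntegrable_iff_integrableOn_Ioc_of_le hb]
    refine Integrable.mono' ((hGz.mono_set (show Ioc Z b ⊆ Ioi Z from Ioc_subset_Ioi_self)).const_mul C)
      (measurable_deriv h).aestronglyMeasurable ?_
    filter_upwards [ae_restrict_mem measurableSet_Ioc] with z hz
    exact hh' z hz.1.le
  have hle : ∀ b, Z ≤ b → ∫ z in Z..b, G z / z ≤ ∫ z in Ioi Z, G z / z := fun b hb => by
    rw [intervalIntegral.integral_of_le hb]
    apply setIntegral_mono_set hGz _ Ioc_subset_Ioi_self.eventuallyLE
    filter_upwards [ae_restrict_mem measurableSet_Ioi] with z hz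
    exact div_nonneg (hG0 z) (hZ.trans hz).le
  have e0 : ∫ z in Ioi Z, (h z : ℂ) * ee (μ * z) = ∫ z in Z..R', (h z : ℂ) * ee (μ * z) := by
    rw [intervalIntegral.integral_of_le hZR]
    apply setIntegral_eq_of_subset_of_forall_sdiff_eq_zero measurableSet_Ioi Ioc_subset_Ioi_self
    intro z hz
    have : R' < z := by
      by_contra hcon; exact hz.2 ⟨hz.1, not_lt.1 hcon⟩
    rw [hR z (by linarith)]; simp
  have hIμ : (Complex.I * μ) ≠ 0 := mul_ne_zero Complex.I_ne_zero (by exact_mod_cast hμ)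
  have key := intervalIntegral.integral_mul_deriv_eq_deriv_mul
    (u := fun z => (h z : ℂ)) (u' := fun z => ((deriv h z : RR) : ℂ))
    (v := fun z => ee (μ * z) / (Complex.I * μ)) (v' := fun z => ee (μ * z)) (a := Z) (b := R')
    (fun z hz => by
      rw [uIcc_of_le hZR] at hz
      exact (hd z hz.1).hasDerivAt.ofReal_comp)
    (fun z hz => by
      have h1 : HasDerivAt (fun z => μ * z) μ z := by simpa using (hasDerivAt_id z).const_mul μ
      have := (hasDerivAt_ee h1).div_const (Complex.I * μ)
      convert this using 1
      exact (mul_div_cancel_left₀ _ hIμ).symm)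
    ⟨(hdi R' hZR).1.ofReal, (hdi R' hZR).2.ofReal⟩
    (Continuous.intervalIntegrable (continuous_ee.comp (by fun_prop)) _ _)
  rw [e0, key, hR R' hRR]
  have hv : ∀ z, ‖ee (μ * z) / (Complex.I * μ)‖ = 1 / |μ| := fun z => by
    rw [norm_div, norm_ee, norm_mul, Complex.norm_I, one_mul, Complex.norm_real, norm_eq_abs]
  have hb := endpoint_bound (h := h) (h' := deriv h) (G := fun z => G z / z) (a := Z) (b := 2 * Z)
    (C := 2 * C) (by linarith)
    (fun z hz => (hd z hz.1).hasDerivAt) (hGzi _ (by linarith))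
    (fun z hz => by
      have hz0 : 0 < z := hZ.trans_le hz.1
      refine (hh z hz.1).trans ?_
      have : 2 * C * (2 * Z - Z) * (G z / z) = C * (2 * Z / z) * G z := by field_simp; ring
      rw [this]
      apply mul_le_mul_of_nonneg_right _ (hG0 z)
      have : 1 ≤ 2 * Z / z := by rw [le_div_iff₀ hz0]; linarith [hz.2]
      nlinarith)
    (fun z hz => by
      refine (hh' z hz.1).trans ?_
      have : 0 ≤ G z / z := div_nonneg (hG0 z) (hZ.trans_le hz.1).le
      nlinarith [mul_nonneg hC this])
    (hdi _ (by linarith)) Z ⟨le_rfl, by linarith⟩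
  have hI2 : ∫ z in Z..(2*Z), G z / z ≤ ∫ z in Ioi Z, G z / z := hle _ (by linarith)
  have e3 : ‖∫ z in Z..R', ((deriv h z : RR) : ℂ) * (ee (μ * z) / (Complex.I * μ))‖ ≤
      ∫ z in Z..R', C / |μ| * (G z / z) := by
    apply intervalIntegral.norm_integral_le_of_norm_le hZR
    · refine ae_of_all _ fun z hz => ?_
      rw [norm_mul, hv, Complex.norm_real, norm_eq_abs]
      have := mul_le_mul_of_nonneg_right (hh' z hz.1.le) (show 0 ≤ 1 / |μ| by positivity)
      refine this.trans (le_of_eq ?_); ring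
    · exact (hGzi _ hZR).const_mul _
  rw [intervalIntegral.integral_const_mul] at e3
  have hI3 := hle _ hZR
  have hμ' : 0 < |μ| := abs_pos.2 hμ
  have e4 : ‖(h Z : ℂ) * (ee (μ * Z) / (Complex.I * μ))‖ ≤ 4 * C / |μ| * ∫ z in Ioi Z, G z / z := by
    rw [norm_mul, hv, Complex.norm_real, norm_eq_abs]
    have : |h Z| ≤ 4 * C * ∫ z in Ioi Z, G z / z := by nlinarith
    calc _ ≤ (4 * C * ∫ z in Ioi Z, G z / z) * (1 / |μ|) := by gcongr
      _ = _ := by ring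
  have e5 : C / |μ| * ∫ z in Z..R', G z / z ≤ C / |μ| * ∫ z in Ioi Z, G z / z := by gcongr
  simp only [Complex.ofReal_zero, zero_mul, zero_sub]
  refine (norm_sub_le _ _).trans ?_
  rw [norm_neg]
  have : 5 * C / |μ| * ∫ z in Ioi Z, G z / z = 4 * C / |μ| * (∫ z in Ioi Z, G z / z) +
    C / |μ| * ∫ z in Ioi Z, G z / z := by ring
  linarith

lemma tail_bound_neg {h G : RR → RR} {Z R C μ : RR} (hZ : 0 < Z) (hμ : μ ≠ 0) (hC : 0 ≤ C)
    (hG0 : ∀ z, 0 ≤ G z) (hG : IntegrableOn G (Iio (-Z)))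
    (hd : ∀ z, z ≤ -Z → DifferentiableAt RR h z) (hh : ∀ z, z ≤ -Z → |h z| ≤ C * G z)
    (hh' : ∀ z, z ≤ -Z → |deriv h z| ≤ C * (G z / |z|)) (hR : ∀ z, z < -R → h z = 0) :
    ‖∫ z in Iio (-Z), (h z : ℂ) * ee (μ * z)‖ ≤ 5 * C / |μ| * ∫ z in Iio (-Z), G z / |z| := by
  have hG' : IntegrableOn (fun z => G (-z)) (Ioi Z) := by
    have h1 := (Measure.measurePreserving_neg (volume : Measure RR)).integrableOn_comp_preimage
      (Homeomorph.neg RR).measurableEmbedding (f := G) (s := Iio (-Z))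
    have h2 : (Neg.neg ⁻¹' Iio (-Z) : Set RR) = Ioi Z := by ext; simp
    rw [h2] at h1
    exact h1.2 hG
  have := tail_bound (h := fun z => h (-z)) (G := fun z => G (-z)) (Z := Z) (R := R) (C := C) (μ := -μ)
    hZ (neg_ne_zero.2 hμ) hC (fun z => hG0 _) hG'
    (fun z hz => by
      have : DifferentiableAt RR h (-z) := hd (-z) (by linarith)
      exact this.comp z differentiable_neg.differentiableAt)
    (fun z hz => hh (-z) (by linarith))
    (fun z hz => by
      rw [deriv_comp_neg, abs_neg]
      have := hh' (-z) (by linarith)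
      rwa [abs_neg, abs_of_pos (hZ.trans_le hz)] at this)
    (fun z hz => hR _ (by linarith))
  rw [abs_neg] at this
  have e1 : ∫ z in Ioi Z, ((h (-z) : RR) : ℂ) * ee (-μ * z) = ∫ z in Iio (-Z), (h z : ℂ) * ee (μ * z) := by
    rw [← integral_Iic_eq_integral_Iio, ← integral_comp_neg_Ioi]
    simp
  have e2 : ∫ z in Ioi Z, G (-z) / z = ∫ z in Iio (-Z), G z / |z| := by
    rw [← integral_Iic_eq_integral_Iio, ← integral_comp_neg_Ioi Z (fun z => G z / |z|)]
    apply setIntegral_congr_fun measurableSet_Ioi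
    intro z hz
    simp only [abs_neg, abs_of_pos (hZ.trans hz)]
  rwa [e1, e2] at this

/-- oscillation in `x` over a slab, restricted to a set of `z` -/
lemma slab_x {G h : Q2 → RR} {k : RR → RR} {a C M ν μ : RR} (ha : 0 < a) (hG : Integrable G)
    (hG0 : ∀ p, 0 ≤ G p) (hm : AEStronglyMeasurable h volume) (hk : Measurable k)
    (hh : ∀ p, |h p| ≤ C * G p)
    (hx : ∀ x ∈ Icc a (2 * a), ∀ z, z ≠ 0 → DifferentiableAt RR (fun x => h (x, z)) x ∧
      |deriv (fun x => h (x, z)) x| ≤ C / a * G (x, z))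
    (hkc : ContinuousOn k (Icc a (2 * a)))
    (hM : ∀ x ∈ Icc a (2 * a), ‖∫ s in a..x, ee (ν * s + μ * k s)‖ ≤ M) (hM0 : 0 ≤ M)
    {T : Set RR} (hT : MeasurableSet T) :
    ‖∫ p in Ioc a (2 * a) ×ˢ T, (h p : ℂ) * ee (ν * p.1 + μ * (k p.1 + p.2))‖ ≤
      3 * C / a * M * ∫ p in Ioc a (2 * a) ×ˢ T, G p := by
  have hab : a < 2 * a := by linarith
  have hFi : Integrable (fun p : Q2 => (h p : ℂ) * ee (ν * p.1 + μ * (k p.1 + p.2))) := by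
    refine Integrable.mono' (hG.const_mul C) ?_ (ae_of_all _ fun p => ?_)
    · refine (Complex.continuous_ofReal.comp_aestronglyMeasurable hm).mul ?_
      exact (continuous_ee.measurable.comp (by fun_prop)).aestronglyMeasurable
    · rw [norm_mul, norm_ee, mul_one, Complex.norm_real]; exact hh p
  have hr : (volume : Measure Q2).restrict (Ioc a (2 * a) ×ˢ T) =
      (volume.restrict (Ioc a (2 * a))).prod (volume.restrict T) := by
    rw [Measure.prod_restrict]; rfl
  have hF' := hFi.integrableOn (s := Ioc a (2 * a) ×ˢ T)
  have hG' := hG.integrableOn (s := Ioc a (2 * a) ×ˢ T)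
  rw [IntegrableOn, hr] at hF' hG'
  rw [hr, integral_prod_symm _ hF', integral_prod_symm _ hG', ← integral_const_mul]
  apply norm_integral_le_of_norm_le (hG'.integral_prod_right.const_mul _)
  have hne : ∀ᵐ z ∂(volume.restrict T), z ≠ (0:RR) :=
    ae_restrict_of_ae (by simp [ae_iff])
  filter_upwards [hne, hG'.prod_left_ae] with z hz hGz
  have hGi : IntervalIntegrable (fun x => G (x, z)) volume a (2 * a) :=
    (intervalIntegrable_iff_integrableOn_Ioc_of_le hab.le).2 hGz
  have e : ∫ x in Ioc a (2 * a), (h (x, z) : ℂ) * ee (ν * x + μ * (k x + z)) =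
      (∫ x in a..(2 * a), (h (x, z) : ℂ) * ee (ν * x + μ * k x)) * ee (μ * z) := by
    rw [intervalIntegral.integral_of_le hab.le, ← integral_mul_const]
    congr 1; ext x
    rw [mul_assoc, ← ee_add]; congr 2; ring
  rw [e, norm_mul, norm_ee, mul_one]
  have := amp_bound (h := fun x => h (x, z)) (h' := deriv (fun x => h (x, z))) (G := fun x => G (x, z))
    (Φ := fun x => ν * x + μ * k x) (a := a) (b := 2 * a) (C := C / a) (M := M) hab
    (fun x hx' => (hx x hx' z hz).1.hasDerivAt) hGi
    (fun x hx' => by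
      refine (hh (x, z)).trans (le_of_eq ?_)
      field_simp; ring)
    (fun x hx' => (hx x hx' z hz).2)
    (by
      rw [intervalIntegrable_iff_integrableOn_Ioc_of_le hab.le]
      refine Integrable.mono' (hGz.const_mul (C / a)) (measurable_deriv _).aestronglyMeasurable ?_
      filter_upwards [ae_restrict_mem measurableSet_Ioc] with x hx'
      exact (hx x ⟨hx'.1.le, hx'.2⟩ z hz).2)
    (by fun_prop) hM
  refine this.trans (le_of_eq ?_)
  rw [← intervalIntegral.integral_of_le hab.le]
  ring

lemma slab_triv {G h : Q2 → RR} {k : RR → RR} {C ν μ : RR} (hG : Integrable G)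
    (hh : ∀ p, |h p| ≤ C * G p) (S : Set Q2) :
    ‖∫ p in S, (h p : ℂ) * ee (ν * p.1 + μ * (k p.1 + p.2))‖ ≤ C * ∫ p in S, G p := by
  rw [← integral_const_mul]
  apply norm_integral_le_of_norm_le (hG.integrableOn.const_mul C)
  refine ae_of_all _ fun p => ?_
  rw [norm_mul, norm_ee, mul_one, Complex.norm_real]; exact hh p

lemma slab_z {G h : Q2 → RR} {k : RR → RR} {a R C Z ν μ : RR} (hZ : 0 < Z) (hμ : μ ≠ 0)
    (hC : 0 ≤ C) (hG : Integrable G)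
    (hG0 : ∀ p, 0 ≤ G p) (hm : AEStronglyMeasurable h volume) (hk : Measurable k)
    (hh : ∀ p, |h p| ≤ C * G p)
    (hz : ∀ x ∈ Icc a (2 * a), ∀ z, z ≠ 0 → DifferentiableAt RR (fun z => h (x, z)) z ∧
      |deriv (fun z => h (x, z)) z| ≤ C * (G (x, z) / |z|))
    (hR : ∀ x ∈ Icc a (2 * a), ∀ z, R < |z| → h (x, z) = 0) :
    ‖∫ p in Ioc a (2 * a) ×ˢ (Icc (-Z) Z)ᶜ, (h p : ℂ) * ee (ν * p.1 + μ * (k p.1 + p.2))‖ ≤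
      5 * C / |μ| * ∫ p in Ioc a (2 * a) ×ˢ (Icc (-Z) Z)ᶜ, G p / |p.2| := by
  have hFi : Integrable (fun p : Q2 => (h p : ℂ) * ee (ν * p.1 + μ * (k p.1 + p.2))) := by
    refine Integrable.mono' (hG.const_mul C) ?_ (ae_of_all _ fun p => ?_)
    · refine (Complex.continuous_ofReal.comp_aestronglyMeasurable hm).mul ?_
      exact (continuous_ee.measurable.comp (by fun_prop)).aestronglyMeasurable
    · rw [norm_mul, norm_ee, mul_one, Complex.norm_real]; exact hh p
  have hr : (volume : Measure Q2).restrict (Ioc a (2 * a) ×ˢ (Icc (-Z) Z)ᶜ) =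
      (volume.restrict (Ioc a (2 * a))).prod (volume.restrict (Icc (-Z) Z)ᶜ) := by
    rw [Measure.prod_restrict]; rfl
  have hms : MeasurableSet (Ioc a (2 * a) ×ˢ (Icc (-Z) Z)ᶜ) :=
    measurableSet_Ioc.prod measurableSet_Icc.compl
  have habs : ∀ z ∈ (Icc (-Z) Z)ᶜ, Z < |z| := fun z hz => by
    rw [mem_compl_iff, mem_Icc, ← abs_le] at hz; exact not_le.1 hz
  have hGZ : IntegrableOn (fun p : Q2 => G p / |p.2|) (Ioc a (2 * a) ×ˢ (Icc (-Z) Z)ᶜ) := by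
    refine Integrable.mono' (hG.integrableOn.const_mul (1 / Z)) ?_ ?_
    · exact (hG.integrableOn.aestronglyMeasurable.aemeasurable.div
        (by fun_prop)).aestronglyMeasurable
    · filter_upwards [ae_restrict_mem hms] with p hp
      have hp2 := habs _ hp.2
      rw [norm_eq_abs, abs_of_nonneg (div_nonneg (hG0 p) (abs_nonneg _)), div_eq_mul_one_div, mul_comm]
      exact mul_le_mul_of_nonneg_right (one_div_le_one_div_of_le hZ hp2.le) (hG0 p)
  have hF' := hFi.integrableOn (s := Ioc a (2 * a) ×ˢ (Icc (-Z) Z)ᶜ)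
  have hG' := hG.integrableOn (s := Ioc a (2 * a) ×ˢ (Icc (-Z) Z)ᶜ)
  rw [IntegrableOn, hr] at hF' hG' hGZ
  rw [hr, integral_prod _ hF', integral_prod _ hGZ, ← integral_const_mul]
  apply norm_integral_le_of_norm_le (hGZ.integral_prod_left.const_mul _)
  filter_upwards [ae_restrict_mem measurableSet_Ioc, hG'.prod_right_ae, hGZ.prod_right_ae,
    hF'.prod_right_ae] with x hx hGx hGZx hFx
  have hx' : x ∈ Icc a (2 * a) := ⟨hx.1.le, hx.2⟩
  have hset : (Icc (-Z) Z)ᶜ = Iio (-Z) ∪ Ioi Z := by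
    ext z; simp only [mem_compl_iff, mem_Icc, not_and_or, not_le, mem_union, mem_Iio, mem_Ioi]
  have hdisj : Disjoint (Iio (-Z)) (Ioi Z) := by
    rw [Set.disjoint_left]; intro z hz1 hz2
    simp only [mem_Iio, mem_Ioi] at hz1 hz2; linarith
  have hsp : ∀ {E : Type} [NormedAddCommGroup E] [NormedSpace RR E] (f : RR → E),
      Integrable f (volume.restrict (Icc (-Z) Z)ᶜ) →
      ∫ z in (Icc (-Z) Z)ᶜ, f z = (∫ z in Iio (-Z), f z) + ∫ z in Ioi Z, f z := by
    intro E _ _ f hf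
    have hf' : IntegrableOn f (Iio (-Z) ∪ Ioi Z) := by rw [← hset]; exact hf
    rw [hset, setIntegral_union hdisj measurableSet_Ioi hf'.left_of_union hf'.right_of_union]
  have hGx' : IntegrableOn (fun z => G (x, z)) (Iio (-Z) ∪ Ioi Z) := by rw [← hset]; exact hGx
  have e : ∫ z in (Icc (-Z) Z)ᶜ, (h (x, z) : ℂ) * ee (ν * x + μ * (k x + z)) =
      (∫ z in (Icc (-Z) Z)ᶜ, (h (x, z) : ℂ) * ee (μ * z)) * ee (ν * x + μ * k x) := by
    rw [← integral_mul_const]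
    congr 1; ext z
    rw [mul_assoc, ← ee_add]; congr 2; ring
  have hi2 : Integrable (fun z => (h (x, z) : ℂ) * ee (μ * z)) (volume.restrict (Icc (-Z) Z)ᶜ) := by
    have := hFx.mul_const (ee (-(ν * x + μ * k x)))
    convert this using 2 with z
    rw [mul_assoc, ← ee_add]; congr 2; ring
  rw [e, norm_mul, norm_ee, mul_one, hsp _ hi2, hsp _ hGZx, mul_add]
  refine (norm_add_le _ _).trans (add_le_add ?_ ?_)
  · apply tail_bound_neg (R := R) hZ hμ hC (fun z => hG0 _) hGx'.left_of_union
    · intro z hz1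
      exact (hz x hx' z (by linarith)).1
    · intro z _; exact hh (x, z)
    · intro z hz1
      exact (hz x hx' z (by linarith)).2
    · intro z hz1
      apply hR x hx' z
      rw [lt_abs]; right; linarith
  · have := tail_bound (h := fun z => h (x, z)) (G := fun z => G (x, z)) (R := R) (C := C) hZ hμ hC (fun z => hG0 _) hGx'.right_of_union
      (fun z hz1 => (hz x hx' z (by linarith)).1) (fun z _ => hh (x, z))
      (fun z hz1 => by
        have := (hz x hx' z (by linarith)).2
        rwa [abs_of_pos (by linarith : 0 < z)] at this)
      (fun z hz1 => by
        apply hR x hx' z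
        rw [lt_abs]; left; linarith)
    refine this.trans (le_of_eq ?_)
    congr 1
    apply setIntegral_congr_fun measurableSet_Ioi
    intro z hz1
    simp only [mem_Ioi] at hz1
    simp only [abs_of_pos (hZ.trans hz1)]

set_option maxHeartbeats 1000000 in
lemma slab_bound {G h : Q2 → RR} {k k' k'' : RR → RR} {a C B c1 c2 K ν μ : RR} (ha : 0 < a)
    (hC : 0 ≤ C) (hB : 0 ≤ B) (hc1 : 0 < c1) (hc2 : 0 ≤ c2) (hK : 0 ≤ K)
    (hG : Integrable G) (hG0 : ∀ p, 0 ≤ G p) (hm : AEStronglyMeasurable h volume)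
    (hk : Measurable k) (hh : ∀ p, |h p| ≤ C * G p)
    (hx : ∀ x ∈ Icc a (2 * a), ∀ z, z ≠ 0 → DifferentiableAt RR (fun x => h (x, z)) x ∧
      |deriv (fun x => h (x, z)) x| ≤ C / a * G (x, z))
    (hz : ∀ x ∈ Icc a (2 * a), ∀ z, z ≠ 0 → DifferentiableAt RR (fun z => h (x, z)) z ∧
      |deriv (fun z => h (x, z)) z| ≤ C * (G (x, z) / |z|))
    (hR : ∀ x ∈ Icc a (2 * a), ∀ z, B * a < |z| → h (x, z) = 0)
    (hk1 : ∀ x ∈ Icc a (2 * a), HasDerivAt k (k' x) x)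
    (hk2 : ∀ x ∈ Icc a (2 * a), HasDerivAt k' (k'' x) x)
    (hkc : ContinuousOn k'' (Icc a (2 * a)))
    (hkx : ∀ x ∈ Icc a (2 * a), |k x| ≤ x) (hk'h : ∀ x ∈ Icc a (2 * a), |k' x| ≤ 1 / 2)
    (hkK : ∀ x ∈ Icc a (2 * a), |k x| ≤ c2 * K)
    (hks : (∀ x ∈ Icc a (2 * a), c1 * K / a ^ 2 ≤ k'' x) ∨
      (∀ x ∈ Icc a (2 * a), k'' x ≤ -(c1 * K / a ^ 2))) :
    ‖∫ p in Ioc a (2 * a) ×ˢ univ, (h p : ℂ) * ee (ν * p.1 + μ * (k p.1 + p.2))‖ ≤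
      (24 * C * (2 + B) + C * (c2 + 1) + 30 * C * (c2 + 1) / √c1 + 5 * C * (c2 + 1)) *
      ∫ p in Ioc a (2 * a) ×ˢ univ, G p * Wt (max |ν| |μ|) (k p.1 + p.2) := by
  have hab : a < 2 * a := by linarith
  set l := max |ν| |μ| with hl
  have hGW : Integrable (fun p : Q2 => G p * Wt l (k p.1 + p.2)) := by
    refine Integrable.mono' hG ?_ (ae_of_all _ fun p => ?_)
    · exact hG.aestronglyMeasurable.mul
        ((continuous_Wt l).measurable.comp (by fun_prop)).aestronglyMeasurable
    · rw [norm_eq_abs, abs_of_nonneg (mul_nonneg (hG0 p) (Wt_pos _ _).le)]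
      exact mul_le_of_le_one_right (hG0 p) (Wt_le_one _ _)
  have hGW0 : ∀ p : Q2, 0 ≤ G p * Wt l (k p.1 + p.2) := fun p => mul_nonneg (hG0 p) (Wt_pos _ _).le
  have hFi : Integrable (fun p : Q2 => (h p : ℂ) * ee (ν * p.1 + μ * (k p.1 + p.2))) := by
    refine Integrable.mono' (hG.const_mul C) ?_ (ae_of_all _ fun p => ?_)
    · refine (Complex.continuous_ofReal.comp_aestronglyMeasurable hm).mul ?_
      exact (continuous_ee.measurable.comp (by fun_prop)).aestronglyMeasurable
    · rw [norm_mul, norm_ee, mul_one, Complex.norm_real]; exact hh p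
  set I := ∫ p in Ioc a (2 * a) ×ˢ univ, G p * Wt l (k p.1 + p.2) with hI
  have hI0 : 0 ≤ I := setIntegral_nonneg (measurableSet_Ioc.prod MeasurableSet.univ) fun p _ => hGW0 p
  -- comparison lemma
  have hcmp : ∀ (T : Set RR), MeasurableSet T → ∀ q : RR, 0 < q →
      (∀ x ∈ Icc a (2 * a), ∀ z ∈ T, 1 / q ≤ Wt l (k x + z)) →
      ∫ p in Ioc a (2 * a) ×ˢ T, G p ≤ q * ∫ p in Ioc a (2 * a) ×ˢ T, G p * Wt l (k p.1 + p.2) := by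
    intro T hT q hq hW
    rw [← integral_const_mul]
    apply setIntegral_mono_on hG.integrableOn (hGW.integrableOn.const_mul q) (measurableSet_Ioc.prod hT)
    intro p hp
    have h1 := hW p.1 ⟨hp.1.1.le, hp.1.2⟩ p.2 hp.2
    rw [div_le_iff₀ hq] at h1
    nlinarith [hG0 p]
  have hsub : ∀ (T : Set RR), MeasurableSet T →
      ∫ p in Ioc a (2 * a) ×ˢ T, G p * Wt l (k p.1 + p.2) ≤ I := by
    intro T hT
    apply setIntegral_mono_set hGW.integrableOn (ae_of_all _ hGW0)
    exact (prod_mono_right (subset_univ _)).eventuallyLE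
  have hkcont : ContinuousOn k (Icc a (2 * a)) := fun x hx => (hk1 x hx).continuousAt.continuousWithinAt
  have hΦ1 : ∀ x ∈ Icc a (2 * a), HasDerivAt (fun s => ν * s + μ * k s) (ν + μ * k' x) x := fun x hx => by
    simpa using ((hasDerivAt_id x).const_mul ν).fun_add ((hk1 x hx).const_mul μ)
  have hΦ2 : ∀ x ∈ Icc a (2 * a), HasDerivAt (fun s => ν + μ * k' s) (μ * k'' x) x := fun x hx => by
    simpa using ((hk2 x hx).const_mul μ).const_add ν
  have hs0 : (0:RR) < √c1 := sqrt_pos.2 hc1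
  have hsubI : ∀ x ∈ Icc a (2 * a), Icc a x ⊆ Icc a (2 * a) := fun x hx => Icc_subset_Icc_right hx.2
  have t1 : 0 ≤ 24 * C * (2 + B) := by positivity
  have t2 : 0 ≤ C * (c2 + 1) := by positivity
  have t3 : 0 ≤ 30 * C * (c2 + 1) / √c1 := by positivity
  have t4 : 0 ≤ 5 * C * (c2 + 1) := by positivity
  rcases le_or_gt |μ| |ν| with hcase | hcase
  · -- case 1
    have hl1 : l = |ν| := max_eq_left hcase
    suffices hs : ‖∫ p in Ioc a (2 * a) ×ˢ Icc (-(B * a)) (B * a),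
        (h p : ℂ) * ee (ν * p.1 + μ * (k p.1 + p.2))‖ ≤ 24 * C * (2 + B) * I by
      have e : ∫ p in Ioc a (2 * a) ×ˢ univ, (h p : ℂ) * ee (ν * p.1 + μ * (k p.1 + p.2)) =
          ∫ p in Ioc a (2 * a) ×ˢ Icc (-(B * a)) (B * a), (h p : ℂ) * ee (ν * p.1 + μ * (k p.1 + p.2)) := by
        apply setIntegral_eq_of_subset_of_forall_sdiff_eq_zero (measurableSet_Ioc.prod MeasurableSet.univ)
          (prod_mono_right (subset_univ _))
        rintro ⟨x, z⟩ ⟨⟨hx1, _⟩, hx2⟩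
        have : B * a < |z| := by
          by_contra hcon
          exact hx2 ⟨hx1, abs_le.1 (not_lt.1 hcon)⟩
        rw [hR x ⟨hx1.1.le, hx1.2⟩ z this]; simp
      rw [e]
      refine hs.trans (mul_le_mul_of_nonneg_right ?_ hI0)
      linarith
    have hkz : ∀ x ∈ Icc a (2 * a), ∀ z ∈ Icc (-(B * a)) (B * a), |k x + z| ≤ (2 + B) * a := by
      intro x hx z hz'
      have h1 := abs_add_le (k x) z
      have h2 := hkx x hx
      have h3 := abs_le.2 hz'
      linarith [hx.2]
    have hTm : MeasurableSet (Icc (-(B * a)) (B * a)) := measurableSet_Icc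
    rcases le_or_gt (l * a) 1 with hla | hla
    · have h1 := hcmp _ hTm (2 + B) (by linarith) (fun x hx z hz' => by
        have := Wt_lower' (l := l) (s := k x + z) (c := 2 + B) (T := 1) (by linarith) le_rfl (by
          have := hkz x hx z hz'
          have hl0 : 0 ≤ l := by rw [hl1]; exact abs_nonneg _
          calc l * |k x + z| ≤ l * ((2 + B) * a) := by gcongr
            _ = (2 + B) * (l * a) := by ring
            _ ≤ (2 + B) * 1 := by gcongr)
        rwa [mul_one] at this)
      refine (slab_triv hG hh _).trans ?_
      have h2 := hsub _ hTm
      calc _ ≤ C * ((2 + B) * I) := by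
            gcongr; exact h1.trans (by gcongr)
        _ ≤ 24 * C * (2 + B) * I := by nlinarith [mul_nonneg (mul_nonneg hC (by linarith : (0:RR) ≤ 2 + B)) hI0]
    · have hlp : 0 < l := by
        by_contra hcon
        have : l * a ≤ 0 := mul_nonpos_of_nonpos_of_nonneg (not_lt.1 hcon) ha.le
        linarith
      have hlow : ∀ x ∈ Icc a (2 * a), l / 2 ≤ |ν + μ * k' x| := by
        intro x hx
        have h1 : |μ * k' x| ≤ l / 2 := by
          rw [abs_mul, hl1]
          calc _ ≤ |ν| * (1/2) := by gcongr; exact hk'h x hx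
            _ = _ := by ring
        have h2 : |ν| - |μ * k' x| ≤ |ν + μ * k' x| := by
          have := abs_sub_abs_le_abs_sub ν (-(μ * k' x))
          rwa [abs_neg, sub_neg_eq_add] at this
        linarith
      have hsg : (∀ x ∈ Icc a (2 * a), 0 ≤ μ * k'' x) ∨ (∀ x ∈ Icc a (2 * a), μ * k'' x ≤ 0) := by
        have hq : 0 ≤ c1 * K / a ^ 2 := by positivity
        rcases hks with hks | hks <;> rcases le_total 0 μ with hμ | hμ
        · left; intro x hx; exact mul_nonneg hμ (hq.trans (hks x hx))
        · right; intro x hx; exact mul_nonpos_of_nonpos_of_nonneg hμ (hq.trans (hks x hx))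
        · right; intro x hx; exact mul_nonpos_of_nonneg_of_nonpos hμ (by linarith [hks x hx])
        · left; intro x hx; exact mul_nonneg_of_nonpos_of_nonpos hμ (by linarith [hks x hx])
      have hM : ∀ x ∈ Icc a (2 * a), ‖∫ s in a..x, ee (ν * s + μ * k s)‖ ≤ 4 / (l / 2) := by
        intro x hx'
        have hs := hsubI x hx'
        refine vdc1' hx'.1 (by linarith) (fun y hy => hΦ1 y (hs hy)) (fun y hy => hΦ2 y (hs hy))
          ((continuousOn_const.mul hkc).mono hs) ?_ (fun y hy => hlow y (hs hy))
        rcases hsg with h | h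
        · left; exact fun y hy => h y (hs hy)
        · right; exact fun y hy => h y (hs hy)
      have h1 := slab_x (ν := ν) (μ := μ) ha hG hG0 hm hk hh hx hkcont hM (by positivity) hTm
      refine h1.trans ?_
      have h3 := hcmp _ hTm ((2 + B) * (l * a)) (by positivity) (fun x hx z hz' => by
        apply Wt_lower' (by linarith) hla.le
        have := hkz x hx z hz'
        calc l * |k x + z| ≤ l * ((2 + B) * a) := by gcongr
          _ = (2 + B) * (l * a) := by ring)
      have h2 := hsub _ hTm
      calc _ ≤ 3 * C / a * (4 / (l / 2)) * ((2 + B) * (l * a) * I) := by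
            gcongr; exact h3.trans (by gcongr)
        _ = 24 * C * (2 + B) * I := by field_simp; ring
  · -- case 2
    have hl2 : l = |μ| := max_eq_right hcase.le
    have hlp : 0 < l := by rw [hl2]; exact (abs_nonneg ν).trans_lt hcase
    have hμ0 : μ ≠ 0 := by rw [hl2] at hlp; exact abs_pos.1 hlp
    set Z := max K (1 / l) with hZdef
    have hZ : 0 < Z := lt_of_lt_of_le (by positivity) (le_max_right _ _)
    have hsplit : ∫ p in Ioc a (2 * a) ×ˢ univ, (h p : ℂ) * ee (ν * p.1 + μ * (k p.1 + p.2)) =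
        (∫ p in Ioc a (2 * a) ×ˢ Icc (-Z) Z, (h p : ℂ) * ee (ν * p.1 + μ * (k p.1 + p.2))) +
        ∫ p in Ioc a (2 * a) ×ˢ (Icc (-Z) Z)ᶜ, (h p : ℂ) * ee (ν * p.1 + μ * (k p.1 + p.2)) := by
      rw [← setIntegral_union _ (measurableSet_Ioc.prod measurableSet_Icc.compl) hFi.integrableOn
        hFi.integrableOn, ← prod_union, union_compl_self]
      rw [Set.disjoint_left]
      rintro p hp1 hp2
      exact hp2.2 hp1.2
    have outer : ‖∫ p in Ioc a (2 * a) ×ˢ (Icc (-Z) Z)ᶜ, (h p : ℂ) * ee (ν * p.1 + μ * (k p.1 + p.2))‖ ≤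
        5 * C * (c2 + 1) * I := by
      refine (slab_z (R := B * a) hZ hμ0 hC hG hG0 hm hk hh hz hR).trans ?_
      rw [← hl2]
      have hTm : MeasurableSet (Icc (-Z) Z)ᶜ := measurableSet_Icc.compl
      have : ∫ p in Ioc a (2 * a) ×ˢ (Icc (-Z) Z)ᶜ, G p / |p.2| ≤
          (c2 + 1) * l * ∫ p in Ioc a (2 * a) ×ˢ (Icc (-Z) Z)ᶜ, G p * Wt l (k p.1 + p.2) := by
        rw [← integral_const_mul]
        apply integral_mono_of_nonneg
        · exact ae_of_all _ fun p => div_nonneg (hG0 p) (abs_nonneg _)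
        · exact hGW.integrableOn.const_mul _
        · filter_upwards [ae_restrict_mem (measurableSet_Ioc.prod hTm)] with p hp
          have hzp : Z < |p.2| := by
            have := hp.2; rw [mem_compl_iff, mem_Icc, ← abs_le] at this; exact not_le.1 this
          have hz0 : 0 < |p.2| := hZ.trans hzp
          have hT1 : 1 ≤ l * |p.2| := by
            have : 1 / l ≤ |p.2| := (le_max_right _ _).trans hzp.le
            rw [div_le_iff₀ hlp] at this; linarith
          have hW := Wt_lower' (l := l) (s := k p.1 + p.2) (c := c2 + 1) (T := l * |p.2|) (by linarith) hT1 (by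
            have h1 := abs_add_le (k p.1) p.2
            have h2 := hkK p.1 ⟨hp.1.1.le, hp.1.2⟩
            have h3 : K ≤ |p.2| := (le_max_left _ _).trans hzp.le
            have h4 : c2 * K ≤ c2 * |p.2| := by gcongr
            calc l * |k p.1 + p.2| ≤ l * ((c2 + 1) * |p.2|) := by gcongr; linarith
              _ = _ := by ring)
          rw [div_le_iff₀ (by positivity)] at hW
          rw [div_le_iff₀ hz0]
          nlinarith [hG0 p]
      calc _ ≤ 5 * C / l * ((c2 + 1) * l * I) := by
            gcongr; exact this.trans (by gcongr; exact hsub _ hTm)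
        _ = _ := by field_simp
    have inner : ‖∫ p in Ioc a (2 * a) ×ˢ Icc (-Z) Z, (h p : ℂ) * ee (ν * p.1 + μ * (k p.1 + p.2))‖ ≤
        (C * (c2 + 1) + 30 * C * (c2 + 1) / √c1) * I := by
      have hTm : MeasurableSet (Icc (-Z) Z) := measurableSet_Icc
      have hkz : ∀ x ∈ Icc a (2 * a), ∀ z ∈ Icc (-Z) Z, |k x + z| ≤ c2 * K + Z := by
        intro x hx z hz'
        have h1 := abs_add_le (k x) z
        have h2 := hkK x hx
        have h3 := abs_le.2 hz'
        linarith
      rcases le_or_gt (l * K) 1 with hlK | hlK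
      · have hZe : Z = 1 / l := max_eq_right (by rw [le_div_iff₀ hlp]; linarith)
        have h1 := hcmp _ hTm (c2 + 1) (by linarith) (fun x hx z hz' => by
          have := Wt_lower' (l := l) (s := k x + z) (c := c2 + 1) (T := 1) (by linarith) le_rfl (by
            have := hkz x hx z hz'
            calc l * |k x + z| ≤ l * (c2 * K + Z) := by gcongr
              _ = c2 * (l * K) + 1 := by rw [hZe]; field_simp
              _ ≤ (c2 + 1) * 1 := by nlinarith)
          rwa [mul_one] at this)
        refine (slab_triv hG hh _).trans ?_
        have h2 := hsub _ hTm
        calc _ ≤ C * ((c2 + 1) * I) := by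
              gcongr; exact h1.trans (by gcongr)
          _ = C * (c2 + 1) * I := by ring
          _ ≤ _ := by
            rw [add_mul]; exact le_add_of_nonneg_right (mul_nonneg t3 hI0)
      · have hKp : 0 < K := by
          by_contra hcon
          have : l * K ≤ 0 := mul_nonpos_of_nonneg_of_nonpos hlp.le (not_lt.1 hcon)
          linarith
        have hZe : Z = K := max_eq_left (by rw [div_le_iff₀ hlp]; linarith)
        have hq : 0 < l * (c1 * K / a ^ 2) := by positivity
        have hsg : (∀ x ∈ Icc a (2 * a), l * (c1 * K / a ^ 2) ≤ μ * k'' x) ∨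
            (∀ x ∈ Icc a (2 * a), μ * k'' x ≤ -(l * (c1 * K / a ^ 2))) := by
          rw [hl2]
          rcases hks with hks | hks <;> rcases le_total 0 μ with hμ | hμ
          · left; intro x hx; rw [abs_of_nonneg hμ]; exact mul_le_mul_of_nonneg_left (hks x hx) hμ
          · right; intro x hx; rw [abs_of_nonpos hμ]; nlinarith [hks x hx]
          · right; intro x hx; rw [abs_of_nonneg hμ]; nlinarith [hks x hx]
          · left; intro x hx; rw [abs_of_nonpos hμ]; nlinarith [hks x hx]
        have hM : ∀ x ∈ Icc a (2 * a), ‖∫ s in a..x, ee (ν * s + μ * k s)‖ ≤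
            10 / √(l * (c1 * K / a ^ 2)) := by
          intro x hx'
          have hs := hsubI x hx'
          refine vdc2' hx'.1 hq (fun y hy => hΦ1 y (hs hy)) (fun y hy => hΦ2 y (hs hy))
            ((continuousOn_const.mul hkc).mono hs) ?_
          rcases hsg with h | h
          · left; exact fun y hy => h y (hs hy)
          · right; exact fun y hy => h y (hs hy)
        have h1 := slab_x (ν := ν) (μ := μ) ha hG hG0 hm hk hh hx hkcont hM (by positivity) hTm
        refine h1.trans ?_
        have hsl : 0 < √(l * K) := sqrt_pos.2 (by linarith)
        have h3 := hcmp _ hTm ((c2 + 1) * √(l * K)) (by positivity) (fun x hx z hz' => by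
          apply Wt_lower (by linarith) hlK.le
          have := hkz x hx z hz'
          calc l * |k x + z| ≤ l * (c2 * K + Z) := by gcongr
            _ = (c2 + 1) * (l * K) := by rw [hZe]; ring)
        have h2 := hsub _ hTm
        have e : √(l * (c1 * K / a ^ 2)) = √c1 * √(l * K) / a := by
          rw [show l * (c1 * K / a ^ 2) = (c1 * (l * K)) / a ^ 2 by ring, sqrt_div (by positivity),
            sqrt_sq ha.le, sqrt_mul hc1.le]
        calc _ ≤ 3 * C / a * (10 / √(l * (c1 * K / a ^ 2))) * ((c2 + 1) * √(l * K) * I) := by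
              gcongr; exact h3.trans (by gcongr)
          _ = 30 * C * (c2 + 1) / √c1 * I := by rw [e]; field_simp; ring
          _ ≤ _ := by
            rw [add_mul]; exact le_add_of_nonneg_left (mul_nonneg t2 hI0)
    rw [hsplit]
    refine (norm_add_le _ _).trans ((add_le_add inner outer).trans ?_)
    have := mul_nonneg t1 hI0
    linarith

/-- shear as a measurable equivalence -/
def shear (φ : RR → RR) (hφ : Measurable φ) : Q2 ≃ᵐ Q2 where
  toFun p := (p.1, φ p.1 + p.2)
  invFun p := (p.1, p.2 - φ p.1)
  left_inv p := by ext <;> simp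
  right_inv p := by ext <;> simp
  measurable_toFun := by simp only [Equiv.coe_fn_mk]; fun_prop
  measurable_invFun := by simp only [Equiv.coe_fn_symm_mk]; fun_prop

lemma shear_apply (φ : RR → RR) (hφ : Measurable φ) (p : Q2) : shear φ hφ p = (p.1, φ p.1 + p.2) := rfl

lemma shear_mp (φ : RR → RR) (hφ : Measurable φ) : MeasurePreserving (shear φ hφ) volume volume := by
  have := (MeasurePreserving.id (volume : Measure RR)).skew_product (μb := (volume : Measure RR))
    (μd := (volume : Measure RR)) (g := fun x z => φ x + z) (by fun_prop)
    (ae_of_all _ fun x => map_add_left_eq_self volume (φ x))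
  exact this

lemma leaf {g H : Q2 → RR} {k k' k'' K : RR → RR} {w0 b C B c1 c2 : RR} (hb : 0 < b)
    (hC : 0 ≤ C) (hB : 0 ≤ B) (hc1 : 0 < c1) (hc2 : 0 ≤ c2) (hK : ∀ a, 0 < a → 0 ≤ K a)
    (hg : Integrable g) (hg0 : ∀ p, 0 ≤ g p) (hm : AEStronglyMeasurable H volume)
    (hk : Measurable k) (hh : ∀ p, |H p| ≤ C * g p)
    (hsupp : ∀ p, H p ≠ 0 → p.1 ∈ Ioc 0 b)
    (hx : ∀ x ∈ Ioc 0 b, ∀ z, z ≠ 0 → DifferentiableAt RR (fun x => H (x, w0 * x + k x + z)) x ∧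
      |x * deriv (fun x => H (x, w0 * x + k x + z)) x| ≤ C * g (x, w0 * x + k x + z))
    (hz : ∀ x ∈ Ioc 0 b, ∀ z, z ≠ 0 → DifferentiableAt RR (fun z => H (x, w0 * x + k x + z)) z ∧
      |z * deriv (fun z => H (x, w0 * x + k x + z)) z| ≤ C * g (x, w0 * x + k x + z))
    (hR : ∀ x ∈ Ioc 0 b, ∀ z, B * x < |z| → H (x, w0 * x + k x + z) = 0)
    (hk1 : ∀ x ∈ Ioc 0 b, HasDerivAt k (k' x) x)
    (hk2 : ∀ x ∈ Ioc 0 b, HasDerivAt k' (k'' x) x)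
    (hkc : ContinuousOn k'' (Ioc 0 b))
    (hkx : ∀ x ∈ Ioc 0 b, |k x| ≤ x) (hk'h : ∀ x ∈ Ioc 0 b, |k' x| ≤ 1 / 2)
    (hkK : ∀ a, 0 < a → 2 * a ≤ b → ∀ x ∈ Icc a (2 * a), |k x| ≤ c2 * K a)
    (hks : ∀ a, 0 < a → 2 * a ≤ b → (∀ x ∈ Icc a (2 * a), c1 * K a / a ^ 2 ≤ k'' x) ∨
      (∀ x ∈ Icc a (2 * a), k'' x ≤ -(c1 * K a / a ^ 2))) :
    ∃ C', ∀ μ1 μ2 : RR, ‖∫ p, (H p : ℂ) * ee (μ1 * p.1 + μ2 * p.2)‖ ≤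
      C' * ∫ p, g p * Wt (max |μ1 + w0 * μ2| |μ2|) (p.2 - w0 * p.1) := by
  refine ⟨24 * C * (2 + 2 * B) + C * (c2 + 1) + 30 * C * (c2 + 1) / √c1 + 5 * C * (c2 + 1), fun μ1 μ2 => ?_⟩
  have hφ : Measurable (fun x => w0 * x + k x) := by fun_prop
  have mp := shear_mp _ hφ
  set S := shear _ hφ with hS
  have hSa : ∀ p, S p = (p.1, w0 * p.1 + k p.1 + p.2) := fun p => rfl
  set ν := μ1 + w0 * μ2
  set l := max |ν| |μ2|
  rw [← mp.integral_comp' (f := S) (fun p => (H p : ℂ) * ee (μ1 * p.1 + μ2 * p.2)),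
    ← mp.integral_comp' (f := S) (fun p => g p * Wt l (p.2 - w0 * p.1))]
  set h := fun p => H (S p)
  set G := fun p => g (S p)
  have hG : Integrable G := (mp.integrable_comp_emb S.measurableEmbedding).2 hg
  have hG0 : ∀ p, 0 ≤ G p := fun p => hg0 _
  have hhm : AEStronglyMeasurable h volume := hm.comp_measurePreserving mp
  have e1 : ∀ p, (H (S p) : ℂ) * ee (μ1 * (S p).1 + μ2 * (S p).2) =
      (h p : ℂ) * ee (ν * p.1 + μ2 * (k p.1 + p.2)) := fun p => by
    simp only [h, hSa, ν]; congr 2; ring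
  have e2 : ∀ p, g (S p) * Wt l ((S p).2 - w0 * (S p).1) = G p * Wt l (k p.1 + p.2) := fun p => by
    simp only [G, hSa]; congr 2; ring
  simp only [e1, e2]
  have hGW : Integrable (fun p : Q2 => G p * Wt l (k p.1 + p.2)) := by
    refine Integrable.mono' hG ?_ (ae_of_all _ fun p => ?_)
    · exact hG.aestronglyMeasurable.mul
        ((continuous_Wt l).measurable.comp (by fun_prop)).aestronglyMeasurable
    · rw [norm_eq_abs, abs_of_nonneg (mul_nonneg (hG0 p) (Wt_pos _ _).le)]
      exact mul_le_of_le_one_right (hG0 p) (Wt_le_one _ _)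
  have hFi : Integrable (fun p : Q2 => (h p : ℂ) * ee (ν * p.1 + μ2 * (k p.1 + p.2))) := by
    refine Integrable.mono' (hG.const_mul C) ?_ (ae_of_all _ fun p => ?_)
    · refine (Complex.continuous_ofReal.comp_aestronglyMeasurable hhm).mul ?_
      exact (continuous_ee.measurable.comp (by fun_prop)).aestronglyMeasurable
    · rw [norm_mul, norm_ee, mul_one, Complex.norm_real]; exact hh _
  set a : ℕ → RR := fun j => b / 2 ^ (j + 1) with ha
  have ha0 : ∀ j, 0 < a j := fun j => by positivity
  have ha2 : ∀ j, 2 * a j ≤ b := fun j => by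
    have : (1:RR) ≤ 2 ^ j := one_le_pow₀ (by norm_num)
    simp only [ha, pow_succ]
    rw [mul_div_assoc', div_le_iff₀ (by positivity)]
    nlinarith
  have hI : ∀ j, ∀ x ∈ Icc (a j) (2 * a j), x ∈ Ioc 0 b := fun j x hx =>
    ⟨(ha0 j).trans_le hx.1, hx.2.trans (ha2 j)⟩
  set T : ℕ → Set Q2 := fun j => Ioc (a j) (2 * a j) ×ˢ univ
  have hTm : ∀ j, MeasurableSet (T j) := fun j => measurableSet_Ioc.prod MeasurableSet.univ
  have hTd : Pairwise (Function.onFun Disjoint T) := by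
    have hd : ∀ i j, i < j → Disjoint (T i) (T j) := by
      intro i j hij
      rw [Set.disjoint_left]
      rintro p ⟨hp1, _⟩ ⟨hp2, _⟩
      have : 2 * a j ≤ a i := by
        simp only [ha]
        rw [mul_div_assoc', div_le_div_iff₀ (by positivity) (by positivity)]
        have : (2:RR) ^ (i + 1) ≤ 2 ^ j := pow_le_pow_right₀ (by norm_num) hij
        rw [pow_succ 2 j]; nlinarith
      linarith [hp1.1, hp2.2]
    intro i j hij
    rcases lt_or_gt_of_ne hij with h | h
    · exact hd i j h
    · exact (hd j i h).symm
  have hTc : Ioc 0 b ×ˢ univ ⊆ ⋃ j, T j := by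
    rintro p ⟨hp, _⟩
    obtain ⟨n, hn1, hn2⟩ := exists_nat_pow_near (x := b / p.1) (y := 2) (by rw [le_div_iff₀ hp.1]; linarith [hp.2]) (by norm_num)
    rw [le_div_iff₀ hp.1] at hn1
    rw [div_lt_iff₀ hp.1] at hn2
    refine mem_iUnion.2 ⟨n, ⟨?_, ?_⟩, trivial⟩
    · simp only [ha]; rw [div_lt_iff₀ (by positivity)]; linarith
    · simp only [ha, pow_succ]; rw [mul_div_assoc', le_div_iff₀ (by positivity)]; linarith
  have s1 := hasSum_integral_iUnion hTm hTd hFi.integrableOn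
  have s2 := (hasSum_integral_iUnion hTm hTd hGW.integrableOn).mul_left
    (24 * C * (2 + 2 * B) + C * (c2 + 1) + 30 * C * (c2 + 1) / √c1 + 5 * C * (c2 + 1))
  have e3 : ∫ p in ⋃ j, T j, (h p : ℂ) * ee (ν * p.1 + μ2 * (k p.1 + p.2)) =
      ∫ p, (h p : ℂ) * ee (ν * p.1 + μ2 * (k p.1 + p.2)) := by
    apply setIntegral_eq_integral_of_forall_compl_eq_zero
    intro p hp
    have : h p = 0 := by
      by_contra hne
      exact hp (hTc ⟨hsupp (S p) hne, trivial⟩)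
    rw [this]; simp
  rw [e3] at s1
  refine (s1.norm_le_of_bounded s2 ?_).trans ?_
  · intro j
    refine slab_bound (k' := k') (k'' := k'') (K := K (a j)) (ha0 j) hC (by linarith) hc1 hc2 (hK _ (ha0 j)) hG hG0 hhm hk (fun p => hh _) ?_ ?_ ?_
      (fun x hx' => hk1 x (hI j x hx')) (fun x hx' => hk2 x (hI j x hx'))
      (hkc.mono (hI j)) (fun x hx' => hkx x (hI j x hx')) (fun x hx' => hk'h x (hI j x hx'))
      (hkK _ (ha0 j) (ha2 j)) (hks _ (ha0 j) (ha2 j))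
    · intro x hx' z hz0
      obtain ⟨d1, d2⟩ := hx x (hI j x hx') z hz0
      refine ⟨d1, ?_⟩
      rw [abs_mul, abs_of_pos (hI j x hx').1] at d2
      rw [div_mul_eq_mul_div, le_div_iff₀ (ha0 j), mul_comm]
      exact (mul_le_mul_of_nonneg_right hx'.1 (abs_nonneg _)).trans d2
    · intro x hx' z hz0
      obtain ⟨d1, d2⟩ := hz x (hI j x hx') z hz0
      refine ⟨d1, ?_⟩
      rw [abs_mul] at d2
      rw [← mul_div_assoc, le_div_iff₀ (abs_pos.2 hz0), mul_comm]
      exact d2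
    · intro x hx' z hz0
      refine hR x (hI j x hx') z (lt_of_le_of_lt ?_ hz0)
      nlinarith [hx'.2]
  · refine mul_le_mul_of_nonneg_left ?_ (by positivity)
    exact setIntegral_le_integral hGW (ae_of_all _ fun p => mul_nonneg (hG0 p) (Wt_pos _ _).le)

lemma Wt_anti {l l' s : RR} (h : l ≤ l') : Wt l' s ≤ Wt l s := by
  unfold Wt
  have : 0 < √(max 1 (l * |s|)) := sqrt_pos.2 (lt_of_lt_of_le one_pos (le_max_left _ _))
  gcongr

lemma Wt_dyadic {l s : RR} (J : ℕ) : Wt l s ≤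
    ∑ j ∈ Finset.range (J + 1), (if l * |s| < 2 ^ j then 2 * (√2)⁻¹ ^ j else 0) + (√2)⁻¹ ^ J := by
  have h2 : (0:RR) < √2 := by positivity
  have hs : ∀ j : ℕ, √((2:RR) ^ j) = √2 ^ j := fun j => by
    rw [sqrt_eq_iff_mul_self_eq (by positivity) (by positivity), ← mul_pow, mul_self_sqrt (by norm_num)]
  have hW : ∀ j : ℕ, (2:RR) ^ j ≤ l * |s| → Wt l s ≤ (√2)⁻¹ ^ j := fun j hj => by
    unfold Wt
    rw [inv_pow, ← hs]
    gcongr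
    exact hj.trans (le_max_right _ _)
  have hn : ∀ j ∈ Finset.range (J + 1), 0 ≤ (if l * |s| < 2 ^ j then 2 * (√2)⁻¹ ^ j else 0) := by
    intro j _; split_ifs <;> positivity
  rcases le_or_gt ((2:RR) ^ J) (l * |s|) with h | h
  · exact (hW J h).trans (le_add_of_nonneg_left (Finset.sum_nonneg hn))
  · have hex : ∃ j : ℕ, l * |s| < 2 ^ j := ⟨J, h⟩
    classical
    set j := Nat.find hex
    have hj : l * |s| < 2 ^ j := Nat.find_spec hex
    have hjJ : j ≤ J := Nat.find_min' hex h
    have h1 := Finset.single_le_sum hn (Finset.mem_range.2 (Nat.lt_succ_of_le hjJ))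
    rw [if_pos hj] at h1
    refine (le_trans ?_ h1).trans (le_add_of_nonneg_right (by positivity))
    rcases Nat.eq_zero_or_pos j with h0 | h0
    · rw [h0]; have := Wt_le_one l s; simp; linarith
    · have hlt : ¬ l * |s| < 2 ^ (j - 1) := Nat.find_min hex (by lia)
      refine (hW _ (not_lt.1 hlt)).trans ?_
      obtain ⟨i, hi⟩ : ∃ i, j = i + 1 := ⟨j - 1, by lia⟩
      rw [hi, Nat.add_sub_cancel, pow_succ]
      have : √2 ≤ 2 := by rw [sqrt_le_left (by norm_num)]; norm_num
      have h3 : 1 ≤ 2 * (√2)⁻¹ := by rw [← div_eq_mul_inv, le_div_iff₀ h2]; linarith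
      have h4 : 0 < (√2)⁻¹ ^ i := by positivity
      nlinarith

lemma weight_large {g : Q2 → RR} {w0 δ R b : RR} {e : ℕ} (hg : Integrable g) (hg0 : ∀ p, 0 ≤ g p)
    (hδ : δ < 1 / 2) (hR : 0 < R) (hR1 : R ≤ 1) (hb : 0 ≤ b)
    (hst : ∀ r, 0 < r → r < R → ∫ p in {p : Q2 | |p.2 - w0 * p.1| < r}, g p ≤ b * r ^ δ * |log r| ^ e) :
    ∃ C, 0 ≤ C ∧ ∀ l, 4 / R ≤ l → ∫ p, g p * Wt l (p.2 - w0 * p.1) ≤ C * (l ^ (-δ) * (log l) ^ e) := by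
  set q : RR := (√2)⁻¹ * 2 ^ δ with hq
  have hs2 : (√2)⁻¹ = (2:RR) ^ (-(1/2):RR) := by rw [sqrt_eq_rpow, rpow_neg (by norm_num)]
  have hq0 : 0 < q := by positivity
  have hq1 : q < 1 := by
    rw [hq, hs2, ← rpow_add (by norm_num)]
    exact rpow_lt_one_of_one_lt_of_neg (by norm_num) (by linarith)
  have hI0 : 0 ≤ ∫ p, g p := integral_nonneg hg0
  refine ⟨2 * b * (1 - q)⁻¹ + √(4 / R) * ∫ p, g p, ?_, fun l hl => ?_⟩
  · have : 0 < 1 - q := by linarith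
    positivity
  have hRl : 4 ≤ l * R := by rwa [div_le_iff₀ hR] at hl
  have hl4 : 4 ≤ l := by
    refine le_trans ?_ hl; rw [le_div_iff₀ hR]; linarith
  have hlp : 0 < l := by linarith
  obtain ⟨J, hJ1, hJ2⟩ := exists_nat_pow_near (x := l * R / 2) (y := 2) (by linarith) (by norm_num)
  set S : ℕ → Set Q2 := fun j => {p : Q2 | |p.2 - w0 * p.1| < 2 ^ j / l} with hS
  have hSm : ∀ j, MeasurableSet (S j) := fun j => by
    apply measurableSet_lt <;> fun_prop
  have hlog : 1 ≤ log l := by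
    rw [le_log_iff_exp_le hlp]
    linarith [exp_one_lt_d9]
  have hpt : ∀ p, g p * Wt l (p.2 - w0 * p.1) ≤
      ∑ j ∈ Finset.range (J + 1), 2 * (√2)⁻¹ ^ j * (S j).indicator g p + (√2)⁻¹ ^ J * g p := by
    intro p
    refine (mul_le_mul_of_nonneg_left (Wt_dyadic J) (hg0 p)).trans (le_of_eq ?_)
    rw [mul_add, Finset.mul_sum]
    congr 1
    · refine Finset.sum_congr rfl fun j _ => ?_
      by_cases h : l * |p.2 - w0 * p.1| < 2 ^ j
      · rw [if_pos h, indicator_of_mem, mul_comm]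
        simp only [hS, mem_ofPred_eq]; rw [lt_div_iff₀ hlp]; linarith
      · rw [if_neg h, indicator_of_notMem]
        · simp
        · simp only [hS, mem_ofPred_eq]; rw [lt_div_iff₀ hlp]; linarith
    · ring
  have hint : ∀ j, Integrable ((S j).indicator g) := fun j => hg.indicator (hSm j)
  have h1 : ∫ p, g p * Wt l (p.2 - w0 * p.1) ≤
      ∑ j ∈ Finset.range (J + 1), 2 * (√2)⁻¹ ^ j * (∫ p in S j, g p) + (√2)⁻¹ ^ J * ∫ p, g p := by
    have hs : Integrable (fun p => ∑ j ∈ Finset.range (J + 1), 2 * (√2)⁻¹ ^ j * (S j).indicator g p) :=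
      integrable_finsetSum _ fun j _ => (hint j).const_mul _
    refine (integral_mono_of_nonneg (ae_of_all _ fun p => mul_nonneg (hg0 p) (Wt_pos _ _).le)
      (hs.add (hg.const_mul _)) (ae_of_all _ hpt)).trans (le_of_eq ?_)
    simp only [Pi.add_apply]
    rw [integral_add hs (hg.const_mul _), integral_finsetSum _ fun j _ => (hint j).const_mul _,
      integral_const_mul]
    congr 1
    refine Finset.sum_congr rfl fun j _ => ?_
    rw [integral_const_mul, integral_indicator (hSm j)]
  refine h1.trans ?_
  rw [add_mul]
  refine add_le_add ?_ ?_
  · have hterm : ∀ j ∈ Finset.range (J + 1), 2 * (√2)⁻¹ ^ j * (∫ p in S j, g p) ≤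
        2 * b * (l ^ (-δ) * (log l) ^ e) * q ^ j := by
      intro j hj
      have hjJ : j ≤ J := Nat.lt_succ_iff.1 (Finset.mem_range.1 hj)
      have hp : (2:RR) ^ j ≤ l * R / 2 := (pow_le_pow_right₀ (by norm_num) hjJ).trans hJ1
      have hr0 : 0 < (2:RR) ^ j / l := by positivity
      have hrR : (2:RR) ^ j / l < R := by
        rw [div_lt_iff₀ hlp]; linarith
      have h2 := hst _ hr0 hrR
      have hlg : |log (2 ^ j / l)| ≤ log l := by
        rw [abs_of_nonpos (log_nonpos hr0.le (by linarith)), ← log_inv]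
        apply log_le_log (by positivity)
        rw [inv_div]
        apply div_le_self hlp.le
        exact one_le_pow₀ (by norm_num)
      calc _ ≤ 2 * (√2)⁻¹ ^ j * (b * (2 ^ j / l) ^ δ * (log l) ^ e) := by
            gcongr
            refine h2.trans ?_
            gcongr
        _ = _ := by
            rw [div_rpow (by positivity) hlp.le, rpow_neg hlp.le, hq, mul_pow,
              ← rpow_natCast 2 j, ← rpow_mul (by norm_num), mul_comm (j:RR), rpow_mul (by norm_num),
              rpow_natCast]
            ring
    refine (Finset.sum_le_sum hterm).trans ?_
    rw [← Finset.mul_sum]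
    have := (summable_geometric_of_lt_one hq0.le hq1).sum_le_tsum (Finset.range (J + 1)) (fun j _ => by positivity)
    rw [tsum_geometric_of_lt_one hq0.le hq1] at this
    have hlp' : 0 ≤ log l := by linarith
    calc _ ≤ 2 * b * (l ^ (-δ) * (log l) ^ e) * (1 - q)⁻¹ := by gcongr
      _ = _ := by ring
  · have h3 : (√2)⁻¹ ^ J ≤ √(4 / R) * l ^ (-δ) := by
      have h4 : (√2)⁻¹ ^ J = √((2 ^ J)⁻¹) := by
        rw [sqrt_inv, inv_pow]; congr 1
        symm
        rw [sqrt_eq_iff_mul_self_eq (by positivity) (by positivity), ← mul_pow, mul_self_sqrt (by norm_num)]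
      rw [h4]
      calc √((2 ^ J)⁻¹) ≤ √(4 / R * l⁻¹) := by
            apply sqrt_le_sqrt
            rw [← div_eq_mul_inv, div_div, ← one_div, div_le_div_iff₀ (by positivity) (by positivity)]
            rw [pow_succ] at hJ2; linarith
        _ = √(4 / R) * l ^ (-(1/2) : RR) := by
            rw [sqrt_mul (by positivity), sqrt_inv, sqrt_eq_rpow l, rpow_neg hlp.le]
        _ ≤ _ := by
            gcongr 1
            exact rpow_le_rpow_of_exponent_le (by linarith) (by linarith)
    calc _ ≤ √(4 / R) * l ^ (-δ) * ∫ p, g p := by gcongr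
      _ ≤ √(4 / R) * l ^ (-δ) * (∫ p, g p) * (log l) ^ e := by
          apply le_mul_of_one_le_right (by positivity) (one_le_pow₀ hlog)
      _ = _ := by ring

/-- the final decay function -/
def dec (δ : RR) (e : ℕ) (μ1 μ2 : RR) : RR :=
  (2 + √(μ1 ^ 2 + μ2 ^ 2)) ^ (-δ) * (log (2 + √(μ1 ^ 2 + μ2 ^ 2))) ^ e

lemma weight_final {g : Q2 → RR} {w0 δ R b : RR} {e : ℕ} (hg : Integrable g) (hg0 : ∀ p, 0 ≤ g p)
    (hδ0 : 0 ≤ δ) (hδ : δ < 1 / 2) (hR : 0 < R) (hR1 : R ≤ 1) (hb : 0 ≤ b)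
    (hst : ∀ r, 0 < r → r < R → ∫ p in {p : Q2 | |p.2 - w0 * p.1| < r}, g p ≤ b * r ^ δ * |log r| ^ e) :
    ∃ C, 0 ≤ C ∧ ∀ μ1 μ2, ∫ p, g p * Wt (max |μ1 + w0 * μ2| |μ2|) (p.2 - w0 * p.1) ≤ C * dec δ e μ1 μ2 := by
  obtain ⟨C, hC, h⟩ := weight_large hg hg0 hδ hR hR1 hb hst
  set c : RR := (2 * (2 + |w0|))⁻¹ with hc
  have hc0 : 0 < c := by positivity
  have hc1 : c ≤ 1 := inv_le_one_of_one_le₀ (by linarith [abs_nonneg w0])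
  set L0 := 4 + 4 / R / c with hL0
  have hL0p : 4 ≤ L0 := by rw [hL0]; linarith [show 0 ≤ 4 / R / c by positivity]
  have hI0 : 0 ≤ ∫ p, g p := integral_nonneg hg0
  have hlog2 : 0 < log 2 := log_pos (by norm_num)
  have hint : ∀ l, Integrable (fun p : Q2 => g p * Wt l (p.2 - w0 * p.1)) := fun l => by
    refine Integrable.mono' hg ?_ (ae_of_all _ fun p => ?_)
    · exact hg.aestronglyMeasurable.mul
        ((continuous_Wt l).measurable.comp (by fun_prop)).aestronglyMeasurable
    · rw [norm_eq_abs, abs_of_nonneg (mul_nonneg (hg0 p) (Wt_pos _ _).le)]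
      exact mul_le_of_le_one_right (hg0 p) (Wt_le_one _ _)
  refine ⟨C * c ^ (-δ) + (∫ p, g p) * L0 ^ δ * (log 2 ^ e)⁻¹, by positivity, fun μ1 μ2 => ?_⟩
  set n := √(μ1 ^ 2 + μ2 ^ 2) with hn
  have hn0 : 0 ≤ n := sqrt_nonneg _
  have hd : dec δ e μ1 μ2 = (2 + n) ^ (-δ) * (log (2 + n)) ^ e := rfl
  have hlogn : log 2 ≤ log (2 + n) := log_le_log (by norm_num) (by linarith)
  have hlogn0 : 0 ≤ log (2 + n) := hlog2.le.trans hlogn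
  rw [hd, add_mul]
  rcases le_or_gt L0 (2 + n) with hL | hL
  · have hnl : c * (2 + n) ≤ max |μ1 + w0 * μ2| |μ2| := by
      set M := max |μ1 + w0 * μ2| |μ2| with hM
      have h1 : |μ2| ≤ M := le_max_right _ _
      have h2 : |μ1| ≤ (1 + |w0|) * M := by
        have : |μ1| ≤ |μ1 + w0 * μ2| + |w0 * μ2| := by
          have := abs_sub (μ1 + w0 * μ2) (w0 * μ2); rwa [add_sub_cancel_right] at this
        rw [abs_mul] at this
        have h3 : |μ1 + w0 * μ2| ≤ M := le_max_left _ _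
        nlinarith [abs_nonneg w0]
      have h3 : n ≤ |μ1| + |μ2| := by
        rw [hn, sqrt_le_left (by positivity)]
        nlinarith [sq_abs μ1, sq_abs μ2, abs_nonneg μ1, abs_nonneg μ2]
      rw [hc, ← div_eq_inv_mul, div_le_iff₀ (by positivity)]
      linarith
    have h2 := h (c * (2 + n)) (by
      have : 4 / R / c ≤ 2 + n := by linarith
      rwa [div_le_iff₀ hc0, mul_comm] at this)
    have h4 : 4 / R ≤ c * (2 + n) := by
      have : 4 / R / c ≤ 2 + n := by linarith
      rwa [div_le_iff₀ hc0, mul_comm] at this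
    have h5 : 1 ≤ c * (2 + n) := le_trans (by rw [le_div_iff₀ hR]; linarith) h4
    refine le_add_of_le_of_nonneg ?_ (by positivity)
    calc _ ≤ ∫ p, g p * Wt (c * (2 + n)) (p.2 - w0 * p.1) := by
          apply integral_mono (hint _) (hint _)
          intro p
          exact mul_le_mul_of_nonneg_left (Wt_anti hnl) (hg0 p)
      _ ≤ _ := h2
      _ ≤ C * ((c * (2 + n)) ^ (-δ) * (log (2 + n)) ^ e) := by
          have : log (c * (2 + n)) ≤ log (2 + n) := log_le_log (by linarith) (by nlinarith)
          have h6 := log_nonneg h5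
          gcongr
      _ = _ := by rw [mul_rpow hc0.le (by linarith)]; ring
  · refine le_add_of_nonneg_of_le (by positivity) ?_
    calc _ ≤ ∫ p, g p := by
          apply integral_mono (hint _) hg
          intro p
          exact mul_le_of_le_one_right (hg0 p) (Wt_le_one _ _)
      _ = (∫ p, g p) * L0 ^ δ * (log 2 ^ e)⁻¹ * (L0 ^ (-δ) * log 2 ^ e) := by
          rw [rpow_neg (by linarith : 0 ≤ L0)]
          have : L0 ^ δ ≠ 0 := (rpow_pos_of_pos (by linarith : 0 < L0) δ).ne'
          field_simp
      _ ≤ _ := by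
          have h9 : L0 ^ (-δ) ≤ (2 + n) ^ (-δ) :=
            rpow_le_rpow_of_nonpos (by linarith) hL.le (by linarith)
          gcongr

/-- geometric bounds for a double array -/
def GB (a : ℕ → ℕ → RR) : Prop := ∃ C ρ : RR, 0 < C ∧ 0 < ρ ∧ ∀ i j, |a i j| ≤ C * ρ ^ (i + j)

/-- sum of a double power series -/
def SS (a : ℕ → ℕ → RR) (q : Q2) : RR := ∑' ij : ℕ × ℕ, a ij.1 ij.2 * (q.1 ^ ij.1 * q.2 ^ ij.2)

lemma GB.flip {a : ℕ → ℕ → RR} (h : GB a) : GB (fun i j => a j i) := by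
  obtain ⟨C, ρ, hC, hρ, h⟩ := h
  exact ⟨C, ρ, hC, hρ, fun i j => by rw [add_comm]; exact h j i⟩

lemma GB.shift {a : ℕ → ℕ → RR} (h : GB a) : GB (fun i j => a i (j + 1)) := by
  obtain ⟨C, ρ, hC, hρ, h⟩ := h
  exact ⟨C * ρ, ρ, by positivity, hρ, fun i j => (h i (j + 1)).trans (le_of_eq (by ring))⟩

lemma GB.summable {a : ℕ → ℕ → RR} (h : GB a) : ∃ r > 0, ∀ q : Q2, |q.1| < r → |q.2| < r →
    Summable (fun ij : ℕ × ℕ => a ij.1 ij.2 * (q.1 ^ ij.1 * q.2 ^ ij.2)) := by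
  obtain ⟨C, ρ, hC, hρ, h⟩ := h
  refine ⟨ρ⁻¹, by positivity, fun q h1 h2 => ?_⟩
  rw [← one_div, lt_div_iff₀' hρ] at h1 h2
  have s := ((summable_geometric_of_lt_one (by positivity) h1).mul_of_nonneg
    (summable_geometric_of_lt_one (by positivity) h2) (fun _ => by positivity) (fun _ => by positivity)).mul_left C
  refine Summable.of_norm_bounded s fun ij => ?_
  rw [norm_eq_abs, abs_mul, abs_mul, abs_pow, abs_pow]
  calc _ ≤ C * ρ ^ (ij.1 + ij.2) * (|q.1| ^ ij.1 * |q.2| ^ ij.2) := by gcongr; exact h _ _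
    _ = _ := by rw [mul_pow, mul_pow, pow_add]; ring

lemma near_abs {r : RR} (hr : 0 < r) : ∀ᶠ q : Q2 in 𝓝 0, |q.1| < r ∧ |q.2| < r := by
  have := Metric.ball_mem_nhds (0 : Q2) hr
  filter_upwards [this] with q hq
  rw [mem_ball_zero_iff, Prod.norm_def, max_lt_iff] at hq
  exact hq

lemma SS_flip (a : ℕ → ℕ → RR) (q : Q2) : SS (fun i j => a j i) q = SS a q.swap := by
  unfold SS
  rw [← (Equiv.prodComm ℕ ℕ).tsum_eq]
  exact tsum_congr fun ij => by simp [mul_comm]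

lemma SS_div {a : ℕ → ℕ → RR} (h : GB a) :
    ∀ᶠ q : Q2 in 𝓝 0, SS a q = SS a (q.1, 0) + q.2 * SS (fun i j => a i (j + 1)) q := by
  obtain ⟨r, hr, hs⟩ := h.summable
  obtain ⟨r', hr', hs'⟩ := h.shift.summable
  filter_upwards [near_abs hr, near_abs hr'] with q hq hq'
  have s1 := hs q hq.1 hq.2
  have s0 := hs (q.1, 0) hq.1 (by simpa using hr)
  have s2 := hs' q hq'.1 hq'.2
  unfold SS
  rw [s1.tsum_prod, s0.tsum_prod, s2.tsum_prod, ← tsum_mul_left,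
    ← Summable.tsum_add s0.prod (s2.prod.mul_left _)]
  refine tsum_congr fun i => ?_
  rw [(s1.prod_factor i).tsum_eq_zero_add, tsum_eq_single (f := fun c => a i c * (q.1 ^ i * (0:RR) ^ c)) 0,
    ← tsum_mul_left]
  · congr 1
    exact tsum_congr fun j => by simp only [pow_succ]; ring
  · intro j hj; simp [hj]

lemma SS_zero (a : ℕ → ℕ → RR) : SS a 0 = a 0 0 := by
  unfold SS
  rw [tsum_eq_single (0, 0)]
  · simp
  · rintro ⟨i, j⟩ hij
    by_cases hi : i = 0
    · have hj : j ≠ 0 := by rintro rfl; exact hij (by rw [hi])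
      simp [hj]
    · simp [hi]

lemma hasSum_antidiag {f : ℕ × ℕ → RR} (hf : Summable f) :
    HasSum (fun n => ∑ ij ∈ Finset.HasAntidiagonal.antidiagonal n, f ij) (∑' ij, f ij) := by
  have s' := (Finset.HasAntidiagonal.sigmaAntidiagonalEquivProd.hasSum_iff.2 hf.hasSum).sigma (fun n => hasSum_fintype _)
  convert s' using 2 with n
  exact (Finset.sum_coe_sort _ f).symm

/-- monomial as a multilinear map -/
def mono (n i : ℕ) : ContinuousMultilinearMap RR (fun _ : Fin n => Q2) RR :=
  (ContinuousMultilinearMap.mkPiAlgebra RR (Fin n) RR).compContinuousLinearMap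
    (fun l => if l.1 < i then ContinuousLinearMap.fst RR RR RR else ContinuousLinearMap.snd RR RR RR)

lemma mono_apply (i j : ℕ) (v : Q2) : mono (i + j) i (fun _ => v) = v.1 ^ i * v.2 ^ j := by
  unfold mono
  rw [ContinuousMultilinearMap.compContinuousLinearMap_apply, ContinuousMultilinearMap.mkPiAlgebra_apply]
  rw [Fin.prod_univ_add]
  congr 1
  · rw [Finset.prod_congr rfl (g := fun _ => v.1)]
    · simp
    · intro l _; simp
  · rw [Finset.prod_congr rfl (g := fun _ => v.2)]
    · simp
    · intro l _; simp

lemma norm_mono (n i : ℕ) : ‖mono n i‖ ≤ 1 := by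
  unfold mono
  refine (ContinuousMultilinearMap.norm_compContinuousLinearMap_le _ _).trans ?_
  rw [ContinuousMultilinearMap.norm_mkPiAlgebra, one_mul]
  refine Finset.prod_le_one (fun _ _ => norm_nonneg _) fun l _ => ?_
  split_ifs
  · exact ContinuousLinearMap.norm_fst_le ..
  · exact ContinuousLinearMap.norm_snd_le ..

lemma SS_analytic {a : ℕ → ℕ → RR} (h : GB a) : AnalyticAt RR (SS a) 0 := by
  obtain ⟨r, hr, hs⟩ := h.summable
  obtain ⟨C, ρ, hC, hρ, h⟩ := h
  let p : FormalMultilinearSeries RR Q2 RR := fun n =>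
    ∑ ij ∈ Finset.HasAntidiagonal.antidiagonal n, a ij.1 ij.2 • mono n ij.1
  have hp : ∀ n v, p n (fun _ => v) = ∑ ij ∈ Finset.HasAntidiagonal.antidiagonal n, a ij.1 ij.2 * (v.1 ^ ij.1 * v.2 ^ ij.2) := by
    intro n v
    simp only [p, ContinuousMultilinearMap.sum_apply, ContinuousMultilinearMap.smul_apply, smul_eq_mul]
    refine Finset.sum_congr rfl fun ij hij => ?_
    have := Finset.HasAntidiagonal.mem_antidiagonal.1 hij
    subst this
    rw [mono_apply]
  have hn : ∀ n, ‖p n‖ ≤ C * (2 * ρ) ^ n := by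
    intro n
    refine (norm_sum_le _ _).trans ?_
    calc _ ≤ ∑ ij ∈ Finset.HasAntidiagonal.antidiagonal n, C * ρ ^ n := by
          refine Finset.sum_le_sum fun ij hij => ?_
          rw [norm_smul]
          have h1 := h ij.1 ij.2
          rw [Finset.HasAntidiagonal.mem_antidiagonal.1 hij] at h1
          calc _ ≤ C * ρ ^ n * 1 := by
                gcongr
                · exact h1
                · exact norm_mono _ _
            _ = _ := mul_one _
      _ = (n + 1) * (C * ρ ^ n) := by simp
      _ ≤ 2 ^ n * (C * ρ ^ n) := by
          gcongr
          exact_mod_cast Nat.succ_le_of_lt Nat.lt_two_pow_self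
      _ = _ := by rw [mul_pow]; ring
  set R : NNReal := ⟨min r (2 * ρ)⁻¹, by positivity⟩ with hR
  have hRp : 0 < (R : RR) := by
    show (0:RR) < min r (2 * ρ)⁻¹
    positivity
  refine ⟨p, R, ?_, by exact_mod_cast hRp, ?_⟩
  · refine p.le_radius_of_bound C fun n => ?_
    have h1 : (R : RR) ≤ (2 * ρ)⁻¹ := min_le_right _ _
    calc _ ≤ C * (2 * ρ) ^ n * ((2 * ρ)⁻¹) ^ n := by gcongr; exact hn n
      _ = C := by rw [mul_assoc, ← mul_pow, mul_inv_cancel₀ (by positivity), one_pow, mul_one]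
  · intro y hy
    rw [zero_add]
    have hy' : ‖y‖ < r := by
      rw [Metric.mem_eball, edist_zero_right, ← ofReal_norm, ENNReal.ofReal_lt_coe_iff (norm_nonneg y)] at hy
      exact hy.trans_le (min_le_left _ _)
    rw [Prod.norm_def, max_lt_iff] at hy'
    simp only [hp]
    exact hasSum_antidiag (hs y hy'.1 hy'.2)

lemma exists_SS {F : Q2 → RR} (hF : AnalyticAt RR F 0) : ∃ a, GB a ∧ F =ᶠ[𝓝 0] SS a := by
  obtain ⟨p, hp⟩ := hF
  obtain ⟨C, ρ, hC, hρ, hb⟩ := p.le_mul_pow_of_radius_pos hp.radius_pos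
  let b : ∀ n, Finset (Fin n) → RR := fun n s => p n (s.piecewise (fun _ => ((1:RR), (0:RR))) (fun _ => ((0:RR), (1:RR))))
  have hbn : ∀ n s, |b n s| ≤ C * ρ ^ n := fun n s => by
    refine ((p n).le_opNorm _).trans ?_
    refine (mul_le_of_le_one_right (norm_nonneg _) ?_).trans (hb n)
    refine Finset.prod_le_one (fun _ _ => norm_nonneg _) fun l _ => ?_
    by_cases hl : l ∈ s <;> simp [hl, Prod.norm_def]
  have hpn : ∀ n v, p n (fun _ => v) = ∑ s : Finset (Fin n), b n s * (v.1 ^ s.card * v.2 ^ (n - s.card)) := by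
    intro n v
    have e : (fun _ : Fin n => v) = (fun _ => v.1 • ((1:RR), (0:RR))) + (fun _ => v.2 • ((0:RR), (1:RR))) := by
      ext l <;> simp
    rw [e, ContinuousMultilinearMap.map_add_univ]
    refine Finset.sum_congr rfl fun s _ => ?_
    have e2 : s.piecewise (fun _ : Fin n => v.1 • ((1:RR), (0:RR))) (fun _ => v.2 • ((0:RR), (1:RR))) =
        fun l => (if l ∈ s then v.1 else v.2) • (s.piecewise (fun _ => ((1:RR), (0:RR))) (fun _ => ((0:RR), (1:RR))) : Fin n → Q2) l := by
      ext l <;> by_cases hl : l ∈ s <;> simp [hl]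
    rw [e2, ContinuousMultilinearMap.map_smul_univ, Finset.prod_ite, smul_eq_mul, mul_comm]
    simp only [Finset.prod_const]
    have c1 : (Finset.univ.filter (fun l => l ∈ s)).card = s.card := by simp
    have c2 : (Finset.univ.filter (fun l => l ∉ s)).card = n - s.card := by
      rw [Finset.filter_not, ← Finset.compl_eq_univ_sdiff, Finset.card_compl]; simp
    rw [c1, c2]
  let a : ℕ → ℕ → RR := fun i j => ∑ s : Finset (Fin (i + j)) with s.card = i, b (i + j) s
  have ha : GB a := by
    refine ⟨C, 2 * ρ, hC, by positivity, fun i j => ?_⟩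
    refine (Finset.abs_sum_le_sum_abs _ _).trans ((Finset.sum_le_sum fun s _ => hbn _ s).trans ?_)
    rw [Finset.sum_const, nsmul_eq_mul]
    have : ((Finset.univ.filter (fun s : Finset (Fin (i + j)) => s.card = i)).card : RR) ≤ 2 ^ (i + j) := by
      have := Finset.card_filter_le (Finset.univ : Finset (Finset (Fin (i + j)))) (fun s => s.card = i)
      rw [Finset.card_univ, Fintype.card_finset, Fintype.card_fin] at this
      exact_mod_cast this
    rw [mul_pow]
    nlinarith [show 0 < C * ρ ^ (i + j) by positivity]
  refine ⟨a, ha, ?_⟩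
  obtain ⟨r, hr, hs⟩ := ha.summable
  filter_upwards [hp.eventually_hasSum_sub, near_abs hr] with q hq hqr
  rw [sub_zero] at hq
  refine hq.unique ?_
  have key : (fun n => p n fun _ => q) = fun n => ∑ ij ∈ Finset.HasAntidiagonal.antidiagonal n,
      a ij.1 ij.2 * (q.1 ^ ij.1 * q.2 ^ ij.2) := by
   funext n
   rw [hpn, ← Finset.sum_fiberwise_of_maps_to (t := Finset.HasAntidiagonal.antidiagonal n) (g := fun s => (s.card, n - s.card))]
   · refine Finset.sum_congr rfl fun ij hij => ?_
     have := Finset.HasAntidiagonal.mem_antidiagonal.1 hij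
     subst this
     rw [Finset.sum_mul]
     refine Finset.sum_congr ?_ ?_
     · ext s
       simp only [Finset.mem_filter, Finset.mem_univ, true_and, Prod.ext_iff]
       lia
     · intro s hs
       have := (Finset.mem_filter.1 hs).2
       rw [this, Nat.add_sub_cancel_left]
   · intro s _
     rw [Finset.HasAntidiagonal.mem_antidiagonal]
     have := s.card_le_univ
     rw [Fintype.card_fin] at this
     simp only; lia
  rw [key]
  exact hasSum_antidiag (hs q hqr.1 hqr.2)

lemma GB.shiftN {a : ℕ → ℕ → RR} (h : GB a) (r : ℕ) : GB (fun i j => a i (j + r)) := by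
  induction r with
  | zero => exact h
  | succ r ih =>
    have := ih.shift
    simpa only [add_assoc, add_comm 1 r] using this

lemma SS_iter {a : ℕ → ℕ → RR} (h : GB a) (k : ℕ) : ∀ᶠ q : Q2 in 𝓝 0,
    SS a q = ∑ r ∈ Finset.range k, SS (fun i j => a i (j + r)) (q.1, 0) * q.2 ^ r
      + q.2 ^ k * SS (fun i j => a i (j + k)) q := by
  induction k with
  | zero => simp
  | succ k ih =>
    filter_upwards [ih, SS_div (h.shiftN k)] with q h1 h2
    rw [h1, h2, Finset.sum_range_succ]
    simp only [add_assoc, add_comm 1 k]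
    ring

lemma SS_row0 {a : ℕ → ℕ → RR} (h : ∀ i, a i 0 = 0) (t : RR) : SS a (t, 0) = 0 := by
  unfold SS
  convert tsum_zero with ij
  rcases ij with ⟨i, _ | j⟩
  · simp [h]
  · simp

/-- order k in the second variable on the first axis -/
def Reg (F : Q2 → RR) (k : ℕ) : Prop := AnalyticAt RR F 0 ∧ ∃ u : RR → RR, ContinuousAt u 0 ∧ u 0 ≠ 0 ∧
  ∀ᶠ w in 𝓝 (0:RR), F (0, w) = w ^ k * u w

lemma tendsto_slice2 : Tendsto (fun w : RR => ((0:RR), w)) (𝓝 0) (𝓝 (0 : Q2)) := by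
  have : Continuous (fun w : RR => ((0:RR), w)) := by fun_prop
  exact this.tendsto' _ _ rfl

lemma tendsto_slice1 : Tendsto (fun t : RR => (t, (0:RR))) (𝓝 0) (𝓝 (0 : Q2)) := by
  have : Continuous (fun w : RR => (w, (0:RR))) := by fun_prop
  exact this.tendsto' _ _ rfl

/-- expansion in the second variable -/
def Expd (F : Q2 → RR) (k : ℕ) (a : ℕ → RR → RR) (U : Q2 → RR) : Prop :=
  (∀ r, AnalyticAt RR (a r) 0) ∧ AnalyticAt RR U 0 ∧
    ∀ᶠ q : Q2 in 𝓝 0, F q = ∑ r ∈ Finset.range k, a r q.1 * q.2 ^ r + q.2 ^ k * U q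

lemma eq_at_zero {u v : RR → RR} (hu : ContinuousAt u 0) (hv : ContinuousAt v 0) {j : ℕ}
    (h : ∀ᶠ w in 𝓝 (0:RR), w ^ j * u w = w ^ j * v w) : u 0 = v 0 := by
  have h1 : ∀ᶠ w in 𝓝[≠] (0:RR), u w = v w := by
    filter_upwards [h.filter_mono nhdsWithin_le_nhds, self_mem_nhdsWithin] with w hw hw0
    exact mul_left_cancel₀ (pow_ne_zero _ hw0) hw
  have h2 := (hu.tendsto.mono_left nhdsWithin_le_nhds : Tendsto u (𝓝[≠] 0) _)
  exact tendsto_nhds_unique (h2.congr' h1) (hv.tendsto.mono_left nhdsWithin_le_nhds)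

lemma Reg.expand {F : Q2 → RR} {k : ℕ} (h : Reg F k) : ∃ a U, Expd F k a U ∧
    (∀ r < k, a r 0 = 0) ∧ U 0 ≠ 0 := by
  obtain ⟨hF, u, hu, hu0, hFu⟩ := h
  obtain ⟨A, hA, hFA⟩ := exists_SS hF
  have h1 : ∀ r, (∀ r' < r, A 0 r' = 0) → r ≤ k → A 0 r = 0 ^ (k - r) * u 0 := by
    intro r hr hrk
    have := SS_zero (fun i j => A i (j + r))
    rw [zero_add] at this
    rw [← this]
    refine eq_at_zero (j := r) (u := fun w => SS (fun i j => A i (j + r)) (0, w)) (v := fun w => w ^ (k - r) * u w) ?_ ?_ ?_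
    · exact ContinuousAt.comp (f := fun w : RR => ((0:RR), w)) (g := SS (fun i j => A i (j + r)))
        ((SS_analytic (hA.shiftN r)).continuousAt) (by fun_prop)
    · fun_prop
    · filter_upwards [hFu, tendsto_slice2.eventually hFA, tendsto_slice2.eventually (SS_iter hA r)] with w h1 h2 h3
      rw [← mul_assoc, ← pow_add, Nat.add_sub_cancel' hrk, ← h1, h2, h3, Finset.sum_eq_zero, zero_add]
      intro r' hr'
      have := SS_zero (fun i j => A i (j + r'))
      rw [zero_add, hr r' (Finset.mem_range.1 hr')] at this
      show SS _ 0 * _ = 0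
      rw [this, zero_mul]
  have h2 : ∀ r < k, A 0 r = 0 := by
    intro r
    induction r using Nat.strong_induction_on with
    | _ r ih =>
      intro hr
      rw [h1 r (fun r' h => ih r' h (h.trans hr)) hr.le, zero_pow (by lia), zero_mul]
  refine ⟨fun r t => SS (fun i j => A i (j + r)) (t, 0), SS (fun i j => A i (j + k)), ⟨fun r => ?_, SS_analytic (hA.shiftN k), ?_⟩, ?_, ?_⟩
  · exact AnalyticAt.comp (f := fun t : RR => (t, (0:RR))) (g := SS (fun i j => A i (j + r))) (SS_analytic (hA.shiftN r)) (by fun_prop)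
  · filter_upwards [hFA, SS_iter hA k] with q h1 h2
    rw [h1, h2]
  · intro r hr
    show SS _ 0 = 0
    rw [SS_zero, zero_add, h2 r hr]
  · rw [SS_zero, zero_add, h1 k h2 le_rfl]
    simpa using hu0

lemma exists_factor {Φ : Q2 → RR} (hΦ : AnalyticAt RR Φ 0) (h0 : ¬ ∀ᶠ q in 𝓝 0, Φ q = 0) :
    ∃ m k F, Reg F k ∧ ∀ᶠ q : Q2 in 𝓝 0, Φ q = q.1 ^ m * F q := by
  obtain ⟨A, hA, hFA⟩ := exists_SS hΦ
  have hex : ∃ i, ∃ j, A i j ≠ 0 := by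
    by_contra! hc
    apply h0
    filter_upwards [hFA] with q hq
    rw [hq]; simp [SS, hc]
  classical
  set m := Nat.find hex
  have hm := Nat.find_spec hex
  have hm' : ∀ i < m, ∀ j, A i j = 0 := by
    intro i hi j
    have := Nat.find_min hex hi
    push Not at this
    exact this j
  set k := Nat.find hm
  have hk := Nat.find_spec hm
  have hk' : ∀ j < k, A m j = 0 := by
    intro j hj
    have := Nat.find_min hm hj
    push Not at this
    exact this
  have hB : GB (fun i j => A (i + m) j) := (hA.flip.shiftN m).flip
  refine ⟨m, k, SS (fun i j => A (i + m) j), ⟨SS_analytic hB, fun w => SS (fun i j => A (i + m) (j + k)) (0, w), ?_, ?_, ?_⟩, ?_⟩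
  · exact ContinuousAt.comp (f := fun w : RR => ((0:RR), w)) (g := SS (fun i j => A (i + m) (j + k)))
        ((SS_analytic (hB.shiftN k)).continuousAt) (by fun_prop)
  · show SS _ 0 ≠ 0
    rw [SS_zero, zero_add, zero_add]
    exact hk
  · filter_upwards [tendsto_slice2.eventually (SS_iter hB k)] with w hw
    rw [hw, Finset.sum_eq_zero, zero_add]
    intro r hr
    show SS _ 0 * _ = 0
    rw [SS_zero, zero_add, zero_add, hk' r (Finset.mem_range.1 hr), zero_mul]
  · have hsw : Tendsto (Prod.swap : Q2 → Q2) (𝓝 0) (𝓝 0) := continuous_swap.tendsto' _ _ rfl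
    filter_upwards [hFA, hsw.eventually (SS_iter hA.flip m)] with q h1 h2
    rw [SS_flip, Prod.swap_swap] at h2
    rw [h1, h2, Finset.sum_eq_zero, zero_add, SS_flip (fun i j => A (i + m) j), Prod.swap_swap]
    · simp
    · intro r hr
      rw [SS_row0, zero_mul]
      intro i
      simp [hm' r (Finset.mem_range.1 hr)]

/-- derivative in the second variable -/
def Dw (F : Q2 → RR) (q : Q2) : RR := deriv (fun w => F (q.1, w)) q.2

lemma Dw_congr {F G : Q2 → RR} (h : F =ᶠ[𝓝 0] G) : Dw F =ᶠ[𝓝 0] Dw G := by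
  filter_upwards [h.eventuallyEq_nhds] with q hq
  refine Filter.EventuallyEq.deriv_eq ?_
  have : Tendsto (fun w : RR => (q.1, w)) (𝓝 q.2) (𝓝 q) := by
    have : Continuous (fun w : RR => (q.1, w)) := by fun_prop
    exact this.tendsto q.2
  exact this.eventually hq

lemma hasDerivAt_slice {F : Q2 → RR} {q : Q2} (hF : DifferentiableAt RR F q) :
    HasDerivAt (fun w => F (q.1, w)) (fderiv RR F q (0, 1)) q.2 :=
  HasFDerivAt.comp_hasDerivAt (f := fun w : RR => (q.1, w)) q.2 hF.hasFDerivAt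
    ((hasDerivAt_const _ _).prodMk (hasDerivAt_id _))

lemma hasDerivAt_slice1 {F : Q2 → RR} {q : Q2} (hF : DifferentiableAt RR F q) :
    HasDerivAt (fun t => F (t, q.2)) (fderiv RR F q (1, 0)) q.1 :=
  HasFDerivAt.comp_hasDerivAt (f := fun w : RR => (w, q.2)) q.1 hF.hasFDerivAt
    ((hasDerivAt_id _).prodMk (hasDerivAt_const _ _))

lemma Dw_analytic {F : Q2 → RR} (hF : AnalyticAt RR F 0) : AnalyticAt RR (Dw F) 0 := by
  have h1 : AnalyticAt RR (fun q => fderiv RR F q (0, 1)) 0 :=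
    (ContinuousLinearMap.analyticAt (ContinuousLinearMap.apply RR RR ((0:RR), (1:RR))) _).comp hF.fderiv
  refine h1.congr ?_
  filter_upwards [hF.eventually_analyticAt] with q hq
  exact (hasDerivAt_slice hq.differentiableAt).deriv.symm

lemma Dw_expd {F : Q2 → RR} {k : ℕ} {a : ℕ → RR → RR} {U : Q2 → RR} (h : Expd F (k + 1) a U) :
    Expd (Dw F) k (fun r t => (r + 1) * a (r + 1) t) (fun q => (k + 1) * U q + q.2 * Dw U q) := by
  obtain ⟨ha, hU, hF⟩ := h
  have hD := Dw_analytic hU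
  refine ⟨fun r => analyticAt_const.mul (ha _), (analyticAt_const.mul hU).add (analyticAt_snd.mul hD), ?_⟩
  filter_upwards [Dw_congr hF, hU.eventually_analyticAt] with q hq hq2
  rw [hq]
  have h1 := hasDerivAt_slice hq2.differentiableAt
  have h2 : HasDerivAt (fun w : RR => ∑ r ∈ Finset.range (k + 1), a r q.1 * w ^ r) (∑ r ∈ Finset.range (k + 1), a r q.1 * (r * q.2 ^ (r - 1))) q.2 :=
    HasDerivAt.fun_sum fun r _ => (hasDerivAt_pow r q.2).const_mul _
  have h3 := h2.fun_add ((hasDerivAt_pow (k + 1) q.2).fun_mul h1)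
  unfold Dw
  rw [h3.deriv, h1.deriv, Finset.sum_range_succ']
  simp only [Nat.cast_zero, zero_mul, mul_zero, add_zero, Nat.add_sub_cancel, Nat.cast_add, Nat.cast_one]
  rw [Finset.sum_congr rfl (g := fun r : ℕ => ((r:RR) + 1) * a (r + 1) q.1 * q.2 ^ r) (fun r _ => by ring)]
  ring

lemma Dw_iter_expd {F : Q2 → RR} {k : ℕ} {a : ℕ → RR → RR} {U : Q2 → RR} (h : Expd F (k + 1) a U) :
    ∃ V, AnalyticAt RR V 0 ∧ (U 0 ≠ 0 → V 0 ≠ 0) ∧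
      ∀ᶠ q : Q2 in 𝓝 0, Dw^[k] F q = (k.factorial : RR) * a k q.1 + q.2 * V q := by
  induction k generalizing F a U with
  | zero =>
    refine ⟨U, h.2.1, id, ?_⟩
    filter_upwards [h.2.2] with q hq
    simp [hq]
  | succ k ih =>
    obtain ⟨V, hV, hV0, hVe⟩ := ih (Dw_expd h)
    refine ⟨V, hV, fun hU => hV0 ?_, ?_⟩
    · simp only [Prod.snd_zero, zero_mul, add_zero]
      exact mul_ne_zero (by positivity) hU
    · filter_upwards [hVe] with q hq
      rw [Function.iterate_succ_apply, hq, Nat.factorial_succ]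
      push_cast; ring

lemma Dw_iter_shift (F : Q2 → RR) (c : RR → RR) (k : ℕ) :
    Dw^[k] (fun q => F (q.1, c q.1 + q.2)) = fun q => (Dw^[k] F) (q.1, c q.1 + q.2) := by
  induction k generalizing F with
  | zero => rfl
  | succ k ih =>
    rw [Function.iterate_succ_apply, Function.iterate_succ_apply, ← ih]
    congr 1
    funext q
    exact deriv_comp_const_add (f := fun w => F (q.1, w)) (c q.1) q.2

lemma exists_center {F : Q2 → RR} {k : ℕ} (h : Reg F (k + 1)) : ∃ c : RR → RR, AnalyticAt RR c 0 ∧ c 0 = 0 ∧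
    ∀ a U, Expd (fun q => F (q.1, c q.1 + q.2)) (k + 1) a U → ∀ᶠ t in 𝓝 0, a k t = 0 := by
  obtain ⟨a, U, he, ha, hU⟩ := h.expand
  obtain ⟨V, hV, hV0, hVe⟩ := Dw_iter_expd he
  set H : Q2 → RR := fun q => (k.factorial : RR) * a k q.1 + q.2 * V q with hH
  have hak : AnalyticAt RR (fun q : Q2 => a k q.1) 0 := AnalyticAt.comp (f := Prod.fst) (g := a k) (x := (0 : Q2)) (he.1 k) analyticAt_fst
  have hHa : AnalyticAt RR H 0 := (analyticAt_const.mul hak).add (analyticAt_snd.mul hV)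
  have hd : HasDerivAt (fun w => H (0, w)) (V 0) 0 := by
    have h1 := hasDerivAt_slice hV.differentiableAt
    have := ((hasDerivAt_id (0:RR)).fun_mul h1).const_add ((k.factorial : RR) * a k 0)
    exact this.congr_deriv (by show 1 * V 0 + 0 * _ = V 0; ring)
  have hfd : fderiv RR H 0 (0, 1) = V 0 := (hasDerivAt_slice (q := 0) hHa.differentiableAt).unique hd
  have hcd : ContDiffAt RR ⊤ H 0 := hHa.contDiffAt
  have hinv : (fderiv RR H 0 ∘L .inr RR RR RR).IsInvertible := by
    refine ⟨ContinuousLinearEquiv.unitsEquivAut RR (Units.mk0 (V 0) (hV0 hU)), ?_⟩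
    ext
    simp [hfd]
  have hn : (⊤ : WithTop ℕ∞) ≠ 0 := by simp
  have hc0 : hcd.implicitFunction hn hinv 0 = 0 := hcd.implicitFunction_apply_self hn hinv
  have hca : AnalyticAt RR (hcd.implicitFunction hn hinv) 0 := (hcd.contDiffAt_implicitFunction hn hinv).analyticAt
  refine ⟨hcd.implicitFunction hn hinv, hca, hc0, fun a' U' he' => ?_⟩
  obtain ⟨V', -, -, hVe'⟩ := Dw_iter_expd he'
  have h3 := hcd.eventually_apply_implicitFunction hn hinv
  have hS : Tendsto (fun t => (t, hcd.implicitFunction hn hinv t)) (𝓝 0) (𝓝 (0 : Q2)) := by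
    have : ContinuousAt (fun t => (t, hcd.implicitFunction hn hinv t)) 0 := by
      have := hca.continuousAt
      fun_prop
    have := this.tendsto
    rwa [hc0] at this
  filter_upwards [tendsto_slice1.eventually hVe', hS.eventually hVe, h3] with t h1 h2 h3
  rw [Dw_iter_shift] at h1
  simp only [add_zero, zero_mul] at h1
  have h4 : H (t, hcd.implicitFunction hn hinv t) = (k.factorial : RR) * a' k t := h2.symm.trans h1
  rw [h3] at h4
  have : H 0 = 0 := by simp [hH, ha k (by lia)]
  rw [this] at h4
  have hf : (k.factorial : RR) ≠ 0 := by positivity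
  exact (mul_eq_zero.1 h4.symm).resolve_left hf

/-- logarithmic derivative bound -/
def LD (C : RR) (v : Q2) (G : Q2 → RR) (q : Q2) : Prop :=
  DifferentiableAt RR G q ∧ |fderiv RR G q v| ≤ C * |G q|

lemma LD.mul {C C' : RR} {v q : Q2} {G G' : Q2 → RR} (h : LD C v G q) (h' : LD C' v G' q) :
    LD (C + C') v (fun p => G p * G' p) q := by
  refine ⟨h.1.mul h'.1, ?_⟩
  rw [fderiv_fun_mul h.1 h'.1]
  simp only [_root_.add_apply, _root_.smul_apply, smul_eq_mul]
  refine (abs_add_le _ _).trans ?_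
  rw [abs_mul, abs_mul, abs_mul]
  nlinarith [mul_le_mul_of_nonneg_left h.2 (abs_nonneg (G' q)), mul_le_mul_of_nonneg_left h'.2 (abs_nonneg (G q))]

lemma LD.prod {ι : Type*} {C : ι → RR} {v q : Q2} {G : ι → Q2 → RR} (s : Finset ι)
    (h : ∀ i ∈ s, LD (C i) v (G i) q) : LD (∑ i ∈ s, C i) v (fun p => ∏ i ∈ s, G i p) q := by
  classical
  induction s using Finset.induction_on with
  | empty => simp [LD]
  | insert a s ha ih =>
    simp only [Finset.prod_insert ha, Finset.sum_insert ha]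
    exact (h a (by simp)).mul (ih fun i hi => h i (by simp [hi]))

lemma LD.rpow_abs {C : RR} {v q : Q2} {G : Q2 → RR} (h : LD C v G q) (h0 : G q ≠ 0) (γ : RR) :
    LD (|γ| * C) v (fun p => |G p| ^ γ) q := by
  have e : (fun p => |G p| ^ γ) = (fun s : RR => |s| ^ γ) ∘ G := rfl
  have hd : HasDerivAt (fun s : RR => |s| ^ γ) ((SignType.sign (G q) : RR) * γ * |G q| ^ (γ - 1)) (G q) :=
    HasDerivAt.rpow_const (hasDerivAt_abs h0) (Or.inl (abs_ne_zero.2 h0))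
  have hc := hd.comp_hasFDerivAt q h.1.hasFDerivAt
  refine ⟨hc.differentiableAt, ?_⟩
  rw [e, hc.fderiv, _root_.smul_apply, smul_eq_mul]
  have hp := abs_pos.2 h0
  have hs : |((SignType.sign (G q) : SignType) : RR)| = 1 := by
    rcases lt_or_gt_of_ne h0 with h | h <;> simp [h]
  simp only [Function.comp]
  rw [abs_mul, abs_mul, abs_mul, hs, one_mul, abs_of_nonneg (rpow_nonneg (abs_nonneg _) _),
    abs_of_nonneg (rpow_nonneg (abs_nonneg (G q)) γ), rpow_sub_one hp.ne']
  calc _ ≤ |γ| * (|G q| ^ γ / |G q|) * (C * |G q|) := by gcongr; exact h.2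
    _ = _ := by field_simp

lemma LD.congr {C : RR} {v q : Q2} {G G' : Q2 → RR} (h : LD C v G q) (e : G' =ᶠ[𝓝 q] G) : LD C v G' q := by
  unfold LD
  rw [e.fderiv_eq, e.eq_of_nhds]
  exact ⟨h.1.congr_of_eventuallyEq e, h.2⟩

/-- the chart of a node -/
def chart (N L : ℕ) (κ : RR → RR) (w0 : RR) (q : Q2) : Q2 :=
  (q.1 ^ N, w0 * q.1 ^ N + κ q.1 + q.1 ^ L * q.2)

/-- node of the resolution tree -/
structure IsNode {ι : Type} [Fintype ι] (g : Q2 → RR) (D : Set Q2) (γ : ι → RR) (w0 : RR)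
    (N L : ℕ) (κ : RR → RR) (m : RR) (F : ι → Q2 → RR) (k : ι → ℕ) : Prop where
  hN : 0 < N
  hL : N ≤ L
  κm : Measurable κ
  hκ : ∃ κ1 : RR → RR, AnalyticAt RR κ1 0 ∧ κ1 0 = 0 ∧ ∀ᶠ t in 𝓝 0, κ t = t ^ N * κ1 t
  reg : ∀ i, Reg (F i) (k i)
  rep : ∀ᶠ q : Q2 in 𝓝 0, 0 < q.1 → g (chart N L κ w0 q) =
    D.indicator 1 (chart N L κ w0 q) * (|q.1| ^ m * ∏ i, |F i q| ^ γ i)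
  fr : ∀ᶠ q : Q2 in 𝓝 0, 0 < q.1 → chart N L κ w0 q ∈ frontier D → ∃ i, F i q = 0

/-- amplitude class -/
structure Amp (v : Q2 → Q2) (χ : Q2 → Q2) (S : Set Q2) (Ψ : Q2 → RR) : Prop where
  meas : Measurable Ψ
  pos : ∀ p, Ψ p ≠ 0 → 0 < p.1
  supp : ∀ q : Q2, 0 < q.1 → Ψ (χ q) ≠ 0 → q ∈ S
  bd : ∃ C, 0 ≤ C ∧ ∀ q : Q2, 0 < q.1 → DifferentiableAt RR (fun q => Ψ (χ q)) q ∧ |Ψ (χ q)| ≤ C ∧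
    |fderiv RR (fun q => Ψ (χ q)) q (q.1, 0)| ≤ C ∧ |fderiv RR (fun q => Ψ (χ q)) q (v q)| ≤ C

/-- the target estimate -/
def Good (g : Q2 → RR) (w0 : RR) (Ψ : Q2 → RR) : Prop :=
  ∃ C, ∀ μ1 μ2, ‖∫ p : Q2, ((g p * Ψ p : RR) : ℂ) * ee (μ1 * p.1 + μ2 * p.2)‖ ≤
    C * ∫ p : Q2, g p * Wt (max |μ1 + w0 * μ2| |μ2|) (p.2 - w0 * p.1)

/-- inverse of the chart -/
def tinv (N : ℕ) (p : Q2) : RR := p.1 ^ ((N : RR)⁻¹)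
/-- inverse of the chart -/
def winv (N L : ℕ) (κ : RR → RR) (w0 : RR) (p : Q2) : RR := (p.2 - w0 * p.1 - κ (tinv N p)) / tinv N p ^ L

lemma tinv_pos {N : ℕ} {p : Q2} (hp : 0 < p.1) : 0 < tinv N p := rpow_pos_of_pos hp _

lemma tinv_pow {N : ℕ} (hN : 0 < N) {p : Q2} (hp : 0 < p.1) : tinv N p ^ N = p.1 :=
  rpow_inv_natCast_pow hp.le hN.ne'

lemma chart_inv {N L : ℕ} (hN : 0 < N) (κ : RR → RR) (w0 : RR) {p : Q2} (hp : 0 < p.1) :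
    chart N L κ w0 (tinv N p, winv N L κ w0 p) = p := by
  have h1 := tinv_pos (N := N) hp
  have h2 := tinv_pow hN hp
  unfold chart winv
  ext
  · exact h2
  · simp only [h2]
    field_simp
    ring

lemma tinv_chart {N L : ℕ} (hN : 0 < N) (κ : RR → RR) (w0 : RR) {q : Q2} (hq : 0 < q.1) :
    tinv N (chart N L κ w0 q) = q.1 := pow_rpow_inv_natCast hq.le hN.ne'

lemma winv_chart {N L : ℕ} (hN : 0 < N) (κ : RR → RR) (w0 : RR) {q : Q2} (hq : 0 < q.1) :
    winv N L κ w0 (chart N L κ w0 q) = q.2 := by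
  unfold winv
  rw [tinv_chart hN κ w0 hq]
  simp only [chart]
  field_simp
  ring

lemma winv_meas {N L : ℕ} {κ : RR → RR} (hκ : Measurable κ) (w0 : RR) : Measurable (winv N L κ w0) := by
  have h : Measurable (tinv N) := by unfold tinv; fun_prop
  unfold winv
  have := hκ.comp h
  simp only [Function.comp_def] at this
  fun_prop

lemma Amp.abs_le {v χ S Ψ} {N L : ℕ} {κ : RR → RR} {w0 : RR} (hN : 0 < N) (hχ : χ = chart N L κ w0) (h : Amp v χ S Ψ) :
    ∃ C, 0 ≤ C ∧ ∀ p, |Ψ p| ≤ C := by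
  obtain ⟨C, hC, hb⟩ := h.bd
  refine ⟨C, hC, fun p => ?_⟩
  by_cases hp : Ψ p = 0
  · rw [hp, abs_zero]; exact hC
  · have h1 := h.pos p hp
    have := (hb (tinv N p, winv N L κ w0 p) (tinv_pos h1)).2.1
    rwa [hχ, chart_inv hN κ w0 h1] at this

lemma Good.add {g Ψ Ψ' : Q2 → RR} {w0 : RR} (hg : Integrable g) (hΨ : Measurable Ψ) (hΨ' : Measurable Ψ')
    (hb : ∃ C, ∀ p, |Ψ p| ≤ C) (hb' : ∃ C, ∀ p, |Ψ' p| ≤ C) (h : Good g w0 Ψ) (h' : Good g w0 Ψ') :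
    Good g w0 (fun p => Ψ p + Ψ' p) := by
  obtain ⟨C, h⟩ := h
  obtain ⟨C', h'⟩ := h'
  have hi : ∀ (Ψ : Q2 → RR) (μ1 μ2 : RR), Measurable Ψ → (∃ C, ∀ p, |Ψ p| ≤ C) →
      Integrable (fun p : Q2 => ((g p * Ψ p : RR) : ℂ) * ee (μ1 * p.1 + μ2 * p.2)) := by
    rintro Ψ μ1 μ2 hm ⟨C, hC⟩
    have h1 : Integrable (fun p => g p * Ψ p) := hg.mul_bdd hm.aestronglyMeasurable (Eventually.of_forall hC)
    refine h1.ofReal.mul_bdd (c := 1) ?_ (Eventually.of_forall fun p => (norm_ee _).le)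
    exact (continuous_ee.comp (by fun_prop)).aestronglyMeasurable
  refine ⟨C + C', fun μ1 μ2 => ?_⟩
  have : ∀ p : Q2, ((g p * (Ψ p + Ψ' p) : RR) : ℂ) * ee (μ1 * p.1 + μ2 * p.2) =
    ((g p * Ψ p : RR) : ℂ) * ee (μ1 * p.1 + μ2 * p.2) + ((g p * Ψ' p : RR) : ℂ) * ee (μ1 * p.1 + μ2 * p.2) := by
    intro p; push_cast; ring
  simp only [this]
  rw [integral_add (hi Ψ _ _ hΨ hb) (hi Ψ' _ _ hΨ' hb'), add_mul]
  exact (norm_add_le _ _).trans (add_le_add (h _ _) (h' _ _))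

lemma root_deriv {N : ℕ} {x : RR} (hx : 0 < x) :
    HasDerivAt (fun x : RR => x ^ ((N:RR)⁻¹)) (x ^ ((N:RR)⁻¹) / (N * x)) x := by
  refine (hasDerivAt_rpow_const (Or.inl hx.ne')).congr_deriv ?_
  rw [rpow_sub_one hx.ne', div_eq_mul_inv, div_eq_mul_inv, mul_inv]; ring

lemma powu_deriv {N q : ℕ} {x : RR} (hx : 0 < x) {v : RR → RR} (hv : DifferentiableAt RR v (x ^ ((N:RR)⁻¹))) :
    HasDerivAt (fun x : RR => (x ^ ((N:RR)⁻¹)) ^ q * v (x ^ ((N:RR)⁻¹)))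
      (x⁻¹ * ((x ^ ((N:RR)⁻¹)) ^ q * ((q * v (x ^ ((N:RR)⁻¹)) + x ^ ((N:RR)⁻¹) * deriv v (x ^ ((N:RR)⁻¹))) / N))) x := by
  have h1 := root_deriv (N := N) hx
  have h2 := (h1.fun_pow q).fun_mul (hv.hasDerivAt.comp x h1)
  refine h2.congr_deriv ?_
  have ht : 0 < x ^ ((N:RR)⁻¹) := rpow_pos_of_pos hx _
  set t := x ^ ((N:RR)⁻¹)
  rcases q with _ | q
  · simp [div_eq_mul_inv, mul_inv]; ring
  · simp only [Nat.add_sub_cancel, Function.comp, div_eq_mul_inv, mul_inv, pow_succ]; ring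

lemma kappa_facts {N : ℕ} (hN : 0 < N) {κ κ1 : RR → RR} (h1 : AnalyticAt RR κ1 0) (h0 : κ1 0 = 0)
    (hκ : ∀ᶠ t in 𝓝 0, κ t = t ^ N * κ1 t) : ∃ b > 0, ∃ (k' k'' K : RR → RR) (c1 c2 : RR), 0 < c1 ∧ 0 ≤ c2 ∧
      (∀ a, 0 < a → 0 ≤ K a) ∧
      (∀ x ∈ Ioc 0 b, HasDerivAt (fun x => κ (x ^ ((N:RR)⁻¹))) (k' x) x) ∧
      (∀ x ∈ Ioc 0 b, HasDerivAt k' (k'' x) x) ∧ ContinuousOn k'' (Ioc 0 b) ∧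
      (∀ x ∈ Ioc 0 b, |κ (x ^ ((N:RR)⁻¹))| ≤ x) ∧ (∀ x ∈ Ioc 0 b, |k' x| ≤ 1 / 2) ∧
      (∀ a, 0 < a → 2 * a ≤ b → ∀ x ∈ Icc a (2 * a), |κ (x ^ ((N:RR)⁻¹))| ≤ c2 * K a) ∧
      (∀ a, 0 < a → 2 * a ≤ b → (∀ x ∈ Icc a (2 * a), c1 * K a / a ^ 2 ≤ k'' x) ∨
        (∀ x ∈ Icc a (2 * a), k'' x ≤ -(c1 * K a / a ^ 2))) := by
  obtain ⟨q, u, hq, hu, hκu, hu0⟩ : ∃ (q : ℕ) (u : RR → RR), N < q ∧ AnalyticAt RR u 0 ∧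
      (∀ᶠ t in 𝓝 0, κ t = t ^ q * u t) ∧ (u = (fun _ => 0) ∨ u 0 ≠ 0) := by
    by_cases hz : ∀ᶠ t in 𝓝 0, κ1 t = 0
    · refine ⟨N + 1, fun _ => 0, by lia, analyticAt_const, ?_, Or.inl rfl⟩
      filter_upwards [hκ, hz] with t h1 h2
      simp [h1, h2]
    · obtain ⟨n, u, hu, hu0, he⟩ := h1.exists_eventuallyEq_pow_smul_nonzero_iff.2 hz
      have hn : n ≠ 0 := by
        rintro rfl
        have := he.self_of_nhds
        simp [h0] at this
        exact hu0 this.symm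
      refine ⟨N + n, u, by lia, hu, ?_, Or.inr hu0⟩
      filter_upwards [hκ, he] with t h1 h2
      rw [h1, h2, sub_zero, smul_eq_mul, pow_add, mul_assoc]
  have hNp : (0:RR) < N := by exact_mod_cast hN
  set u1 : RR → RR := fun t => (q * u t + t * deriv u t) / N with hu1
  have hu1a : AnalyticAt RR u1 0 := by
    have := hu.deriv
    exact ((analyticAt_const.mul hu).add (analyticAt_id.mul this)).div analyticAt_const hNp.ne'
  set u2 : RR → RR := fun t => (q * u1 t + t * deriv u1 t) / N with hu2
  have hu2a : AnalyticAt RR u2 0 := by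
    have := hu1a.deriv
    exact ((analyticAt_const.mul hu1a).add (analyticAt_id.mul this)).div analyticAt_const hNp.ne'
  set v : RR → RR := fun t => u2 t - u1 t with hv
  have hva : AnalyticAt RR v 0 := hu2a.sub hu1a
  have hv0 : v 0 = (q:RR) / N * ((q:RR) / N - 1) * u 0 := by simp only [hv, hu2, hu1, zero_mul, add_zero]; field_simp
  have hq1 : (1:RR) < (q:RR) / N := by rw [lt_div_iff₀ hNp, one_mul]; exact_mod_cast hq
  -- bounds
  obtain ⟨M, hM, hMu⟩ : ∃ M > 0, ∀ᶠ t in 𝓝 (0:RR), |u t| ≤ M ∧ |u1 t| ≤ M := by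
    refine ⟨|u 0| + |u1 0| + 1, by positivity, ?_⟩
    filter_upwards [hu.continuousAt.abs.eventually_le_const (show |u 0| < |u 0| + |u1 0| + 1 by linarith [abs_nonneg (u1 0)]),
      hu1a.continuousAt.abs.eventually_le_const (show |u1 0| < |u 0| + |u1 0| + 1 by linarith [abs_nonneg (u 0)])] with t a b
    exact ⟨a, b⟩
  have hsm : ∀ᶠ t in 𝓝 (0:RR), |t| ^ (q - N) * M ≤ 1 / 2 := by
    have : ContinuousAt (fun t : RR => |t| ^ (q - N) * M) 0 := by fun_prop
    exact this.eventually_le_const (by simp [show q - N ≠ 0 by lia])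
  have hvl : ∀ᶠ t in 𝓝 (0:RR), (0 < v 0 → v 0 / 2 ≤ v t) ∧ (v 0 < 0 → v t ≤ v 0 / 2) := by
    rcases lt_trichotomy (v 0) 0 with h | h | h
    · filter_upwards [hva.continuousAt.eventually_le_const (show v 0 < v 0 / 2 by linarith)] with t ht
      exact ⟨fun h' => by linarith, fun _ => ht⟩
    · simp [h]
    · filter_upwards [hva.continuousAt.eventually_const_le (show v 0 / 2 < v 0 by linarith)] with t ht
      exact ⟨fun _ => ht, fun h' => by linarith⟩
  obtain ⟨τ, hτ, hall⟩ := Metric.eventually_nhds_iff.1 (hκu.eventually_nhds.and (hu.eventually_analyticAt.and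
    (hu1a.eventually_analyticAt.and (hu2a.eventually_analyticAt.and (hMu.and (hsm.and hvl))))))
  have hroot : ∀ x ∈ Ioc (0:RR) ((τ / 2) ^ N), 0 < x ^ ((N:RR)⁻¹) ∧ dist (x ^ ((N:RR)⁻¹)) 0 < τ ∧ (x ^ ((N:RR)⁻¹)) ^ N = x := by
    intro x hx
    have h1 : 0 < x ^ ((N:RR)⁻¹) := rpow_pos_of_pos hx.1 _
    refine ⟨h1, ?_, rpow_inv_natCast_pow hx.1.le hN.ne'⟩
    rw [dist_eq, sub_zero, abs_of_pos h1]
    have := rpow_le_rpow hx.1.le hx.2 (inv_nonneg.2 hNp.le)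
    rw [pow_rpow_inv_natCast (by positivity) hN.ne'] at this
    linarith
  have hpw : ∀ x ∈ Ioc (0:RR) ((τ / 2) ^ N), (x ^ ((N:RR)⁻¹)) ^ q * M ≤ x / 2 := by
    intro x hx
    obtain ⟨r1, r2, r3⟩ := hroot x hx
    have := (hall r2).2.2.2.2.2.1
    rw [abs_of_pos r1] at this
    rw [show q = N + (q - N) by lia, pow_add, r3, mul_assoc]
    nlinarith [hx.1]
  refine ⟨(τ / 2) ^ N, by positivity, fun x => x⁻¹ * ((x ^ ((N:RR)⁻¹)) ^ q * u1 (x ^ ((N:RR)⁻¹))),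
    fun x => x⁻¹ * (x⁻¹ * ((x ^ ((N:RR)⁻¹)) ^ q * v (x ^ ((N:RR)⁻¹)))), fun a => if v 0 = 0 then 0 else (a ^ ((N:RR)⁻¹)) ^ q,
    if v 0 = 0 then 1 else |v 0| / 8, M * 2 ^ q, ?_, by positivity, ?_, ?_, ?_, ?_, ?_, ?_, ?_, ?_⟩
  · split_ifs with h
    · exact one_pos
    · have := abs_pos.2 h
      positivity
  · intro a ha
    dsimp only
    split_ifs
    · exact le_rfl
    · positivity
  · intro x hx
    obtain ⟨r1, r2, r3⟩ := hroot x hx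
    have := powu_deriv (N := N) (q := q) hx.1 (hall r2).2.1.differentiableAt
    refine this.congr_of_eventuallyEq ?_
    exact (root_deriv hx.1).continuousAt.eventually (hall r2).1
  · intro x hx
    obtain ⟨r1, r2, r3⟩ := hroot x hx
    have := (hasDerivAt_inv hx.1.ne').fun_mul (powu_deriv (N := N) (q := q) hx.1 (hall r2).2.2.1.differentiableAt)
    refine this.congr_deriv ?_
    simp only [hv, hu2]
    have := hx.1.ne'
    field_simp
    ring
  · intro x hx
    obtain ⟨r1, r2, r3⟩ := hroot x hx
    have c1 := (root_deriv (N := N) hx.1).continuousAt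
    have c2 : ContinuousAt v (x ^ ((N:RR)⁻¹)) := (hall r2).2.2.2.1.continuousAt.sub (hall r2).2.2.1.continuousAt
    have c3 : ContinuousAt (fun x : RR => v (x ^ ((N:RR)⁻¹))) x := ContinuousAt.comp (g := v) (f := fun x : RR => x ^ ((N:RR)⁻¹)) c2 c1
    have c4 := continuousAt_inv₀ hx.1.ne'
    exact (c4.mul (c4.mul ((c1.pow q).mul c3))).continuousWithinAt
  · intro x hx
    obtain ⟨r1, r2, r3⟩ := hroot x hx
    rw [(hall r2).1.self_of_nhds, abs_mul, abs_of_pos (pow_pos r1 q)]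
    have := hpw x hx
    nlinarith [(hall r2).2.2.2.2.1.1, pow_pos r1 q, hx.1]
  · intro x hx
    obtain ⟨r1, r2, r3⟩ := hroot x hx
    rw [abs_mul, abs_mul, abs_of_pos (pow_pos r1 q), abs_of_pos (inv_pos.2 hx.1), inv_mul_le_iff₀ hx.1]
    have := hpw x hx
    nlinarith [(hall r2).2.2.2.2.1.2, pow_pos r1 q, hx.1]
  · intro a ha hab x hx
    have hx' : x ∈ Ioc (0:RR) ((τ / 2) ^ N) := ⟨ha.trans_le hx.1, hx.2.trans hab⟩
    obtain ⟨r1, r2, r3⟩ := hroot x hx'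
    rw [(hall r2).1.self_of_nhds]
    split_ifs with h
    · have hu00 : u = fun _ => 0 := by
        refine hu0.resolve_right fun h' => ?_
        rw [hv0] at h
        have : (q:RR) / N * ((q:RR) / N - 1) ≠ 0 := mul_ne_zero (by positivity) (by linarith)
        exact mul_ne_zero this h' h
      simp [hu00]
    · rw [abs_mul, abs_of_pos (pow_pos r1 q)]
      have e1 : x ^ ((N:RR)⁻¹) ≤ 2 * a ^ ((N:RR)⁻¹) := by
        calc x ^ ((N:RR)⁻¹) ≤ (2 * a) ^ ((N:RR)⁻¹) := rpow_le_rpow hx'.1.le hx.2 (by positivity)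
          _ = 2 ^ ((N:RR)⁻¹) * a ^ ((N:RR)⁻¹) := mul_rpow (by norm_num) ha.le
          _ ≤ 2 * a ^ ((N:RR)⁻¹) := by
            gcongr
            calc (2:RR) ^ ((N:RR)⁻¹) ≤ 2 ^ (1:RR) := rpow_le_rpow_of_exponent_le (by norm_num)
                  (inv_le_one_of_one_le₀ (by exact_mod_cast hN))
              _ = 2 := rpow_one 2
      calc _ ≤ (2 * a ^ ((N:RR)⁻¹)) ^ q * M := by
            gcongr
            exact (hall r2).2.2.2.2.1.1
        _ = _ := by rw [mul_pow]; ring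
  · intro a ha hab
    by_cases h : v 0 = 0
    · left
      intro x hx
      have hu00 : u = fun _ => 0 := by
        refine hu0.resolve_right fun h' => ?_
        rw [hv0] at h
        have : (q:RR) / N * ((q:RR) / N - 1) ≠ 0 := mul_ne_zero (by positivity) (by linarith)
        exact mul_ne_zero this h' h
      have e1 : u1 = fun _ => 0 := by funext t; simp [hu1, hu00]
      have e2 : v = fun _ => 0 := by funext t; simp [hv, hu2, e1]
      simp [e2]
    · simp only [h, if_false]
      have hA : ∀ x ∈ Icc a (2 * a), 0 < x⁻¹ * (x⁻¹ * (x ^ ((N:RR)⁻¹)) ^ q) ∧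
          (a ^ ((N:RR)⁻¹)) ^ q / (4 * a ^ 2) ≤ x⁻¹ * (x⁻¹ * (x ^ ((N:RR)⁻¹)) ^ q) := by
        intro x hx
        have hx0 : 0 < x := ha.trans_le hx.1
        refine ⟨by positivity, ?_⟩
        have e1 : a ^ ((N:RR)⁻¹) ≤ x ^ ((N:RR)⁻¹) := rpow_le_rpow ha.le hx.1 (by positivity)
        have e2 : (2 * a)⁻¹ ≤ x⁻¹ := by gcongr; exact hx.2
        calc _ = (2 * a)⁻¹ * ((2 * a)⁻¹ * (a ^ ((N:RR)⁻¹)) ^ q) := by field_simp; ring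
          _ ≤ _ := by gcongr
      rcases lt_or_gt_of_ne h with h | h
      · right
        intro x hx
        obtain ⟨r1, r2, r3⟩ := hroot x ⟨ha.trans_le hx.1, hx.2.trans hab⟩
        obtain ⟨a1, a2⟩ := hA x hx
        have b1 := (hall r2).2.2.2.2.2.2.2 h
        rw [abs_of_neg h]
        calc _ = (x⁻¹ * (x⁻¹ * (x ^ ((N:RR)⁻¹)) ^ q)) * v (x ^ ((N:RR)⁻¹)) := by ring
          _ ≤ (x⁻¹ * (x⁻¹ * (x ^ ((N:RR)⁻¹)) ^ q)) * (v 0 / 2) := by gcongr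
          _ ≤ (a ^ ((N:RR)⁻¹)) ^ q / (4 * a ^ 2) * (v 0 / 2) := mul_le_mul_of_nonpos_right a2 (by linarith)
          _ = _ := by field_simp; ring
      · left
        intro x hx
        obtain ⟨r1, r2, r3⟩ := hroot x ⟨ha.trans_le hx.1, hx.2.trans hab⟩
        obtain ⟨a1, a2⟩ := hA x hx
        have b1 := (hall r2).2.2.2.2.2.2.1 h
        rw [abs_of_pos h]
        calc _ = (a ^ ((N:RR)⁻¹)) ^ q / (4 * a ^ 2) * (v 0 / 2) := by field_simp; ring
          _ ≤ (x⁻¹ * (x⁻¹ * (x ^ ((N:RR)⁻¹)) ^ q)) * (v 0 / 2) := by gcongr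
          _ ≤ (x⁻¹ * (x⁻¹ * (x ^ ((N:RR)⁻¹)) ^ q)) * v (x ^ ((N:RR)⁻¹)) := by gcongr
          _ = _ := by ring

lemma fd_le {G : Q2 → RR} {q : Q2} {a b M x y : RR} (h1 : |fderiv RR G q (x, 0)| ≤ M) (h2 : |fderiv RR G q (0, y)| ≤ M) :
    |fderiv RR G q (a * x, b * y)| ≤ (|a| + |b|) * M := by
  have e : ((a * x, b * y) : Q2) = a • (x, (0:RR)) + b • ((0:RR), y) := by simp
  rw [e, map_add, map_smul, map_smul, smul_eq_mul, smul_eq_mul, add_mul]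
  refine (abs_add_le _ _).trans ?_
  rw [abs_mul, abs_mul]
  gcongr

lemma leafNode {ι : Type} [Fintype ι] {g : Q2 → RR} {D : Set Q2} {γ : ι → RR} {w0 : RR}
    {N L : ℕ} {κ : RR → RR} {m : RR} {F : ι → Q2 → RR} {k : ι → ℕ} (hg : Integrable g) (hg0 : ∀ p, 0 ≤ g p)
    (hn : IsNode g D γ w0 N L κ m F k) : ∃ η > 0, ∀ S : Set Q2, IsClosed S →
      (∀ q ∈ S, 0 < q.1 → q.1 ≤ η ∧ |q.2| ≤ η) → ∀ C, 0 ≤ C →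
      (∀ q ∈ S, 0 < q.1 → q.2 ≠ 0 → ∀ i, F i q ≠ 0 ∧ LD C (q.1, 0) (F i) q ∧ LD C (0, q.2) (F i) q) →
      ∀ Ψ, Amp (fun q => (0, q.2)) (chart N L κ w0) S Ψ → Good g w0 Ψ := by
  obtain ⟨hN, hL, κm, ⟨κ1, hκ1, hκ0, hκ⟩, reg, rep, fr⟩ := hn
  obtain ⟨b, hb, k', k'', K, c1, c2, hc1, hc2, hK, hk1, hk2, hkc, hkx, hk'h, hkK, hks⟩ := kappa_facts hN hκ1 hκ0 hκ
  have hκa : AnalyticAt RR κ 0 := ((analyticAt_id.pow N).mul hκ1).congr (by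
    filter_upwards [hκ] with t ht; rw [ht]; rfl)
  obtain ⟨r1, hr1, ht⟩ := Metric.eventually_nhds_iff.1 hκa.eventually_analyticAt
  obtain ⟨r2, hr2, hq⟩ := Metric.eventually_nhds_iff.1 (rep.and fr).eventually_nhds
  have hNp : (0:RR) < N := by exact_mod_cast hN
  refine ⟨min (min (r1 / 2) (r2 / 2)) (min 1 (b ^ ((N:RR)⁻¹))), by positivity, fun S hS hSη C hC hSF Ψ hΨ => ?_⟩
  obtain ⟨Cψ, hCψ, hΨb⟩ := hΨ.abs_le hN rfl
  obtain ⟨Cd, hCd, hbd⟩ := hΨ.bd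
  set χ := chart N L κ w0 with hχ
  set η := min (min (r1 / 2) (r2 / 2)) (min 1 (b ^ ((N:RR)⁻¹))) with hη
  have e1 : η ≤ r1 / 2 := (min_le_left _ _).trans (min_le_left _ _)
  have e2 : η ≤ r2 / 2 := (min_le_left _ _).trans (min_le_right _ _)
  have e3 : η ≤ 1 := (min_le_right _ _).trans (min_le_left _ _)
  have e4 : η ≤ b ^ ((N:RR)⁻¹) := (min_le_right _ _).trans (min_le_right _ _)
  set C0 : RR := |m| + ∑ i, |γ i| * C with hC0
  have hC0p : 0 ≤ C0 := by positivity
  set H : Q2 → RR := fun p => g p * Ψ p with hH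
  have core : ∀ q : Q2, 0 < q.1 → q.2 ≠ 0 → DifferentiableAt RR (fun q => H (χ q)) q ∧
      |fderiv RR (fun q => H (χ q)) q (q.1, 0)| ≤ (Cd + Cd * C0) * g (χ q) ∧
      |fderiv RR (fun q => H (χ q)) q (0, q.2)| ≤ (Cd + Cd * C0) * g (χ q) := by
    intro q hq1 hq2
    obtain ⟨d1, d2, d3, d4⟩ := hbd q hq1
    have hpos : ∀ᶠ q' : Q2 in 𝓝 q, 0 < q'.1 := continuous_fst.continuousAt.eventually (lt_mem_nhds hq1)
    by_cases hqS : q ∈ S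
    · obtain ⟨b1, b2⟩ := hSη q hqS hq1
      have hF := hSF q hqS hq1 hq2
      have hqd : dist q 0 < r2 := by
        rw [dist_zero_right, Prod.norm_def, max_lt_iff, norm_eq_abs, norm_eq_abs, abs_of_pos hq1]
        constructor <;> linarith
      obtain ⟨hrep, hfr⟩ := (hq hqd).and hpos |>.and (Eventually.of_forall fun _ => trivial) |>.self_of_nhds.1.1
      have hrep' := ((hq hqd).and hpos)
      have hκc : ContinuousAt κ q.1 := (ht (show dist q.1 0 < r1 by rw [dist_eq, sub_zero, abs_of_pos hq1]; linarith)).continuousAt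
      have hχc : ContinuousAt χ q := by
        have : ContinuousAt (fun q : Q2 => κ q.1) q := ContinuousAt.comp (g := κ) (f := Prod.fst) hκc continuous_fst.continuousAt
        rw [hχ]; unfold chart; fun_prop
      have hnf : χ q ∉ frontier D := fun h => by
        obtain ⟨i, hi⟩ := hfr hq1 h
        exact (hF i).1 hi
      obtain ⟨c, hc⟩ : ∃ c : RR, ∀ᶠ q' in 𝓝 q, D.indicator (1 : Q2 → RR) (χ q') = c := by
        by_cases hi : χ q ∈ interior D
        · refine ⟨1, ?_⟩
          filter_upwards [hχc.eventually (isOpen_interior.mem_nhds hi)] with q' hq'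
          simp [interior_subset hq']
        · have : χ q ∉ closure D := fun h => hnf ⟨h, hi⟩
          refine ⟨0, ?_⟩
          filter_upwards [hχc.eventually (isClosed_closure.isOpen_compl.mem_nhds this)] with q' hq'
          have : χ q' ∉ D := fun h => hq' (subset_closure h)
          simp [this]
      have heq : (fun q => g (χ q)) =ᶠ[𝓝 q] fun q => c * (|q.1| ^ m * ∏ i, |F i q| ^ γ i) := by
        filter_upwards [hrep', hc] with q' h1 h2
        rw [h1.1.1 h1.2, h2]
      have hconst : ∀ v, LD 0 v (fun _ => c) q := fun v => ⟨differentiableAt_const _, by simp⟩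
      have hA : ∀ (v : Q2) (C1 : RR), LD C1 v Prod.fst q → 0 ≤ C1 → C1 ≤ 1 → (∀ i, LD C v (F i) q) → LD C0 v (fun q => g (χ q)) q := by
        intro v C1 h1 h1p h1' h2
        have h3 := (hconst v).mul ((h1.rpow_abs hq1.ne' m).mul (LD.prod Finset.univ (fun i _ => (h2 i).rpow_abs (hF i).1 (γ i))))
        have h4 := h3.congr heq
        refine ⟨h4.1, h4.2.trans ?_⟩
        gcongr
        nlinarith [abs_nonneg m]
      have hfin : ∀ v, LD C0 v (fun q => g (χ q)) q → |fderiv RR (fun q => Ψ (χ q)) q v| ≤ Cd →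
          |fderiv RR (fun q => H (χ q)) q v| ≤ (Cd + Cd * C0) * g (χ q) := by
        intro v h1 h2
        simp only [hH]
        rw [fderiv_fun_mul h1.1 d1]
        simp only [_root_.add_apply, _root_.smul_apply, smul_eq_mul]
        refine (abs_add_le _ _).trans ?_
        have h3 := h1.2
        rw [abs_of_nonneg (hg0 _)] at h3
        rw [abs_mul, abs_mul, abs_of_nonneg (hg0 _)]
        calc _ ≤ g (χ q) * Cd + Cd * (C0 * g (χ q)) := by
              gcongr
              exact hg0 _
          _ = _ := by ring
      have f1 : fderiv RR (Prod.fst : Q2 → RR) q = ContinuousLinearMap.fst RR RR RR := fderiv_fst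
      have l1 := hA (q.1, 0) 1 ⟨differentiableAt_fst, by rw [f1]; simp⟩ zero_le_one le_rfl (fun i => (hF i).2.1)
      have l2 := hA (0, q.2) 0 ⟨differentiableAt_fst, by rw [f1]; simp⟩ le_rfl zero_le_one (fun i => (hF i).2.2)
      exact ⟨l1.1.mul d1, hfin _ l1 d3, hfin _ l2 d4⟩
    · have hz : (fun q => H (χ q)) =ᶠ[𝓝 q] fun _ => 0 := by
        filter_upwards [hpos, hS.isOpen_compl.mem_nhds hqS] with q' h1 h2
        have : Ψ (χ q') = 0 := by
          by_contra h
          exact h2 (hΨ.supp q' h1 h)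
        simp [hH, this]
      rw [hz.fderiv_eq]
      have : 0 ≤ (Cd + Cd * C0) * g (χ q) := mul_nonneg (by positivity) (hg0 _)
      refine ⟨(differentiableAt_const _).congr_of_eventuallyEq hz, ?_, ?_⟩ <;> simpa using this
  set C1 := Cd + Cd * C0 with hC1
  have hC1p : 0 ≤ C1 := by positivity
  set θ : RR → RR := fun x => x ^ ((N:RR)⁻¹) with hθ
  have hθp : ∀ x, 0 < x → 0 < θ x := fun x hx => rpow_pos_of_pos hx _
  have hθχ : ∀ x, 0 < x → ∀ z, χ (θ x, z * (θ x ^ L)⁻¹) = (x, w0 * x + κ (θ x) + z) := by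
    intro x hx z
    have h1 : θ x ^ N = x := rpow_inv_natCast_pow hx.le hN.ne'
    have h2 := hθp x hx
    simp only [hχ, chart, h1]
    rw [mul_comm z, mul_inv_cancel_left₀ (by positivity)]
  have hsuppH : ∀ p, H p ≠ 0 → 0 < p.1 ∧ (tinv N p, winv N L κ w0 p) ∈ S := by
    intro p hp
    have hp' : Ψ p ≠ 0 := right_ne_zero_of_mul hp
    have h1 := hΨ.pos p hp'
    refine ⟨h1, hΨ.supp _ (tinv_pos h1) ?_⟩
    rwa [hχ, chart_inv hN κ w0 h1]
  have Hm : AEStronglyMeasurable H := hg.1.mul hΨ.meas.aestronglyMeasurable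
  have hNinv : (N:RR)⁻¹ ≤ 1 := inv_le_one_of_one_le₀ (by exact_mod_cast hN)
  refine leaf (g := g) (H := H) (k := fun x => κ (θ x)) (k' := k') (k'' := k'') (K := K) (w0 := w0) (b := b)
    (C := (1 + L) * C1 + Cψ) (B := 1) (c1 := c1) (c2 := c2) hb (by positivity) zero_le_one hc1 hc2 hK hg hg0 Hm
    (κm.comp (by fun_prop)) ?_ ?_ ?_ ?_ ?_ hk1 hk2 hkc hkx hk'h hkK hks
  · intro p
    rw [abs_mul, abs_of_nonneg (hg0 p), mul_comm]
    refine mul_le_mul_of_nonneg_right ((hΨb p).trans ?_) (hg0 p)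
    have : 0 ≤ (1 + (L:RR)) * C1 := by positivity
    linarith
  · intro p hp
    obtain ⟨h1, h2⟩ := hsuppH p hp
    have h3 := (hSη _ h2 (tinv_pos h1)).1.trans e4
    refine ⟨h1, ?_⟩
    exact (rpow_le_rpow_iff h1.le hb.le (by positivity)).1 h3
  · intro x hx z hz
    have hx0 := hx.1
    have ht0 := hθp x hx0
    set w := z * (θ x ^ L)⁻¹ with hw
    obtain ⟨a1, a2, a3⟩ := core (θ x, w) ht0 (mul_ne_zero hz (by positivity))
    rw [hθχ x hx0] at a2 a3
    have hder : HasDerivAt (fun x => ((θ x, z * (θ x ^ L)⁻¹) : Q2)) ((N * x)⁻¹ * θ x, -(L / (N * x)) * w) x := by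
      have r := root_deriv (N := N) hx0
      have r2 := ((r.fun_pow L).fun_inv (pow_pos ht0 L).ne').const_mul z
      refine (r.congr_deriv ?_).prodMk (r2.congr_deriv ?_)
      · rw [div_eq_inv_mul]
      · rw [hw]
        change z * (-(L * θ x ^ (L - 1) * (θ x / (N * x))) / (θ x ^ L) ^ 2) = _
        rcases Nat.eq_zero_or_pos L with h | h
        · lia
        · obtain ⟨L', rfl⟩ : ∃ L', L = L' + 1 := ⟨L - 1, by lia⟩
          simp only [Nat.add_sub_cancel, pow_succ]
          field_simp
    have hcomp := HasFDerivAt.comp_hasDerivAt (f := fun x => ((θ x, z * (θ x ^ L)⁻¹) : Q2)) x a1.hasFDerivAt hder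
    have heq : (fun x => H (x, w0 * x + κ (θ x) + z)) =ᶠ[𝓝 x] fun x => H (χ (θ x, z * (θ x ^ L)⁻¹)) := by
      filter_upwards [lt_mem_nhds hx0] with x' hx'
      rw [hθχ x' hx']
    have hd := hcomp.congr_of_eventuallyEq heq
    refine ⟨hd.differentiableAt, ?_⟩
    rw [hd.deriv]
    have := fd_le (a := (N * x)⁻¹) (b := -(L / (N * x))) a2 a3
    rw [abs_mul, abs_of_pos hx0]
    calc _ ≤ x * ((|((N:RR) * x)⁻¹| + |-((L:RR) / (N * x))|) * (C1 * g (x, w0 * x + κ (θ x) + z))) := by gcongr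
      _ = (1 + L) * (N:RR)⁻¹ * (C1 * g (x, w0 * x + κ (θ x) + z)) := by
          rw [abs_neg, abs_of_pos (by positivity), abs_of_nonneg (by positivity)]
          field_simp
      _ ≤ (1 + L) * 1 * (C1 * g (x, w0 * x + κ (θ x) + z)) := by
          have := hg0 (x, w0 * x + κ (θ x) + z)
          gcongr
      _ = (1 + L) * C1 * g (x, w0 * x + κ (θ x) + z) := by ring
      _ ≤ _ := by
          gcongr
          · exact hg0 _
          · linarith
  · intro x hx z hz
    have hx0 := hx.1
    have ht0 := hθp x hx0
    set w := z * (θ x ^ L)⁻¹ with hw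
    obtain ⟨a1, a2, a3⟩ := core (θ x, w) ht0 (mul_ne_zero hz (by positivity))
    rw [hθχ x hx0] at a2 a3
    have hder : HasDerivAt (fun z => ((θ x, z * (θ x ^ L)⁻¹) : Q2)) (0, z⁻¹ * w) z := by
      refine (hasDerivAt_const _ _).prodMk ((((hasDerivAt_id z).mul_const _)).congr_deriv ?_)
      rw [hw]; field_simp
    have hcomp := HasFDerivAt.comp_hasDerivAt (f := fun z => ((θ x, z * (θ x ^ L)⁻¹) : Q2)) z a1.hasFDerivAt hder
    have heq : (fun z => H (x, w0 * x + κ (θ x) + z)) = fun z => H (χ (θ x, z * (θ x ^ L)⁻¹)) := by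
      funext z'
      rw [hθχ x hx0]
    rw [heq]
    refine ⟨hcomp.differentiableAt, ?_⟩
    rw [show deriv (fun z => H (χ (θ x, z * (θ x ^ L)⁻¹))) z = _ from hcomp.deriv]
    have := fd_le (a := 0) (b := z⁻¹) a2 a3
    rw [zero_mul] at this
    rw [abs_mul]
    calc _ ≤ |z| * ((|(0:RR)| + |z⁻¹|) * (C1 * g (x, w0 * x + κ (θ x) + z))) := by gcongr
      _ = C1 * g (x, w0 * x + κ (θ x) + z) := by
          rw [abs_zero, abs_inv, zero_add, mul_inv_cancel_left₀ (abs_ne_zero.2 hz)]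
      _ ≤ _ := by
          have : 0 ≤ (L:RR) * C1 := by positivity
          gcongr
          · exact hg0 _
          · linarith
  · intro x hx z hz
    by_contra hne
    obtain ⟨h1, h2⟩ := hsuppH _ hne
    have hx0 := hx.1
    have ht0 := hθp x hx0
    rw [← hθχ x hx0, hχ, tinv_chart hN κ w0 ht0, winv_chart hN κ w0 ht0] at h2
    obtain ⟨h3, h4⟩ := hSη _ h2 ht0
    simp only at h3 h4
    rw [abs_mul, abs_inv, abs_of_pos (pow_pos ht0 L), ← div_eq_mul_inv, div_le_iff₀ (pow_pos ht0 L)] at h4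
    have h5 : θ x ^ L ≤ θ x ^ N := pow_le_pow_of_le_one ht0.le (h3.trans e3) hL
    have h6 : θ x ^ N = x := rpow_inv_natCast_pow hx0.le hN.ne'
    rw [h6] at h5
    have : η * θ x ^ L ≤ 1 * x := by gcongr
    linarith

lemma leafF {F : Q2 → RR} {k : ℕ} {a : ℕ → RR → RR} {U : Q2 → RR} (h : Expd F k a U) (hF : AnalyticAt RR F 0) (hU0 : U 0 ≠ 0) :
    ∃ ε > 0, ∃ C, 0 ≤ C ∧ ∀ᶠ q : Q2 in 𝓝 0, q.2 ≠ 0 →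
      (∀ r < k, |a r q.1| ≤ ε * |q.2| ^ (k - r) ∧ |q.1 * deriv (a r) q.1| ≤ |q.2| ^ (k - r)) →
      F q ≠ 0 ∧ LD C (q.1, 0) F q ∧ LD C (0, q.2) F q := by
  obtain ⟨ha, hU, he⟩ := h
  set u := |U 0| with hu
  have hup : 0 < u := abs_pos.2 hU0
  set M : RR := ‖fderiv RR U 0‖ + 1 with hM
  have hMp : 0 < M := by positivity
  have ev1 : ∀ᶠ q in 𝓝 (0 : Q2), ‖fderiv RR U q‖ ≤ M :=
    (hU.fderiv.continuousAt.norm).eventually_le_const (by rw [hM]; linarith)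
  have ev2 : ∀ᶠ q in 𝓝 (0 : Q2), |U q| ≤ 2 * u := hU.continuousAt.abs.eventually_le_const (by linarith)
  have ev3 : ∀ᶠ q in 𝓝 (0 : Q2), u / 2 ≤ |U q| := hU.continuousAt.abs.eventually_const_le (by linarith)
  have ev4 : ∀ᶠ q : Q2 in 𝓝 0, ∀ r ∈ Finset.range k, AnalyticAt RR (a r) q.1 :=
    (Finset.eventually_all _).2 fun r _ => (continuous_fst.tendsto' (0 : Q2) 0 rfl).eventually (ha r).eventually_analyticAt
  set ε := u / (4 * (k + 1)) with hε
  have hεp : 0 < ε := by positivity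
  set A : RR := k + M + k * (k * ε) + k * (2 * u) with hA
  have hAp : 0 ≤ A := by positivity
  refine ⟨ε, hεp, A / (u / 4), by positivity, ?_⟩
  filter_upwards [ev1, ev2, ev3, ev4, he.eventually_nhds, hU.eventually_analyticAt, hF.eventually_analyticAt, near_abs one_pos] with q b1 b2 b3 b4 b5 b6 b7 b8 hw hr
  have hwp := abs_pos.2 hw
  set X := |q.2| ^ k with hX
  have hXp : 0 < X := by positivity
  have hsplit : ∀ r ∈ Finset.range k, |q.2| ^ (k - r) * |q.2| ^ r = X := fun r hr => by
    rw [← pow_add, hX, Nat.sub_add_cancel (Finset.mem_range.1 hr).le]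
  have hs1 : |∑ r ∈ Finset.range k, a r q.1 * q.2 ^ r| ≤ k * (ε * X) := by
    refine (Finset.abs_sum_le_sum_abs _ _).trans ?_
    calc _ ≤ ∑ r ∈ Finset.range k, ε * X := by
          refine Finset.sum_le_sum fun r hr' => ?_
          rw [abs_mul, abs_pow, ← hsplit r hr', ← mul_assoc]
          gcongr
          exact (hr r (Finset.mem_range.1 hr')).1
      _ = _ := by simp
  have hFl : u / 4 * X ≤ |F q| := by
    rw [b5.self_of_nhds]
    have h1 := abs_sub_abs_le_abs_sub (q.2 ^ k * U q) (-∑ r ∈ Finset.range k, a r q.1 * q.2 ^ r)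
    rw [sub_neg_eq_add, abs_neg, abs_mul, abs_pow, add_comm (q.2 ^ k * U q)] at h1
    have h2 : k * (ε * X) ≤ u / 4 * X := by
      rw [← mul_assoc]
      gcongr
      rw [hε, ← mul_div_assoc, div_le_div_iff₀ (by positivity) (by positivity)]
      nlinarith
    nlinarith [mul_le_mul_of_nonneg_left b3 hXp.le]
  have hFne : F q ≠ 0 := by
    intro h0
    rw [h0, abs_zero] at hFl
    have : 0 < u / 4 * X := by positivity
    linarith
  have fin : ∀ v, |fderiv RR F q v| ≤ A * X → LD (A / (u / 4)) v F q := by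
    intro v hv
    refine ⟨b7.differentiableAt, hv.trans ?_⟩
    calc A * X = A / (u / 4) * (u / 4 * X) := by field_simp
      _ ≤ _ := by gcongr
  refine ⟨hFne, fin _ ?_, fin _ ?_⟩
  · have d1 := hasDerivAt_slice1 b6.differentiableAt
    have d2 : HasDerivAt (fun t => ∑ r ∈ Finset.range k, a r t * q.2 ^ r) (∑ r ∈ Finset.range k, deriv (a r) q.1 * q.2 ^ r) q.1 :=
      HasDerivAt.fun_sum fun r hr => ((b4 r hr).differentiableAt.hasDerivAt).mul_const _
    have d3 := d2.fun_add (d1.const_mul (q.2 ^ k))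
    have d4 := hasDerivAt_slice1 b7.differentiableAt
    have hcu : Tendsto (fun t : RR => (t, q.2)) (𝓝 q.1) (𝓝 q) := by
      have : Continuous (fun t : RR => (t, q.2)) := by fun_prop
      exact this.tendsto q.1
    have d5 := d4.unique (d3.congr_of_eventuallyEq (hcu.eventually b5))
    rw [show ((q.1, 0) : Q2) = q.1 • ((1:RR), (0:RR)) by simp, map_smul, smul_eq_mul, d5, mul_add, Finset.mul_sum]
    refine (abs_add_le _ _).trans ?_
    have h1 : |∑ r ∈ Finset.range k, q.1 * (deriv (a r) q.1 * q.2 ^ r)| ≤ k * X := by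
      refine (Finset.abs_sum_le_sum_abs _ _).trans ?_
      calc _ ≤ ∑ r ∈ Finset.range k, X := by
            refine Finset.sum_le_sum fun r hr' => ?_
            rw [← mul_assoc, abs_mul, abs_pow, ← hsplit r hr']
            gcongr
            exact (hr r (Finset.mem_range.1 hr')).2
        _ = _ := by simp
    have h2 : |fderiv RR U q (1, 0)| ≤ M := by
      rw [← norm_eq_abs]
      refine ((fderiv RR U q).le_opNorm _).trans ?_
      simpa [Prod.norm_def] using b1
    have h3 : |q.1 * (q.2 ^ k * fderiv RR U q (1, 0))| ≤ M * X := by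
      rw [abs_mul, abs_mul, abs_pow]
      calc _ ≤ 1 * (X * M) := by gcongr; exact b8.1.le
        _ = _ := by ring
    have : 0 ≤ (k * (k * ε) + k * (2 * u)) * X := by positivity
    rw [hA]; linarith
  · have d1 := hasDerivAt_slice b6.differentiableAt
    have d2 : HasDerivAt (fun w => ∑ r ∈ Finset.range k, a r q.1 * w ^ r) (∑ r ∈ Finset.range k, a r q.1 * (r * q.2 ^ (r - 1))) q.2 :=
      HasDerivAt.fun_sum fun r hr => (hasDerivAt_pow r q.2).const_mul _
    have d3 := d2.fun_add ((hasDerivAt_pow k q.2).fun_mul d1)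
    have d4 := hasDerivAt_slice b7.differentiableAt
    have hcu : Tendsto (fun t : RR => (q.1, t)) (𝓝 q.2) (𝓝 q) := by
      have : Continuous (fun t : RR => (q.1, t)) := by fun_prop
      exact this.tendsto q.2
    have d5 := d4.unique (d3.congr_of_eventuallyEq (hcu.eventually b5))
    have hpw : ∀ r : ℕ, q.2 * (r * q.2 ^ (r - 1)) = r * q.2 ^ r := by
      intro r
      rcases r with _ | r
      · simp
      · rw [Nat.add_sub_cancel, pow_succ]; ring
    rw [show ((0, q.2) : Q2) = q.2 • ((0:RR), (1:RR)) by simp, map_smul, smul_eq_mul, d5, mul_add, mul_add, Finset.mul_sum,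
      ← mul_assoc q.2 (k * q.2 ^ (k - 1)), hpw k]
    have h1 : |∑ r ∈ Finset.range k, q.2 * (a r q.1 * (r * q.2 ^ (r - 1)))| ≤ k * (k * ε) * X := by
      refine (Finset.abs_sum_le_sum_abs _ _).trans ?_
      calc _ ≤ ∑ r ∈ Finset.range k, k * ε * X := by
            refine Finset.sum_le_sum fun r hr' => ?_
            rw [mul_left_comm, hpw, mul_left_comm, abs_mul, abs_mul, abs_pow, ← hsplit r hr', Nat.abs_cast]
            have h2 : (r:RR) ≤ k := by exact_mod_cast (Finset.mem_range.1 hr').le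
            calc _ ≤ (k:RR) * (ε * |q.2| ^ (k - r) * |q.2| ^ r) := by
                  gcongr
                  exact (hr r (Finset.mem_range.1 hr')).1
              _ = _ := by ring
        _ = _ := by simp; ring
    have h2 : |fderiv RR U q (0, 1)| ≤ M := by
      rw [← norm_eq_abs]
      refine ((fderiv RR U q).le_opNorm _).trans ?_
      simpa [Prod.norm_def] using b1
    have h3 : |q.2 * (q.2 ^ k * fderiv RR U q (0, 1))| ≤ M * X := by
      rw [abs_mul, abs_mul, abs_pow]
      calc _ ≤ 1 * (X * M) := by gcongr; exact b8.2.le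
        _ = _ := by ring
    have h4 : |k * q.2 ^ k * U q| ≤ k * (2 * u) * X := by
      rw [abs_mul, abs_mul, abs_pow, Nat.abs_cast]
      calc _ ≤ k * X * (2 * u) := by gcongr
        _ = _ := by ring
    have : 0 ≤ (k:RR) * X := by positivity
    have e1 := abs_add_le (∑ r ∈ Finset.range k, q.2 * (a r q.1 * (r * q.2 ^ (r - 1)))) (k * q.2 ^ k * U q + q.2 * (q.2 ^ k * fderiv RR U q (0, 1)))
    have e2 := abs_add_le (k * q.2 ^ k * U q) (q.2 * (q.2 ^ k * fderiv RR U q (0, 1)))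
    rw [hA]; linarith

lemma outer_small {a b : RR → RR} {P n : ℕ} (hn : 0 < n) (hb : AnalyticAt RR b 0) (hab : ∀ᶠ t in 𝓝 0, a t = t ^ (P * n) * b t)
    {ε : RR} (hε : 0 < ε) : ∃ B0 : RR, ∀ B, B0 ≤ B → 1 ≤ B → ∀ᶠ q : Q2 in 𝓝 0, 0 < q.1 → B * q.1 ^ P ≤ |q.2| →
      |a q.1| ≤ ε * |q.2| ^ n ∧ |q.1 * deriv a q.1| ≤ |q.2| ^ n := by
  set b1 : RR → RR := fun t => (P * n : ℕ) * b t + t * deriv b t with hb1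
  have hb1a : ContinuousAt b1 0 := by
    have h1 := hb.continuousAt
    have h2 := hb.deriv.continuousAt
    fun_prop
  set M := |b 0| + |b1 0| + 1 with hM
  have hMp : 0 < M := by positivity
  have ev : ∀ᶠ t in 𝓝 (0:RR), |b t| ≤ M ∧ |b1 t| ≤ M := by
    filter_upwards [hb.continuousAt.abs.eventually_le_const (show |b 0| < M by linarith [abs_nonneg (b1 0)]),
      hb1a.abs.eventually_le_const (show |b1 0| < M by linarith [abs_nonneg (b 0)])] with t a b
    exact ⟨a, b⟩
  have hfst : Tendsto (Prod.fst : Q2 → RR) (𝓝 0) (𝓝 0) := continuous_fst.tendsto' (0 : Q2) 0 rfl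
  refine ⟨M / ε + M, fun B hB hB1 => ?_⟩
  filter_upwards [hfst.eventually ev, hfst.eventually hab.eventually_nhds, hfst.eventually hb.eventually_analyticAt] with q e1 e2 e3 hq hw
  have hBp : 0 < B := by linarith
  have hk : q.1 ^ (P * n) * B ≤ |q.2| ^ n := by
    calc q.1 ^ (P * n) * B ≤ q.1 ^ (P * n) * B ^ n := by
          gcongr
          exact le_self_pow₀ hB1 hn.ne'
      _ = (B * q.1 ^ P) ^ n := by rw [mul_pow, ← pow_mul, mul_comm]
      _ ≤ _ := by gcongr
  have hεB : M ≤ ε * B := by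
    have : M / ε ≤ B := by linarith
    rwa [div_le_iff₀' hε] at this
  have hMB : M ≤ B := by
    have : 0 < M / ε := by positivity
    linarith
  have hpp : 0 < q.1 ^ (P * n) := by positivity
  constructor
  · rw [e2.self_of_nhds, abs_mul, abs_of_pos hpp]
    calc _ ≤ q.1 ^ (P * n) * (ε * B) := by gcongr; exact e1.1.trans hεB
      _ = ε * (q.1 ^ (P * n) * B) := by ring
      _ ≤ _ := by gcongr
  · have hd := (((hasDerivAt_pow (P * n) q.1).fun_mul e3.differentiableAt.hasDerivAt).congr_of_eventuallyEq e2).deriv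
    have : q.1 * deriv a q.1 = q.1 ^ (P * n) * b1 q.1 := by
      rw [hd, hb1]
      rcases hz : P * n with _ | j
      · simp
      · simp only [Nat.add_sub_cancel, pow_succ]; ring
    rw [this, abs_mul, abs_of_pos hpp]
    refine le_trans ?_ hk
    gcongr
    exact e1.2.trans hMB

/-- the standard amplitude class -/
abbrev Amp1 := Amp (fun _ => ((0:RR), (1:RR)))

lemma Amp.mono {v χ S S' Ψ} (h : Amp v χ S Ψ) (hS : S ⊆ S') : Amp v χ S' Ψ :=
  ⟨h.meas, h.pos, fun q hq h' => hS (h.supp q hq h'), h.bd⟩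

lemma Amp1.pull {χ S Ψ} (h : Amp1 χ S Ψ) {M : Q2 → Q2} {S' : Set Q2} {C : RR}
    (hpos : ∀ q : Q2, 0 < q.1 → 0 < (M q).1)
    (hc : ∀ q : Q2, 0 < q.1 → M q ∉ S → ∀ᶠ q' in 𝓝 q, M q' ∉ S)
    (hM : ∀ q : Q2, 0 < q.1 → M q ∈ S → q ∈ S' ∧ ∃ M' : Q2 →L[RR] Q2, HasFDerivAt M M' q ∧
      ∃ a b b', M' (q.1, 0) = (a * (M q).1, b) ∧ M' (0, 1) = (0, b') ∧ |a| ≤ C ∧ |b| ≤ C ∧ |b'| ≤ C) :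
    Amp1 (fun q => χ (M q)) S' Ψ := by
  obtain ⟨A, hA, hb⟩ := h.bd
  refine ⟨h.meas, h.pos, fun q hq h' => (hM q hq (h.supp _ (hpos q hq) h')).1, A + 2 * |C| * A, by positivity, fun q hq => ?_⟩
  have hA' : A ≤ A + 2 * |C| * A := by have : 0 ≤ |C| * A := by positivity
                                       linarith
  by_cases hS : M q ∈ S
  · obtain ⟨-, M', hM', a, b, b', e1, e2, ha, hb1, hb2⟩ := hM q hq hS
    obtain ⟨d1, d2, d3, d4⟩ := hb (M q) (hpos q hq)
    have hd := d1.hasFDerivAt.comp q hM'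
    have he : (fun q => Ψ (χ q)) ∘ M = fun q => Ψ (χ (M q)) := rfl
    rw [he] at hd
    refine ⟨hd.differentiableAt, d2.trans hA', ?_, ?_⟩
    · rw [hd.fderiv, ContinuousLinearMap.comp_apply, e1,
        show (a * (M q).1, b) = a • ((M q).1, (0:RR)) + b • ((0:RR), (1:RR)) by simp, map_add, map_smul, map_smul,
        smul_eq_mul, smul_eq_mul]
      refine (abs_add_le _ _).trans ?_
      rw [abs_mul, abs_mul]
      have h1 := mul_le_mul (ha.trans (le_abs_self C)) d3 (abs_nonneg _) (abs_nonneg _)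
      have h2 := mul_le_mul (hb1.trans (le_abs_self C)) d4 (abs_nonneg _) (abs_nonneg _)
      linarith
    · rw [hd.fderiv, ContinuousLinearMap.comp_apply, e2,
        show ((0:RR), b') = b' • ((0:RR), (1:RR)) by simp, map_smul, smul_eq_mul, abs_mul]
      have h2 := mul_le_mul (hb2.trans (le_abs_self C)) d4 (abs_nonneg _) (abs_nonneg _)
      have : 0 ≤ |C| * A := by positivity
      linarith
  · have h0 : (fun q => Ψ (χ (M q))) =ᶠ[𝓝 q] fun _ => 0 := by
      have hp : ∀ᶠ q' : Q2 in 𝓝 q, 0 < q'.1 := continuous_fst.continuousAt.eventually (lt_mem_nhds hq)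
      filter_upwards [hc q hq hS, hp] with q' h1 h2
      by_contra h3
      exact h1 (h.supp _ (hpos q' h2) h3)
    have hd := (hasFDerivAt_const (𝕜 := RR) (0:RR) q).congr_of_eventuallyEq h0
    have h00 := h0.eq_of_nhds
    refine ⟨hd.differentiableAt, ?_, ?_, ?_⟩
    · rw [h00, abs_zero]; positivity
    · rw [hd.fderiv]; simp; positivity
    · rw [hd.fderiv]; simp; positivity

/-- cutoff functions -/
def Cut (β : RR → RR) : Prop := Differentiable RR β ∧ ∃ C, ∀ x, |β x| ≤ C ∧ |deriv β x| ≤ C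

lemma Cut.mul {β β' : RR → RR} (h : Cut β) (h' : Cut β') : Cut (fun x => β x * β' x) := by
  obtain ⟨h, C, hC⟩ := h
  obtain ⟨h', C', hC'⟩ := h'
  have p1 := (abs_nonneg _).trans (hC 0).1
  have p2 := (abs_nonneg _).trans (hC' 0).1
  refine ⟨h.fun_mul h', 2 * (C * C'), fun x => ⟨?_, ?_⟩⟩
  · rw [abs_mul]
    have := mul_le_mul (hC x).1 (hC' x).1 (abs_nonneg _) p1
    have : 0 ≤ C * C' := by positivity
    linarith
  · rw [deriv_fun_mul (h x) (h' x)]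
    refine (abs_add_le _ _).trans ?_
    rw [abs_mul, abs_mul]
    have h1 := mul_le_mul (hC x).2 (hC' x).1 (abs_nonneg _) p1
    have h2 := mul_le_mul (hC x).1 (hC' x).2 (abs_nonneg _) p1
    linarith

lemma Cut.one_sub {β : RR → RR} (h : Cut β) : Cut (fun x => 1 - β x) := by
  obtain ⟨h, C, hC⟩ := h
  refine ⟨h.const_sub 1, 1 + C, fun x => ⟨?_, ?_⟩⟩
  · refine (abs_sub _ _).trans ?_
    rw [abs_one]; linarith [(hC x).1]
  · rw [deriv_const_sub, abs_neg]; linarith [(hC x).2]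

lemma exists_cut (a : RR) {η : RR} (hη : 0 < η) : ∃ β : RR → RR, Cut β ∧ (∀ x, |x - a| ≤ η / 2 → β x = 1) ∧
    ∀ x, β x ≠ 0 → |x - a| < η := by
  let f : ContDiffBump a := ⟨η / 2, η, by linarith, by linarith⟩
  refine ⟨f, ⟨f.contDiff.differentiable (n := 1) (by norm_num), ?_⟩, fun x hx => f.one_of_mem_closedBall (by simpa [dist_eq] using hx), fun x hx => ?_⟩
  · have hc : Continuous (deriv (f : RR → RR)) := f.contDiff.continuous_deriv (n := 1) le_rfl
    obtain ⟨C, hC⟩ := hc.bounded_above_of_compact_support f.hasCompactSupport.deriv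
    refine ⟨max 1 C, fun x => ⟨?_, (hC x).trans (le_max_right _ _)⟩⟩
    rw [abs_of_nonneg f.nonneg]
    exact f.le_one.trans (le_max_left _ _)
  · have : x ∈ Function.support f := hx
    rw [f.support_eq] at this
    simpa [dist_eq] using this

lemma Amp1.mulW {N L : ℕ} {κ : RR → RR} {w0 : RR} {S Ψ} (hN : 0 < N) (hκ : Measurable κ) (h : Amp1 (chart N L κ w0) S Ψ)
    {β : RR → RR} (hβ : Cut β) :
    Amp1 (chart N L κ w0) (S ∩ {q | β q.2 ≠ 0}) (fun p => Ψ p * β (winv N L κ w0 p)) := by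
  obtain ⟨hd, C, hC⟩ := hβ
  obtain ⟨A, hA, hb⟩ := h.bd
  have p1 := (abs_nonneg _).trans (hC 0).1
  refine ⟨h.meas.mul (hd.continuous.measurable.comp (winv_meas hκ w0)), fun p hp => h.pos p (left_ne_zero_of_mul hp),
    fun q hq hq' => ?_, 2 * (A * C), by positivity, fun q hq => ?_⟩
  · rw [winv_chart hN κ w0 hq] at hq'
    exact ⟨h.supp q hq (left_ne_zero_of_mul hq'), right_ne_zero_of_mul hq'⟩
  · obtain ⟨d1, d2, d3, d4⟩ := hb q hq
    have he : (fun q => Ψ (chart N L κ w0 q) * β (winv N L κ w0 (chart N L κ w0 q))) =ᶠ[𝓝 q]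
        fun q => Ψ (chart N L κ w0 q) * β q.2 := by
      have hp : ∀ᶠ q' : Q2 in 𝓝 q, 0 < q'.1 := continuous_fst.continuousAt.eventually (lt_mem_nhds hq)
      filter_upwards [hp] with q' hq'
      rw [winv_chart hN κ w0 hq']
    have hs : HasFDerivAt (fun q : Q2 => β q.2) (deriv β q.2 • ContinuousLinearMap.snd RR RR RR) q :=
      (hd q.2).hasDerivAt.comp_hasFDerivAt q hasFDerivAt_snd
    have hD := (d1.hasFDerivAt.fun_mul hs).congr_of_eventuallyEq he
    have hAC : 0 ≤ A * C := by positivity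
    refine ⟨hD.differentiableAt, ?_, ?_, ?_⟩
    · rw [winv_chart hN κ w0 hq, abs_mul]
      have := mul_le_mul d2 (hC q.2).1 (abs_nonneg _) hA
      linarith
    · rw [hD.fderiv]
      simp only [_root_.add_apply, _root_.smul_apply, smul_eq_mul, ContinuousLinearMap.coe_snd', mul_zero, zero_add]
      rw [abs_mul]
      have := mul_le_mul (hC q.2).1 d3 (abs_nonneg _) p1
      linarith
    · rw [hD.fderiv]
      simp only [_root_.add_apply, _root_.smul_apply, smul_eq_mul, ContinuousLinearMap.coe_snd', mul_one]
      refine (abs_add_le _ _).trans ?_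
      rw [abs_mul, abs_mul]
      have h1 := mul_le_mul (hC q.2).1 d4 (abs_nonneg _) p1
      have h2 := mul_le_mul d2 (hC q.2).2 (abs_nonneg _) hA
      linarith

lemma glue {N L : ℕ} {κ : RR → RR} {w0 : RR} (hN : 0 < N) (hκ : Measurable κ) {G : (Q2 → RR) → Prop}
    (hadd : ∀ Ψ Ψ' : Q2 → RR, Measurable Ψ → Measurable Ψ' → (∃ C, ∀ p, |Ψ p| ≤ C) → (∃ C, ∀ p, |Ψ' p| ≤ C) →
      G Ψ → G Ψ' → G (fun p => Ψ p + Ψ' p)) {K : Set RR} (hK : IsCompact K)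
    (hloc : ∀ ω : RR, ∃ η > 0, ∀ Ψ, Amp1 (chart N L κ w0) {q | q.1 ≤ η ∧ |q.2 - ω| ≤ η} Ψ → G Ψ) :
    ∃ η > 0, ∀ Ψ, Amp1 (chart N L κ w0) {q | q.1 ≤ η ∧ q.2 ∈ K} Ψ → G Ψ := by
  have key : ∃ β : RR → RR, Cut β ∧ (∀ w ∈ K, β w = 1) ∧ ∃ η > 0, ∀ Ψ, Amp1 (chart N L κ w0) {q | q.1 ≤ η} Ψ →
      G (fun p => Ψ p * β (winv N L κ w0 p)) := by
    refine hK.induction_on (p := fun s => ∃ β : RR → RR, Cut β ∧ (∀ w ∈ s, β w = 1) ∧ ∃ η > 0, ∀ Ψ, Amp1 (chart N L κ w0) {q | q.1 ≤ η} Ψ →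
      G (fun p => Ψ p * β (winv N L κ w0 p))) ?_ ?_ ?_ ?_
    · obtain ⟨η, hη, h⟩ := hloc 0
      refine ⟨fun _ => 0, ⟨differentiable_const _, 0, by simp⟩, by simp, 1, one_pos, fun Ψ hΨ => h _ ?_⟩
      simp only [mul_zero]
      exact ⟨measurable_const, by simp, by simp, 0, le_rfl, by simp⟩
    · rintro s t hst ⟨β, h1, h2, h3⟩
      exact ⟨β, h1, fun w hw => h2 w (hst hw), h3⟩
    · rintro s t ⟨β, h1, h2, η, h3, h4⟩ ⟨β', h1', h2', η', h3', h4'⟩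
      refine ⟨fun x => 1 - (1 - β x) * (1 - β' x), (h1.one_sub.mul h1'.one_sub).one_sub, ?_, min η η', lt_min h3 h3', fun Ψ hΨ => ?_⟩
      · rintro w (hw | hw)
        · simp [h2 w hw]
        · simp [h2' w hw]
      · have a1 := hΨ.mulW hN hκ h1
        have a0 := hΨ.mulW hN hκ h1.one_sub
        have a2 := a0.mulW hN hκ h1'
        have e : (fun p => Ψ p * (1 - (1 - β (winv N L κ w0 p)) * (1 - β' (winv N L κ w0 p)))) =
          fun p => Ψ p * β (winv N L κ w0 p) + Ψ p * (1 - β (winv N L κ w0 p)) * β' (winv N L κ w0 p) := by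
          funext p; ring
        simp only [e]
        obtain ⟨C1, -, b1⟩ := a1.abs_le hN rfl
        obtain ⟨C2, -, b2⟩ := a2.abs_le hN rfl
        refine hadd _ _ a1.meas a2.meas ⟨C1, b1⟩ ⟨C2, b2⟩ (h4 _ (hΨ.mono ?_)) (h4' _ (a0.mono ?_))
        · intro q hq; simp only [mem_ofPred_eq] at hq ⊢; exact hq.trans (min_le_left _ _)
        · intro q hq; have h := hq.1; simp only [mem_ofPred_eq] at h ⊢; exact h.trans (min_le_right _ _)
    · intro ω _
      obtain ⟨η, hη, h⟩ := hloc ω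
      obtain ⟨β, hβ, hβ1, hβ2⟩ := exists_cut ω hη
      refine ⟨closedBall ω (η / 2), mem_nhdsWithin_of_mem_nhds (closedBall_mem_nhds _ (by linarith)), β, hβ,
        fun w hw => hβ1 w (by simpa [dist_eq] using hw), η, hη, fun Ψ hΨ => h _ ((hΨ.mulW hN hκ hβ).mono ?_)⟩
      exact fun q hq => ⟨hq.1, (hβ2 _ hq.2).le⟩
  obtain ⟨β, h1, h2, η, hη, h3⟩ := key
  refine ⟨η, hη, fun Ψ hΨ => ?_⟩
  have e : (fun p => Ψ p * β (winv N L κ w0 p)) = Ψ := by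
    funext p
    by_cases hp : Ψ p = 0
    · rw [hp, zero_mul]
    · have hp1 := hΨ.pos p hp
      have := hΨ.supp (tinv N p, winv N L κ w0 p) (tinv_pos hp1) (by rwa [chart_inv hN κ w0 hp1])
      rw [h2 _ this.2, mul_one]
  rw [← e]
  exact h3 Ψ (hΨ.mono fun q hq => hq.1)

/-- monomial-type substitution -/
def Mp (Q P : ℕ) (c : RR → RR) (ω : RR) (q : Q2) : Q2 := (q.1 ^ Q, c (q.1 ^ Q) + q.1 ^ P * (ω + q.2))
/-- new centre -/
def kp (κ : RR → RR) (Q L P : ℕ) (c : RR → RR) (ω : RR) (t : RR) : RR := κ (t ^ Q) + t ^ (Q * L) * (c (t ^ Q) + t ^ P * ω)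

lemma chart_Mp (N L Q P : ℕ) (κ c : RR → RR) (w0 ω : RR) :
    (fun q => chart N L κ w0 (Mp Q P c ω q)) = chart (Q * N) (Q * L + P) (kp κ Q L P c ω) w0 := by
  funext q
  simp only [chart, Mp, kp, ← pow_mul, pow_add, Prod.mk.injEq, true_and]
  ring

lemma Mp_hasFDerivAt {Q P : ℕ} {c : RR → RR} {ω : RR} {q : Q2} (hc : DifferentiableAt RR c (q.1 ^ Q)) :
    ∃ M' : Q2 →L[RR] Q2, HasFDerivAt (Mp Q P c ω) M' q ∧
      M' (q.1, 0) = (Q * q.1 ^ Q, deriv c (q.1 ^ Q) * (Q * q.1 ^ Q) + P * (q.1 ^ P * (ω + q.2))) ∧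
      M' (0, 1) = (0, q.1 ^ P) := by
  have hp : ∀ n : ℕ, HasFDerivAt (fun q : Q2 => q.1 ^ n) (((n:RR) * q.1 ^ (n - 1)) • ContinuousLinearMap.fst RR RR RR) q :=
    fun n => (hasDerivAt_pow n q.1).comp_hasFDerivAt q hasFDerivAt_fst
  have h1 : HasFDerivAt (fun q : Q2 => c (q.1 ^ Q)) (deriv c (q.1 ^ Q) • (((Q:RR) * q.1 ^ (Q - 1)) • ContinuousLinearMap.fst RR RR RR)) q :=
    hc.hasDerivAt.comp_hasFDerivAt q (hp Q)
  have h2 : HasFDerivAt (fun q : Q2 => ω + q.2) (ContinuousLinearMap.snd RR RR RR) q := hasFDerivAt_snd.const_add ω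
  have h3 := (hp Q).prodMk (h1.fun_add ((hp P).fun_mul h2))
  have hpw : ∀ r : ℕ, (r * q.1 ^ (r - 1)) * q.1 = r * q.1 ^ r := by
    intro r
    rcases r with _ | r
    · simp
    · rw [Nat.add_sub_cancel, pow_succ]; ring
  refine ⟨_, h3, ?_, ?_⟩
  · simp only [ContinuousLinearMap.prod_apply, _root_.add_apply, _root_.smul_apply, smul_eq_mul, ContinuousLinearMap.coe_snd', ContinuousLinearMap.coe_fst', hpw, mul_zero, zero_add]
    congr 2; ring
  · simp

lemma Amp1.pullM {χ S Ψ} (h : Amp1 χ S Ψ) {Q P : ℕ} (hQ : 0 < Q) {c : RR → RR} {ω η R : RR} {S' : Set Q2}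
    (hS : IsClosed S) (hη : η ≤ 1) (hSb : ∀ q ∈ S, q.1 ≤ η ∧ |q.2| ≤ R)
    (hc : ∀ t, 0 ≤ t → t ≤ η → DifferentiableAt RR c t ∧ |c t| ≤ R ∧ |deriv c t| ≤ R)
    (hS' : ∀ q : Q2, 0 < q.1 → Mp Q P c ω q ∈ S → q ∈ S') : Amp1 (fun q => χ (Mp Q P c ω q)) S' Ψ := by
  refine h.pull (C := 1 + Q + |R| * Q + P * (|R| + |R|)) (fun q hq => pow_pos hq Q) ?_ ?_
  · intro q hq hq'
    by_cases h1 : q.1 ^ Q ≤ η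
    · obtain ⟨M', hM, -⟩ := Mp_hasFDerivAt (P := P) (ω := ω) (hc _ (pow_pos hq Q).le h1).1
      exact hM.continuousAt.eventually (hS.isOpen_compl.mem_nhds hq')
    · have hcont : Continuous fun q : Q2 => q.1 ^ Q := by fun_prop
      filter_upwards [hcont.continuousAt.eventually (lt_mem_nhds (not_le.1 h1))] with q' hq1 hq2
      exact absurd (hSb _ hq2).1 (not_le.2 hq1)
  · intro q hq hq'
    obtain ⟨h1, h2⟩ := hSb _ hq'
    have h0 : 0 ≤ q.1 ^ Q := (pow_pos hq Q).le
    have h1' : q.1 ^ Q ≤ η := h1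
    obtain ⟨hd, c1, c2⟩ := hc _ h0 h1'
    obtain ⟨M', hM, e1, e2⟩ := Mp_hasFDerivAt (P := P) (ω := ω) hd
    have hR := le_abs_self R
    have hq1 : q.1 ≤ 1 := by
      by_contra hh
      have := one_lt_pow₀ (not_le.1 hh) hQ.ne'
      linarith
    refine ⟨hS' q hq hq', M', hM, Q, _, _, e1, e2, ?_, ?_, ?_⟩
    · rw [Nat.abs_cast]
      have : 0 ≤ |R| * Q + P * (|R| + |R|) := by positivity
      linarith
    · refine (abs_add_le _ _).trans ?_
      have e3 : q.1 ^ P * (ω + q.2) = (Mp Q P c ω q).2 - c (q.1 ^ Q) := by simp [Mp]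
      rw [e3, abs_mul, abs_mul, abs_mul, Nat.abs_cast, Nat.abs_cast]
      have a1 : |deriv c (q.1 ^ Q)| * (Q * |q.1 ^ Q|) ≤ |R| * (Q * 1) := by
        have := abs_of_nonneg h0
        exact mul_le_mul (c2.trans hR) (by gcongr; linarith) (by positivity) (abs_nonneg _)
      have a2 : (P:RR) * |(Mp Q P c ω q).2 - c (q.1 ^ Q)| ≤ P * (|R| + |R|) := by
        gcongr
        exact (abs_sub _ _).trans (add_le_add (h2.trans hR) (c1.trans hR))
      have : (0:RR) ≤ Q := by positivity
      linarith
    · rw [abs_of_nonneg (pow_pos hq P).le]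
      have := pow_le_one₀ (n := P) hq.le hq1
      have : 0 ≤ Q + |R| * Q + P * (|R| + |R|) := by positivity
      linarith

lemma Mp_tendsto {Q P : ℕ} {c : RR → RR} {ω : RR} (hQ : 0 < Q) (hc : ContinuousAt c 0) (hc0 : c 0 = 0) (hP : P = 0 → ω = 0) :
    Tendsto (Mp Q P c ω) (𝓝 0) (𝓝 0) := by
  have h0 : Mp Q P c ω 0 = 0 := by
    have : (0:RR) ^ P * ω = 0 := by
      rcases P.eq_zero_or_pos with h | h
      · simp [hP h]
      · simp [h.ne']
    ext <;> simp [Mp, hQ.ne', hc0, this]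
  have hp : ContinuousAt (fun q : Q2 => q.1 ^ Q) 0 := by fun_prop
  have h1 : ContinuousAt (fun q : Q2 => c (q.1 ^ Q)) 0 :=
    ContinuousAt.comp (f := fun q : Q2 => q.1 ^ Q) (g := c) (by simpa [hQ.ne'] using hc) hp
  have h2 : ContinuousAt (Mp Q P c ω) 0 := hp.prodMk (h1.add (by fun_prop))
  unfold ContinuousAt at h2
  rwa [h0] at h2

lemma IsNode.pull {ι : Type} [Fintype ι] {g : Q2 → RR} {D : Set Q2} {γ : ι → RR} {w0 : RR}
    {N L : ℕ} {κ : RR → RR} {m : RR} {F : ι → Q2 → RR} {k : ι → ℕ} (hn : IsNode g D γ w0 N L κ m F k)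
    {Q P : ℕ} {c : RR → RR} {ω : RR} (hQ : 0 < Q) (hcm : Measurable c) (hc : AnalyticAt RR c 0) (hc0 : c 0 = 0) (hP : P = 0 → ω = 0)
    {F' : ι → Q2 → RR} {k' e : ι → ℕ} (hr : ∀ i, Reg (F' i) (k' i))
    (hF : ∀ i, ∀ᶠ q : Q2 in 𝓝 0, 0 < q.1 → F i (Mp Q P c ω q) = q.1 ^ e i * F' i q) :
    ∃ m', IsNode g D γ w0 (Q * N) (Q * L + P) (kp κ Q L P c ω) m' F' k' := by
  have hT := Mp_tendsto hQ hc.continuousAt hc0 hP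
  have hF' := eventually_all.2 hF
  have hch : ∀ q, chart (Q * N) (Q * L + P) (kp κ Q L P c ω) w0 q = chart N L κ w0 (Mp Q P c ω q) :=
    fun q => (congrFun (chart_Mp N L Q P κ c w0 ω) q).symm
  refine ⟨Q * m + ∑ i, e i * γ i, Nat.mul_pos hQ hn.hN, ?_, ?_, ?_, hr, ?_, ?_⟩
  · exact (Nat.mul_le_mul_left Q hn.hL).trans (Nat.le_add_right _ _)
  · have h1 := hn.κm
    unfold kp
    fun_prop
  · obtain ⟨κ1, h1, h2, h3⟩ := hn.hκ
    have hp : AnalyticAt RR (fun t : RR => t ^ Q) 0 := by fun_prop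
    have hw : (0:RR) ^ P * ω = 0 := by
      rcases P.eq_zero_or_pos with h | h
      · simp [hP h]
      · simp [h.ne']
    refine ⟨fun t => κ1 (t ^ Q) + t ^ (Q * (L - N)) * (c (t ^ Q) + t ^ P * ω), ?_, ?_, ?_⟩
    · have a1 : AnalyticAt RR (fun t : RR => κ1 (t ^ Q)) 0 := AnalyticAt.fun_comp (by simpa [hQ.ne'] using h1) hp
      have a2 : AnalyticAt RR (fun t : RR => c (t ^ Q)) 0 := AnalyticAt.fun_comp (by simpa [hQ.ne'] using hc) hp
      exact a1.fun_add ((analyticAt_id.fun_pow _).fun_mul (a2.fun_add ((analyticAt_id.fun_pow _).fun_mul analyticAt_const)))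
    · simp [hQ.ne', h2, hc0, hw]
    · have ht : Tendsto (fun t : RR => t ^ Q) (𝓝 0) (𝓝 0) := by
        simpa [ContinuousAt, hQ.ne'] using hp.continuousAt
      filter_upwards [ht.eventually h3] with t ht
      have e1 : Q * L = Q * N + Q * (L - N) := by rw [← Nat.mul_add, Nat.add_sub_cancel' hn.hL]
      rw [kp, ht, e1, pow_add, ← pow_mul]; ring
  · filter_upwards [hT.eventually hn.rep, hF'] with q h1 h2 hq
    have h3 := h1 (pow_pos hq Q)
    rw [hch, h3]
    congr 1
    have e1 : ∀ i, |F i (Mp Q P c ω q)| ^ γ i = q.1 ^ (e i * γ i) * |F' i q| ^ γ i := by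
      intro i
      rw [h2 i hq, abs_mul, abs_of_pos (pow_pos hq _), mul_rpow (pow_pos hq _).le (abs_nonneg _), rpow_mul hq.le,
        rpow_natCast]
    simp only [e1, Finset.prod_mul_distrib]
    rw [abs_of_pos hq, rpow_add hq, rpow_mul hq.le, rpow_natCast, rpow_sum_of_pos hq,
      show |(Mp Q P c ω q).1| = q.1 ^ Q from abs_of_pos (pow_pos hq Q)]
    ring
  · filter_upwards [hT.eventually hn.fr, hF'] with q h1 h2 hq h3
    rw [hch] at h3
    obtain ⟨i, hi⟩ := h1 (pow_pos hq Q) h3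
    rw [h2 i hq] at hi
    exact ⟨i, (mul_eq_zero.1 hi).resolve_left (pow_pos hq _).ne'⟩

/-- the claim of the induction -/
def Claim (g : Q2 → RR) (w0 : RR) (N L : ℕ) (κ : RR → RR) : Prop :=
  ∃ η > 0, ∀ Ψ, Amp1 (chart N L κ w0) {q | q.1 ≤ η ∧ |q.2| ≤ η} Ψ → Good g w0 Ψ

/-- prepared families -/
structure Prep {ι : Type} (F : ι → Q2 → RR) (k : ι → ℕ) (a : ι → ℕ → RR → RR) (U : ι → Q2 → RR) : Prop where
  ex : ∀ i, Expd (F i) (k i) (a i) (U i)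
  U0 : ∀ i, U i 0 ≠ 0
  ord : ∀ i, ∀ r < k i, (∀ᶠ t in 𝓝 0, a i r t = 0) ∨ ∃ n b, 0 < n ∧ AnalyticAt RR b 0 ∧ b 0 ≠ 0 ∧
    ∀ᶠ t in 𝓝 0, a i r t = t ^ ((k i - r) * n) * b t
  ctr : (∃ i, 0 < k i) → ∃ i, 0 < k i ∧ ∀ᶠ t in 𝓝 0, a i (k i - 1) t = 0

lemma box_closed (η ω : RR) : IsClosed {q : Q2 | q.1 ≤ η ∧ |q.2 - ω| ≤ η} :=
  IsClosed.and (isClosed_le continuous_fst continuous_const) (isClosed_le (by fun_prop) continuous_const)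

lemma tendsto_powQ {Q : ℕ} (hQ : 0 < Q) : Tendsto (fun t : RR => t ^ Q) (𝓝 0) (𝓝 0) := by
  have : ContinuousAt (fun t : RR => t ^ Q) 0 := by fun_prop
  simpa [ContinuousAt, hQ.ne'] using this

lemma analyticAt_sub {F : Q2 → RR} (hF : AnalyticAt RR F 0) {u v : Q2 → RR} (hu : AnalyticAt RR u 0) (hv : AnalyticAt RR v 0)
    (hu0 : u 0 = 0) (hv0 : v 0 = 0) : AnalyticAt RR (fun q => F (u q, v q)) 0 :=
  AnalyticAt.fun_comp (f := fun q => (u q, v q)) (by rw [hu0, hv0]; exact hF) (hu.prod hv)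

lemma prepare {ι : Type} [Fintype ι] {g : Q2 → RR} {D : Set Q2} {γ : ι → RR} {w0 : RR}
    {N L : ℕ} {κ : RR → RR} {m : RR} {F : ι → Q2 → RR} {k : ι → ℕ} (hn : IsNode g D γ w0 N L κ m F k) :
    ∃ N' L' κ' m' F' a U, IsNode g D γ w0 N' L' κ' m' F' k ∧ Prep F' k a U ∧ (Claim g w0 N' L' κ' → Claim g w0 N L κ) := by
  -- centre
  obtain ⟨c0, hc0a, hc00, hctr⟩ : ∃ c : RR → RR, AnalyticAt RR c 0 ∧ c 0 = 0 ∧ ((∃ i, 0 < k i) → ∃ i, 0 < k i ∧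
      ∀ a U, Expd (fun q => F i (q.1, c q.1 + q.2)) (k i) a U → ∀ᶠ t in 𝓝 0, a (k i - 1) t = 0) := by
    by_cases h : ∃ i, 0 < k i
    · obtain ⟨i, hi⟩ := h
      obtain ⟨k', hk'⟩ := Nat.exists_eq_add_of_lt hi
      have hk'' : k i = k' + 1 := by omega
      obtain ⟨c, h1, h2, h3⟩ := exists_center (hk'' ▸ hn.reg i)
      refine ⟨c, h1, h2, fun _ => ⟨i, hi, ?_⟩⟩
      rw [hk'']
      exact h3
    · exact ⟨fun _ => 0, analyticAt_const, rfl, fun h' => absurd h' h⟩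
  have hg : ∀ i, ∃ a U, Expd (fun q => F i (q.1, c0 q.1 + q.2)) (k i) a U ∧ (∀ r < k i, a r 0 = 0) ∧ U 0 ≠ 0 := by
    intro i
    refine Reg.expand ⟨?_, ?_⟩
    · refine analyticAt_sub (hn.reg i).1 analyticAt_fst (AnalyticAt.fun_add ?_ analyticAt_snd) rfl (by simp [hc00])
      exact AnalyticAt.fun_comp (f := fun q : Q2 => q.1) hc0a analyticAt_fst
    · obtain ⟨u, h1, h2, h3⟩ := (hn.reg i).2
      exact ⟨u, h1, h2, by simpa [hc00] using h3⟩
  choose a U hex ha0 hU0 using hg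
  set Q : ℕ := ∏ i, (k i).factorial with hQdef
  have hQ : 0 < Q := Finset.prod_pos fun i _ => Nat.factorial_pos _
  -- truncated centre
  obtain ⟨ρ, hρ, hρc⟩ : ∃ ρ > 0, ∀ t, |t| < ρ → AnalyticAt RR c0 t := by
    obtain ⟨ρ, h1, h2⟩ := Metric.eventually_nhds_iff.1 hc0a.eventually_analyticAt
    exact ⟨ρ, h1, fun t ht => h2 (by simpa [dist_eq] using ht)⟩
  classical
  set c : RR → RR := fun t => if |t| < ρ then c0 t else 0 with hcdef
  have hopen : IsOpen {t : RR | |t| < ρ} := isOpen_lt (by fun_prop) (by fun_prop)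
  have hcc : ∀ t, |t| < ρ → c =ᶠ[𝓝 t] c0 := fun t ht => by
    filter_upwards [hopen.mem_nhds ht] with s hs
    exact if_pos hs
  have hca : AnalyticAt RR c 0 := hc0a.congr (hcc 0 (by simpa using hρ)).symm
  have hcz : c 0 = 0 := by simp [hcdef, hc00]
  have hcm : Measurable c := by
    have h1 : ContinuousOn c0 {t : RR | |t| < ρ} := fun t ht => (hρc t ht).continuousAt.continuousWithinAt
    exact h1.measurable_piecewise continuousOn_const hopen.measurableSet
  have hcont : ContinuousAt c 0 := hca.continuousAt
  have hcl0 : c =ᶠ[𝓝 0] c0 := hcc 0 (by simpa using hρ)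
  have hT1 : Tendsto (fun q : Q2 => q.1 ^ Q) (𝓝 0) (𝓝 0) := (tendsto_powQ hQ).comp (by simpa using (continuous_fst (X := RR) (Y := RR)).tendsto 0)
  have hT2 : Tendsto (fun q : Q2 => (q.1 ^ Q, q.2)) (𝓝 0) (𝓝 0) := by
    have : ContinuousAt (fun q : Q2 => (q.1 ^ Q, q.2)) 0 := by fun_prop
    unfold ContinuousAt at this
    simp only [Prod.fst_zero, Prod.snd_zero, zero_pow hQ.ne'] at this
    exact this
  have hpa : AnalyticAt RR (fun q : Q2 => q.1 ^ Q) 0 := analyticAt_fst.fun_pow Q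
  set F' : ι → Q2 → RR := fun i q => F i (q.1 ^ Q, c0 (q.1 ^ Q) + q.2) with hF'
  have hreg : ∀ i, Reg (F' i) (k i) := by
    intro i
    refine ⟨?_, ?_⟩
    · refine analyticAt_sub (hn.reg i).1 hpa (AnalyticAt.fun_add ?_ analyticAt_snd) (by simp [hQ.ne']) (by simp [hc00, hQ.ne'])
      exact AnalyticAt.fun_comp (f := fun q : Q2 => q.1 ^ Q) (by simpa [hQ.ne'] using hc0a) hpa
    · obtain ⟨u, h1, h2, h3⟩ := (hn.reg i).2
      exact ⟨u, h1, h2, by simpa [hF', hc00, hQ.ne'] using h3⟩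
  obtain ⟨m', hnode⟩ := hn.pull (Q := Q) (P := 0) (c := c) (ω := 0) hQ hcm hca hcz (fun _ => rfl) (F' := F') (e := fun _ => 0) hreg (by
    intro i
    filter_upwards [hT1.eventually hcl0] with q hq _
    simp [Mp, hF', hq])
  refine ⟨_, _, _, m', F', fun i r t => a i r (t ^ Q), fun i q => U i (q.1 ^ Q, q.2), hnode, ?_, ?_⟩
  · have hp1 : AnalyticAt RR (fun t : RR => t ^ Q) 0 := analyticAt_id.fun_pow Q
    refine ⟨fun i => ⟨fun r => ?_, ?_, ?_⟩, fun i => ?_, fun i r hr => ?_, fun h => ?_⟩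
    · exact AnalyticAt.fun_comp (f := fun t : RR => t ^ Q) (by simpa [hQ.ne'] using (hex i).1 r) hp1
    · exact analyticAt_sub (hex i).2.1 hpa analyticAt_snd (by simp [hQ.ne']) rfl
    · filter_upwards [hT2.eventually (hex i).2.2] with q hq
      exact hq
    · simp only [Prod.fst_zero, Prod.snd_zero, zero_pow hQ.ne']; exact hU0 i
    · rcases ((hex i).1 r).eventually_eq_zero_or_eventually_ne_zero with h | h
      · exact Or.inl ((tendsto_powQ hQ).eventually h)
      · right
        obtain ⟨n, b, hb, hb0, hab⟩ := ((hex i).1 r).exists_eventuallyEq_pow_smul_nonzero_iff.2 (fun h' => by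
          obtain ⟨t, h1, h2⟩ := (h.and (h'.filter_mono nhdsWithin_le_nhds)).exists
          exact h1 h2)
        have hn0 : n ≠ 0 := by
          rintro rfl
          have := Eventually.self_of_nhds hab
          simp [ha0 i r hr] at this
          exact hb0 this.symm
        obtain ⟨d, hd⟩ : k i - r ∣ Q :=
          (Nat.dvd_factorial (by omega) (Nat.sub_le _ _)).trans (Finset.dvd_prod_of_mem _ (Finset.mem_univ i))
        refine ⟨d * n, fun t => b (t ^ Q), ?_, AnalyticAt.fun_comp (f := fun t : RR => t ^ Q) (by simpa [hQ.ne'] using hb) hp1, by simpa [hQ.ne'] using hb0, ?_⟩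
        · refine Nat.mul_pos (Nat.pos_of_ne_zero ?_) (Nat.pos_of_ne_zero hn0)
          rintro rfl
          omega
        · filter_upwards [(tendsto_powQ hQ).eventually hab] with t ht
          rw [ht, sub_zero, smul_eq_mul, ← mul_assoc, ← hd, ← pow_mul]
    · obtain ⟨i, h1, h2⟩ := hctr h
      exact ⟨i, h1, (tendsto_powQ hQ).eventually (h2 _ _ (hex i))⟩
  · rintro ⟨η', hη', hcl⟩
    -- choose η
    have hcd : ∀ᶠ t in 𝓝 (0:RR), |c t| < η' / 2 ∧ |deriv c t| < |deriv c 0| + 1 ∧ DifferentiableAt RR c t := by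
      have h1 : ∀ᶠ t in 𝓝 (0:RR), |c t| < η' / 2 := hcont.abs.eventually (gt_mem_nhds (by simpa [hcz] using half_pos hη'))
      have h2 := hca.deriv.continuousAt.abs.eventually (gt_mem_nhds (lt_add_one |deriv c 0|))
      filter_upwards [h1, h2, hca.eventually_analyticAt] with t a b d
      exact ⟨a, b, d.differentiableAt⟩
    obtain ⟨ε, hε, hεc⟩ := Metric.eventually_nhds_iff.1 hcd
    set η := min (min (ε / 2) (η' / 2)) (min (η' ^ Q) 1) with hη
    have hη0 : 0 < η := lt_min (lt_min (by linarith) (by linarith)) (lt_min (pow_pos hη' Q) one_pos)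
    have l1 : η ≤ ε / 2 := (min_le_left _ _).trans (min_le_left _ _)
    have l2 : η ≤ η' / 2 := (min_le_left _ _).trans (min_le_right _ _)
    have l3 : η ≤ η' ^ Q := (min_le_right _ _).trans (min_le_left _ _)
    have l4 : η ≤ 1 := (min_le_right _ _).trans (min_le_right _ _)
    refine ⟨η, hη0, fun Ψ hΨ => hcl Ψ ?_⟩
    rw [← chart_Mp]
    refine hΨ.pullM hQ (η := η) (R := max η (max (η' / 2) (|deriv c 0| + 1))) (by simpa using box_closed η 0) l4 ?_ ?_ ?_
    · exact fun q hq => ⟨hq.1, hq.2.trans (le_max_left _ _)⟩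
    · intro t h0 h1
      obtain ⟨a, b, d⟩ := hεc (y := t) (by rw [dist_eq, sub_zero, abs_of_nonneg h0]; linarith)
      exact ⟨d, a.le.trans ((le_max_left _ _).trans (le_max_right _ _)), b.le.trans ((le_max_right _ _).trans (le_max_right _ _))⟩
    · rintro q hq ⟨h1, h2⟩
      simp only [Mp, pow_zero, one_mul, zero_add] at h1 h2
      have h3 := pow_pos hq Q
      obtain ⟨a, -, -⟩ := hεc (y := q.1 ^ Q) (by rw [dist_eq, sub_zero, abs_of_nonneg h3.le]; linarith)
      refine ⟨le_of_pow_le_pow_left₀ hQ.ne' hη'.le (h1.trans l3), ?_⟩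
      rw [abs_le] at h2 ⊢
      rw [abs_lt] at a
      constructor <;> linarith

open Polynomial in
lemma poly_step (k : ℕ) (b : ℕ → RR) {u : RR} (hu : u ≠ 0) (ω : RR) : ∃ (k' : ℕ) (h : RR[X]), k' ≤ k ∧ h.eval ω ≠ 0 ∧
    (∀ x, ∑ r ∈ Finset.range k, b r * x ^ r + x ^ k * u = (x - ω) ^ k' * h.eval x) ∧
    (k' = k → ∀ r < k, b r = u * (-ω) ^ (k - r) * (k.choose r)) := by
  set p : RR[X] := ∑ r ∈ Finset.range k, C (b r) * X ^ r + C u * X ^ k with hp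
  have hdl : (∑ r ∈ Finset.range k, C (b r) * X ^ r).degree < (k : WithBot ℕ) := by
    refine (Finset.sup_lt_iff (f := fun r => (C (b r) * X ^ r : RR[X]).degree) (WithBot.bot_lt_coe k) |>.2 fun r hr => ?_).trans_le' (degree_sum_le _ _)
    exact (degree_C_mul_X_pow_le _ _).trans_lt (WithBot.coe_lt_coe.2 (Nat.cast_lt.2 (Finset.mem_range.1 hr)))
  have hck : p.coeff k = u := by
    rw [hp, coeff_add, coeff_eq_zero_of_degree_lt hdl, coeff_C_mul_X_pow]; simp
  have hcr : ∀ r < k, p.coeff r = b r := by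
    intro r hr
    rw [hp, coeff_add, coeff_C_mul_X_pow, finsetSum_coeff]
    simp only [coeff_C_mul_X_pow]
    rw [Finset.sum_ite_eq (Finset.range k) r]
    simp [hr, hr.ne]
  have hp0 : p ≠ 0 := by rintro h; rw [h, coeff_zero] at hck; exact hu hck.symm
  have hdeg : p.natDegree ≤ k := by
    refine natDegree_le_of_degree_le ((degree_add_le _ _).trans (max_le hdl.le ?_))
    exact degree_C_mul_X_pow_le _ _
  obtain ⟨h, h1, h2⟩ := exists_eq_pow_rootMultiplicity_mul_and_not_dvd p hp0 ω
  set k' := p.rootMultiplicity ω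
  have hh0 : h ≠ 0 := by rintro rfl; simp at h2
  have hXd : ((X - C ω) ^ k').natDegree = k' := by simp
  have hnd : p.natDegree = k' + h.natDegree := by
    rw [h1, (monic_X_sub_C ω |>.pow k').natDegree_mul' hh0, hXd]
  refine ⟨k', h, by omega, fun h3 => h2 (dvd_iff_isRoot.2 h3), fun x => ?_, fun hk r hr => ?_⟩
  · have : p.eval x = ((X - C ω) ^ k' * h).eval x := by rw [← h1]
    rw [hp, eval_add, eval_finsetSum] at this
    simp only [eval_mul, eval_C, eval_pow, eval_X, eval_sub] at this
    rw [← this]; ring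
  · have hh : h = C (h.coeff 0) := eq_C_of_natDegree_eq_zero (by omega)
    have hpe : p = (X + C (-ω)) ^ k * C (h.coeff 0) := by rw [← hh, h1, hk]; simp [sub_eq_add_neg]
    have hc : h.coeff 0 = u := by rw [← hck, hpe, coeff_mul_C, coeff_X_add_C_pow]; simp
    rw [← hcr r hr, hpe, coeff_mul_C, coeff_X_add_C_pow, hc]; ring

lemma min_P {ι : Type} {F : ι → Q2 → RR} {k : ι → ℕ} {a : ι → ℕ → RR → RR} {U : ι → Q2 → RR} (hp : Prep F k a U)
    (hz : ¬ ∀ i, ∀ r < k i, ∀ᶠ t in 𝓝 0, a i r t = 0) :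
    ∃ P, 0 < P ∧ ∃ b : ι → ℕ → RR → RR, (∀ i r, r < k i → AnalyticAt RR (b i r) 0 ∧ ∀ᶠ t in 𝓝 0, a i r t = t ^ (P * (k i - r)) * b i r t) ∧
      ∃ i r, r < k i ∧ b i r 0 ≠ 0 := by
  classical
  have hne : ∃ n, 0 < n ∧ ∃ i r, r < k i ∧ ∃ b : RR → RR, AnalyticAt RR b 0 ∧ b 0 ≠ 0 ∧ ∀ᶠ t in 𝓝 0, a i r t = t ^ ((k i - r) * n) * b t := by
    obtain ⟨i, hz⟩ := not_forall.1 hz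
    obtain ⟨r, hz⟩ := not_forall.1 hz
    obtain ⟨hr, h⟩ := Classical.not_imp.1 hz
    rcases hp.ord i r hr with h' | ⟨n, b, h1, h2, h3, h4⟩
    · exact absurd h' h
    · exact ⟨n, h1, i, r, hr, b, h2, h3, h4⟩
  obtain ⟨hP, i0, r0, hr0, b0, hb1, hb2, hb3⟩ := Nat.find_spec hne
  set P := Nat.find hne with hPdef
  have key : ∀ i r, ∃ b : RR → RR, r < k i → AnalyticAt RR b 0 ∧ ∀ᶠ t in 𝓝 0, a i r t = t ^ (P * (k i - r)) * b t := by
    intro i r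
    by_cases hr : r < k i
    · rcases hp.ord i r hr with h | ⟨n, b, h1, h2, h3, h4⟩
      · exact ⟨fun _ => 0, fun _ => ⟨analyticAt_const, by filter_upwards [h] with t ht; simp [ht]⟩⟩
      · have hle : P ≤ n := Nat.find_min' hne ⟨h1, i, r, hr, b, h2, h3, h4⟩
        refine ⟨fun t => t ^ ((k i - r) * (n - P)) * b t, fun _ => ⟨(analyticAt_id.fun_pow _).fun_mul h2, ?_⟩⟩
        filter_upwards [h4] with t ht
        rw [ht, ← mul_assoc, ← pow_add, mul_comm P, ← Nat.mul_add, Nat.add_sub_cancel' hle]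
    · exact ⟨fun _ => 0, fun h => absurd h hr⟩
  choose b hb using key
  refine ⟨P, hP, b, hb, i0, r0, hr0, ?_⟩
  rw [eq_at_zero (j := P * (k i0 - r0)) (hb i0 r0 hr0).1.continuousAt hb1.continuousAt]
  · exact hb2
  · filter_upwards [(hb i0 r0 hr0).2, hb3] with t h1 h2
    rw [← h1, h2, mul_comm P]

lemma ev_box {p : Q2 → Prop} (h : ∀ᶠ q in 𝓝 0, p q) : ∃ ρ > 0, ∀ q : Q2, |q.1| ≤ ρ → |q.2| ≤ ρ → p q := by
  obtain ⟨ρ, h1, h2⟩ := Metric.eventually_nhds_iff.1 h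
  refine ⟨ρ / 2, half_pos h1, fun q a b => h2 ?_⟩
  rw [dist_zero_right, Prod.norm_def]
  exact max_lt (lt_of_le_of_lt a (half_lt_self h1)) (lt_of_le_of_lt b (half_lt_self h1))

lemma leafStep {ι : Type} [Fintype ι] {g : Q2 → RR} {D : Set Q2} {γ : ι → RR} {w0 : RR}
    {N L : ℕ} {κ : RR → RR} {m : RR} {F : ι → Q2 → RR} {k : ι → ℕ} (hg : Integrable g) (hg0 : ∀ p, 0 ≤ g p)
    (hn : IsNode g D γ w0 N L κ m F k) {a : ι → ℕ → RR → RR} {U : ι → Q2 → RR} (hp : Prep F k a U) :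
    ∃ η > 0, ∃ ε : ι → RR, (∀ i, 0 < ε i) ∧ ∀ S : Set Q2, IsClosed S →
      (∀ q ∈ S, 0 < q.1 → q.1 ≤ η ∧ |q.2| ≤ η) →
      (∀ q ∈ S, 0 < q.1 → q.2 ≠ 0 → ∀ i, ∀ r < k i, |a i r q.1| ≤ ε i * |q.2| ^ (k i - r) ∧ |q.1 * deriv (a i r) q.1| ≤ |q.2| ^ (k i - r)) →
      ∀ Ψ, Amp (fun q => (0, q.2)) (chart N L κ w0) S Ψ → Good g w0 Ψ := by
  obtain ⟨η1, hη1, H⟩ := leafNode hg hg0 hn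
  have h1 := fun i => leafF (hp.ex i) (hn.reg i).1 (hp.U0 i)
  choose ε hε C hC hev using h1
  obtain ⟨ρ, hρ, hbox⟩ := ev_box (eventually_all.2 hev)
  refine ⟨min η1 ρ, lt_min hη1 hρ, ε, hε, fun S hS hSb hSa Ψ hΨ => ?_⟩
  refine H S hS (fun q h h' => ⟨(hSb q h h').1.trans (min_le_left _ _), (hSb q h h').2.trans (min_le_left _ _)⟩) (∑ i, C i)
    (Finset.sum_nonneg fun i _ => hC i) (fun q hq hq1 hq2 i => ?_) Ψ hΨ
  obtain ⟨b1, b2⟩ := hSb q hq hq1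
  have hle : C i ≤ ∑ i, C i := Finset.single_le_sum (fun i _ => hC i) (Finset.mem_univ i)
  obtain ⟨h2, h3, h4⟩ := hbox q (by rw [abs_of_pos hq1]; exact b1.trans (min_le_right _ _)) (b2.trans (min_le_right _ _)) i hq2 (hSa q hq hq1 hq2 i)
  have hm := mul_le_mul_of_nonneg_right hle (abs_nonneg (F i q))
  exact ⟨h2, ⟨h3.1, h3.2.trans hm⟩, ⟨h4.1, h4.2.trans hm⟩⟩

lemma Amp1.leaf {χ S Ψ} (h : Amp1 χ S Ψ) (hS : IsClosed S) {R : RR} (hR : ∀ q ∈ S, |q.2| ≤ R) :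
    Amp (fun q => (0, q.2)) χ S Ψ := by
  obtain ⟨C, hC, hb⟩ := h.bd
  refine ⟨h.meas, h.pos, h.supp, C + |R| * C, by positivity, fun q hq => ?_⟩
  obtain ⟨d1, d2, d3, d4⟩ := hb q hq
  have h0 : 0 ≤ |R| * C := by positivity
  refine ⟨d1, by linarith, by linarith, ?_⟩
  by_cases hq' : q ∈ S
  · rw [show ((0, q.2) : Q2) = q.2 • ((0:RR), (1:RR)) by simp, map_smul, smul_eq_mul, abs_mul]
    have := mul_le_mul ((hR q hq').trans (le_abs_self R)) d4 (abs_nonneg _) (abs_nonneg _)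
    linarith
  · have h0' : (fun q => Ψ (χ q)) =ᶠ[𝓝 q] fun _ => 0 := by
      have hp : ∀ᶠ q' : Q2 in 𝓝 q, 0 < q'.1 := continuous_fst.continuousAt.eventually (lt_mem_nhds hq)
      filter_upwards [hS.isOpen_compl.mem_nhds hq', hp] with q' h1 h2
      by_contra h3
      exact h1 (h.supp _ h2 h3)
    rw [h0'.fderiv_eq]
    simp
    linarith

lemma claim_zero {ι : Type} [Fintype ι] {g : Q2 → RR} {D : Set Q2} {γ : ι → RR} {w0 : RR}
    {N L : ℕ} {κ : RR → RR} {m : RR} {F : ι → Q2 → RR} {k : ι → ℕ} (hg : Integrable g) (hg0 : ∀ p, 0 ≤ g p)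
    (hn : IsNode g D γ w0 N L κ m F k) {a : ι → ℕ → RR → RR} {U : ι → Q2 → RR} (hp : Prep F k a U)
    (hz : ∀ i, ∀ r < k i, ∀ᶠ t in 𝓝 0, a i r t = 0) : Claim g w0 N L κ := by
  obtain ⟨η, hη, ε, hε, H⟩ := leafStep hg hg0 hn hp
  have h1 : ∀ᶠ t in 𝓝 (0:RR), ∀ i, ∀ r ∈ Finset.range (k i), a i r t = 0 ∧ deriv (a i r) t = 0 := by
    refine eventually_all.2 fun i => (Finset.eventually_all _).2 fun r hr => ?_
    filter_upwards [(hz i r (Finset.mem_range.1 hr)).eventually_nhds] with t ht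
    exact ⟨ht.self_of_nhds, by rw [(show a i r =ᶠ[𝓝 t] fun _ => 0 from ht).deriv_eq]; simp⟩
  obtain ⟨ρ, hρ, hr⟩ := Metric.eventually_nhds_iff.1 h1
  refine ⟨min η (ρ / 2), lt_min hη (by linarith), fun Ψ hΨ => ?_⟩
  have hcl : IsClosed {q : Q2 | q.1 ≤ min η (ρ / 2) ∧ |q.2| ≤ min η (ρ / 2)} := by simpa using box_closed (min η (ρ / 2)) 0
  refine H _ hcl (fun q hq _ => ⟨hq.1.trans (min_le_left _ _), hq.2.trans (min_le_left _ _)⟩) (fun q hq hq1 hq2 i r hr' => ?_) Ψ (hΨ.leaf hcl fun q hq => hq.2)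
  have : q.1 ≤ ρ / 2 := hq.1.trans (min_le_right _ _)
  obtain ⟨e1, e2⟩ := hr (y := q.1) (by rw [dist_eq, sub_zero, abs_of_pos hq1]; linarith) i r (Finset.mem_range.2 hr')
  rw [e1, e2]
  have := hε i
  simp
  positivity

lemma winv_outer {N L P : ℕ} {κ : RR → RR} {w0 : RR} (hN : 0 < N) {q : Q2} (hq : 0 < q.1) :
    winv (1 * N) (1 * L + P) (kp κ 1 L P (fun _ => 0) 0) w0 (chart N L κ w0 q) = q.2 * (q.1 ^ P)⁻¹ := by
  have h1 := congrFun (chart_Mp N L 1 P κ (fun _ => 0) w0 0) (q.1, q.2 * (q.1 ^ P)⁻¹)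
  have h2 : Mp 1 P (fun _ => 0) 0 (q.1, q.2 * (q.1 ^ P)⁻¹) = q := by
    have := (pow_pos hq P).ne'
    ext
    · simp [Mp]
    · simp only [Mp, zero_add]; field_simp
  simp only [h2] at h1
  rw [h1, winv_chart (by omega) _ _ (by exact hq)]

lemma Amp1.outer {N L P : ℕ} {κ : RR → RR} {w0 η B : RR} (hN : 0 < N) (hκ : Measurable κ) {Ψ : Q2 → RR}
    (h : Amp1 (chart N L κ w0) {q | q.1 ≤ η ∧ |q.2| ≤ η} Ψ) {β : RR → RR} (hβ : Cut β) (hB : 0 < B)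
    (hβ1 : ∀ x, |x - 0| ≤ 2 * B / 2 → β x = 1) (hβ2 : ∀ x, β x ≠ 0 → |x - 0| < 2 * B) :
    Amp (fun q => (0, q.2)) (chart N L κ w0) {q | (q.1 ≤ η ∧ |q.2| ≤ η) ∧ B * |q.1| ^ P ≤ |q.2|}
      (fun p => Ψ p * (1 - β (winv (1 * N) (1 * L + P) (kp κ 1 L P (fun _ => 0) 0) w0 p))) := by
  have hcl : IsClosed {q : Q2 | q.1 ≤ η ∧ |q.2| ≤ η} := by simpa using box_closed η 0
  have h' := h.leaf hcl (R := η) (fun q hq => hq.2)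
  obtain ⟨A, hA, hb⟩ := h'.bd
  obtain ⟨hd, C, hC⟩ := hβ
  have p1 := (abs_nonneg _).trans (hC 0).1
  have hder : ∀ x, |deriv β x * x| ≤ C * (2 * B) := by
    intro x
    by_cases hx : |x| ≤ 2 * B
    · rw [abs_mul]; exact mul_le_mul (hC x).2 hx (abs_nonneg _) p1
    · have : β =ᶠ[𝓝 x] fun _ => 0 := by
        filter_upwards [continuous_abs.continuousAt.eventually (lt_mem_nhds (not_le.1 hx))] with y hy
        by_contra h0
        have := hβ2 y h0
        rw [sub_zero] at this
        linarith
      rw [this.deriv_eq]; simp; positivity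
  have hkm : Measurable (kp κ 1 L P (fun _ => 0) 0) := by unfold kp; fun_prop
  refine ⟨h.meas.mul (measurable_const.sub (hd.continuous.measurable.comp (winv_meas hkm w0))), fun p hp => h.pos p (left_ne_zero_of_mul hp),
    fun q hq hq' => ?_, A * (1 + C) + P * (A * (C * (2 * B))) + A * (C * (2 * B)), by positivity, fun q hq => ?_⟩
  · rw [winv_outer hN hq] at hq'
    refine ⟨h.supp q hq (left_ne_zero_of_mul hq'), ?_⟩
    by_contra hh
    apply right_ne_zero_of_mul hq'
    rw [hβ1, sub_self]
    rw [sub_zero, abs_mul, abs_inv, abs_pow, mul_div_cancel_left₀ _ two_ne_zero]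
    have : 0 < |q.1| ^ P := pow_pos (abs_pos.2 hq.ne') P
    rw [← div_eq_mul_inv, div_le_iff₀ this]
    exact (not_le.1 hh).le
  · obtain ⟨d1, d2, d3, d4⟩ := hb q hq
    have hP0 : q.1 ^ P ≠ 0 := (pow_pos hq P).ne'
    have he : (fun q => Ψ (chart N L κ w0 q) * (1 - β (winv (1 * N) (1 * L + P) (kp κ 1 L P (fun _ => 0) 0) w0 (chart N L κ w0 q)))) =ᶠ[𝓝 q]
        fun q => Ψ (chart N L κ w0 q) * (1 - β (q.2 * (q.1 ^ P)⁻¹)) := by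
      have hp : ∀ᶠ q' : Q2 in 𝓝 q, 0 < q'.1 := continuous_fst.continuousAt.eventually (lt_mem_nhds hq)
      filter_upwards [hp] with q' hq'
      rw [winv_outer hN hq']
    have hz : HasFDerivAt (fun q : Q2 => (q.1 ^ P)⁻¹) ((-(P * q.1 ^ (P - 1)) / (q.1 ^ P) ^ 2) • ContinuousLinearMap.fst RR RR RR) q :=
      HasDerivAt.comp_hasFDerivAt (f := fun q : Q2 => q.1) (h₂ := fun s : RR => (s ^ P)⁻¹) q ((hasDerivAt_pow P q.1).fun_inv hP0) hasFDerivAt_fst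
    have hs := ((hd (q.2 * (q.1 ^ P)⁻¹)).hasDerivAt.comp_hasFDerivAt q (hasFDerivAt_snd.fun_mul hz)).const_sub 1
    have hD := (d1.hasFDerivAt.fun_mul hs).congr_of_eventuallyEq he
    set x := q.2 * (q.1 ^ P)⁻¹ with hx
    have hAC : 0 ≤ A * (C * (2 * B)) := by positivity
    have hPA : 0 ≤ P * (A * (C * (2 * B))) := by positivity
    have hA1 : 0 ≤ A * (1 + C) := by positivity
    have hb1 : |1 - β x| ≤ 1 + C := (abs_sub _ _).trans (by rw [abs_one]; linarith [(hC x).1])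
    have hpw : (P * q.1 ^ (P - 1)) * q.1 = P * q.1 ^ P := by
      rcases P with _ | r
      · simp
      · rw [Nat.add_sub_cancel, pow_succ]; ring
    refine ⟨hD.differentiableAt, ?_, ?_, ?_⟩
    · rw [winv_outer hN hq, abs_mul]
      have := mul_le_mul d2 hb1 (abs_nonneg _) hA
      linarith
    · rw [hD.fderiv]
      simp only [_root_.add_apply, _root_.neg_apply, _root_.smul_apply, smul_eq_mul, ContinuousLinearMap.coe_snd', ContinuousLinearMap.coe_fst', Function.comp, mul_zero, add_zero]
      have e : deriv β x * (q.2 * (-(P * q.1 ^ (P - 1)) / (q.1 ^ P) ^ 2 * q.1)) = - (P * (deriv β x * x)) := by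
        rw [div_mul_eq_mul_div, neg_mul, hpw, hx]; field_simp
      rw [e, neg_neg, ← hx]
      refine (abs_add_le _ _).trans ?_
      rw [abs_mul, abs_mul (P:RR), Nat.abs_cast, abs_mul (1 - _)]
      have h1 := mul_le_mul hb1 d3 (abs_nonneg _) (by linarith)
      have h2 := mul_le_mul d2 (mul_le_mul_of_nonneg_left (hder x) (Nat.cast_nonneg P)) (by positivity) hA
      linarith
    · rw [hD.fderiv]
      simp only [_root_.add_apply, _root_.neg_apply, _root_.smul_apply, smul_eq_mul, ContinuousLinearMap.coe_snd', ContinuousLinearMap.coe_fst', Function.comp, mul_zero, zero_add]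
      rw [mul_comm (q.1 ^ P)⁻¹ q.2, ← hx]
      refine (abs_add_le _ _).trans ?_
      rw [abs_mul, abs_mul, abs_neg]
      have h1 := mul_le_mul hb1 d4 (abs_nonneg _) (by linarith)
      have h2 := mul_le_mul d2 (hder x) (by positivity) hA
      linarith

lemma child {ι : Type} [Fintype ι] {g : Q2 → RR} {D : Set Q2} {γ : ι → RR} {w0 : RR}
    {N L : ℕ} {κ : RR → RR} {m : RR} {F : ι → Q2 → RR} {k : ι → ℕ}
    (hn : IsNode g D γ w0 N L κ m F k) {a : ι → ℕ → RR → RR} {U : ι → Q2 → RR} (hp : Prep F k a U) {P : ℕ} (hP : 0 < P)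
    {b : ι → ℕ → RR → RR} (hb : ∀ i r, r < k i → AnalyticAt RR (b i r) 0 ∧ ∀ᶠ t in 𝓝 0, a i r t = t ^ (P * (k i - r)) * b i r t)
    (hb0 : ∃ i r, r < k i ∧ b i r 0 ≠ 0) (ω : RR) :
    ∃ m' F' k', IsNode g D γ w0 (1 * N) (1 * L + P) (kp κ 1 L P (fun _ => 0) ω) m' F' k' ∧ ∑ i, k' i < ∑ i, k i := by
  have h1 := fun i => poly_step (k i) (fun r => b i r 0) (hp.U0 i) ω
  choose k' h hk hh heq hcoef using h1
  set F' : ι → Q2 → RR := fun i q => ∑ r ∈ Finset.range (k i), b i r q.1 * (ω + q.2) ^ r + (ω + q.2) ^ (k i) * U i (q.1, q.1 ^ P * (ω + q.2)) with hF'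
  have hsn : AnalyticAt RR (fun q : Q2 => ω + q.2) 0 := analyticAt_const.fun_add analyticAt_snd
  have hpw : AnalyticAt RR (fun q : Q2 => q.1 ^ P * (ω + q.2)) 0 := (analyticAt_fst.fun_pow P).fun_mul hsn
  have hM : Tendsto (Mp 1 P (fun _ => 0) ω) (𝓝 0) (𝓝 0) := Mp_tendsto one_pos continuousAt_const rfl (fun h => absurd h hP.ne')
  have hT1 : Tendsto (fun q : Q2 => q.1) (𝓝 0) (𝓝 0) := (continuous_fst (X := RR) (Y := RR)).tendsto 0
  have hreg : ∀ i, Reg (F' i) (k' i) := by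
    intro i
    refine ⟨?_, fun w => (h i).eval (ω + w), ?_, by simpa using hh i, Eventually.of_forall fun w => ?_⟩
    · refine (Finset.analyticAt_fun_sum _ fun r hr => ?_).fun_add ((hsn.fun_pow _).fun_mul (analyticAt_sub (hp.ex i).2.1 analyticAt_fst hpw rfl (by simp [hP.ne'])))
      exact (AnalyticAt.fun_comp (f := fun q : Q2 => q.1) (hb i r (Finset.mem_range.1 hr)).1 analyticAt_fst).fun_mul (hsn.fun_pow r)
    · exact ((h i).continuous.comp (by fun_prop)).continuousAt
    · have := heq i (ω + w)
      simp only [hF', zero_pow hP.ne', zero_mul]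
      rw [show ((0:RR), (0:RR)) = 0 from rfl, this]
      congr 2; ring
  obtain ⟨m', hnode⟩ := hn.pull (Q := 1) (P := P) (c := fun _ => 0) (ω := ω) one_pos measurable_const analyticAt_const rfl
    (fun h => absurd h hP.ne') (F' := F') (k' := k') (e := fun i => P * k i) hreg (by
    intro i
    have h2 : ∀ᶠ t in 𝓝 (0:RR), ∀ r ∈ Finset.range (k i), a i r t = t ^ (P * (k i - r)) * b i r t :=
      (Finset.eventually_all _).2 fun r hr => (hb i r (Finset.mem_range.1 hr)).2
    filter_upwards [hM.eventually (hp.ex i).2.2, hT1.eventually h2] with q e1 e2 _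
    rw [e1]
    simp only [Mp, pow_one, zero_add, hF']
    rw [mul_add (q.1 ^ (P * k i)), Finset.mul_sum]
    congr 1
    · refine Finset.sum_congr rfl fun r hr => ?_
      rw [e2 r hr, mul_pow, ← pow_mul]
      have : P * k i = P * (k i - r) + P * r := by rw [← Nat.mul_add, Nat.sub_add_cancel (Finset.mem_range.1 hr).le]
      rw [this, pow_add]; ring
    · rw [mul_pow, ← pow_mul]; ring)
  refine ⟨m', F', k', hnode, ?_⟩
  by_contra hlt
  have hall : ∀ i, k' i = k i := by
    intro i
    by_contra hne
    exact hlt (Finset.sum_lt_sum (fun i _ => hk i) ⟨i, Finset.mem_univ i, lt_of_le_of_ne (hk i) hne⟩)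
  obtain ⟨i1, r1, hr1, hb1⟩ := hb0
  obtain ⟨i0, hk0, hz⟩ := hp.ctr ⟨i1, by omega⟩
  have hr0 : k i0 - 1 < k i0 := by omega
  have hbz : b i0 (k i0 - 1) 0 = 0 := by
    refine eq_at_zero (v := fun _ => 0) (j := P * (k i0 - (k i0 - 1))) (hb i0 _ hr0).1.continuousAt continuousAt_const ?_
    filter_upwards [hz, (hb i0 _ hr0).2] with t h1 h2
    rw [← h2, h1, mul_zero]
  have hω : ω = 0 := by
    have := hcoef i0 (hall i0) _ hr0
    simp only [hbz] at this
    rw [show k i0 - (k i0 - 1) = 1 by omega, pow_one] at this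
    have h3 : ((k i0).choose (k i0 - 1) : RR) ≠ 0 := by exact_mod_cast (Nat.choose_pos (by omega)).ne'
    have h4 := hp.U0 i0
    by_contra h5
    exact (mul_ne_zero (mul_ne_zero h4 (neg_ne_zero.2 h5)) h3) this.symm
  apply hb1
  have := hcoef i1 (hall i1) _ hr1
  rw [this, hω, neg_zero, zero_pow (by omega)]; ring

lemma node_claim {ι : Type} [Fintype ι] {g : Q2 → RR} {D : Set Q2} {γ : ι → RR} {w0 : RR}
    (hg : Integrable g) (hg0 : ∀ p, 0 ≤ g p) (K : ℕ) : ∀ (N L : ℕ) (κ : RR → RR) (m : RR) (F : ι → Q2 → RR) (k : ι → ℕ),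
    IsNode g D γ w0 N L κ m F k → ∑ i, k i = K → Claim g w0 N L κ := by
  induction K using Nat.strong_induction_on with
  | _ K ih =>
  intro N0 L0 κ0 m0 F0 k hn0 hK
  obtain ⟨N, L, κ, m, F, a, U, hn, hp, hcl⟩ := prepare hn0
  apply hcl
  by_cases hz : ∀ i, ∀ r < k i, ∀ᶠ t in 𝓝 0, a i r t = 0
  · exact claim_zero hg hg0 hn hp hz
  obtain ⟨P, hP, b, hb, hb0⟩ := min_P hp hz
  obtain ⟨η1, hη1, ε, hε, H⟩ := leafStep hg hg0 hn hp
  -- choice of B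
  obtain ⟨B, hB1, hBo⟩ : ∃ B : RR, 1 ≤ B ∧ ∀ i, ∀ r ∈ Finset.range (k i), ∀ᶠ q : Q2 in 𝓝 0, 0 < q.1 → B * q.1 ^ P ≤ |q.2| →
      |a i r q.1| ≤ ε i * |q.2| ^ (k i - r) ∧ |q.1 * deriv (a i r) q.1| ≤ |q.2| ^ (k i - r) := by
    have h1 : ∀ᶠ B : RR in atTop, ∀ i, ∀ r ∈ Finset.range (k i), ∀ᶠ q : Q2 in 𝓝 0, 0 < q.1 → B * q.1 ^ P ≤ |q.2| →
        |a i r q.1| ≤ ε i * |q.2| ^ (k i - r) ∧ |q.1 * deriv (a i r) q.1| ≤ |q.2| ^ (k i - r) := by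
      refine eventually_all.2 fun i => (Finset.eventually_all _).2 fun r hr => ?_
      have hr' := Finset.mem_range.1 hr
      obtain ⟨B0, h⟩ := outer_small (n := k i - r) (by omega) (hb i r hr').1 (hb i r hr').2 (hε i)
      filter_upwards [eventually_ge_atTop B0, eventually_ge_atTop 1] with B h1 h2
      exact h B h1 h2
    obtain ⟨B, h2, h3⟩ := ((eventually_ge_atTop 1).and h1).exists
    exact ⟨B, h2, h3⟩
  have hB : 0 < B := by linarith
  obtain ⟨ρ, hρ, hbox⟩ := ev_box (eventually_all.2 fun i => (Finset.eventually_all _).2 (hBo i))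
  have hN : 0 < 1 * N := by rw [one_mul]; exact hn.hN
  have hkm : Measurable (kp κ 1 L P (fun _ => 0) 0) := by
    have := hn.κm
    unfold kp; fun_prop
  -- inner part
  obtain ⟨η2, hη2, hin⟩ := glue (N := 1 * N) (L := 1 * L + P) (κ := kp κ 1 L P (fun _ => 0) 0) (w0 := w0) hN hkm (G := Good g w0)
    (fun Ψ Ψ' h1 h2 h3 h4 h5 h6 => Good.add hg h1 h2 h3 h4 h5 h6) (K := Icc (-(2 * B)) (2 * B)) isCompact_Icc (by
      intro ω
      obtain ⟨m', F', k', hn', hlt⟩ := child hn hp hP hb hb0 ω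
      obtain ⟨η, hη, h⟩ := ih _ (hK ▸ hlt) _ _ _ _ _ _ hn' rfl
      refine ⟨min η 1, lt_min hη one_pos, fun Ψ hΨ => h Ψ ?_⟩
      have h2 := hΨ.pullM (Q := 1) (P := 0) (c := fun _ => 0) (ω := ω) (η := min η 1) (R := |ω| + 1) (S' := {q | q.1 ≤ η ∧ |q.2| ≤ η}) one_pos
        (box_closed _ ω) (min_le_right _ _) (fun q hq => ⟨hq.1, ?_⟩) (fun t _ _ => ⟨differentiableAt_const _, by simp; positivity, by simp; positivity⟩)
        (fun q hq hq' => ?_)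
      · have e : (fun q => chart (1 * N) (1 * L + P) (kp κ 1 L P (fun _ => 0) 0) w0 (Mp 1 0 (fun _ => 0) ω q)) =
            chart (1 * N) (1 * L + P) (kp κ 1 L P (fun _ => 0) ω) w0 := by
          rw [← chart_Mp, ← chart_Mp]
          funext q
          simp [Mp]
        rwa [e] at h2
      · have h3 := hq.2.trans (min_le_right _ _)
        have h4 := abs_add_le (q.2 - ω) ω
        rw [sub_add_cancel] at h4
        linarith
      · obtain ⟨h3, h4⟩ := hq'
        simp only [Mp, pow_one, pow_zero, one_mul, zero_add, add_sub_cancel_left] at h3 h4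
        exact ⟨h3.trans (min_le_left _ _), h4.trans (min_le_left _ _)⟩)
  obtain ⟨β, hβ, hβ1, hβ2⟩ := exists_cut 0 (η := 2 * B) (by linarith)
  set η := min (min η1 η2) (min ρ 1) with hηd
  have hη0 : 0 < η := lt_min (lt_min hη1 hη2) (lt_min hρ one_pos)
  have l1 : η ≤ η1 := (min_le_left _ _).trans (min_le_left _ _)
  have l2 : η ≤ η2 := (min_le_left _ _).trans (min_le_right _ _)
  have l3 : η ≤ ρ := (min_le_right _ _).trans (min_le_left _ _)
  have l4 : η ≤ 1 := (min_le_right _ _).trans (min_le_right _ _)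
  refine ⟨η, hη0, fun Ψ hΨ => ?_⟩
  have hcl0 : IsClosed {q : Q2 | q.1 ≤ η ∧ |q.2| ≤ η} := by simpa using box_closed η 0
  have hout := hΨ.outer (P := P) hn.hN hn.κm hβ hB hβ1 hβ2
  have h2 := hΨ.pullM (Q := 1) (P := P) (c := fun _ => 0) (ω := 0) (η := η) (R := 1) (S' := {q | q.1 ≤ η}) one_pos
    hcl0 l4 (fun q hq => ⟨hq.1, hq.2.trans l4⟩) (fun t _ _ => ⟨differentiableAt_const _, by simp, by simp⟩)
    (fun q hq hq' => by have := hq'.1; simpa [Mp] using this)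
  rw [chart_Mp] at h2
  have hinn := h2.mulW hN hkm hβ
  have e : Ψ = fun p => Ψ p * β (winv (1 * N) (1 * L + P) (kp κ 1 L P (fun _ => 0) 0) w0 p) +
      Ψ p * (1 - β (winv (1 * N) (1 * L + P) (kp κ 1 L P (fun _ => 0) 0) w0 p)) := by funext p; ring
  rw [e]
  obtain ⟨C1, -, b1⟩ := hinn.abs_le hN rfl
  obtain ⟨C2, -, b2⟩ := hout.abs_le hn.hN rfl
  refine Good.add hg hinn.meas hout.meas ⟨C1, b1⟩ ⟨C2, b2⟩ (hin _ (hinn.mono ?_)) (H _ ?_ ?_ ?_ _ hout)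
  · rintro q ⟨h3, h4⟩
    refine ⟨le_trans h3 l2, ?_⟩
    have := hβ2 _ h4
    rw [sub_zero] at this
    exact abs_le.1 this.le
  · exact IsClosed.and hcl0 (isClosed_le (by fun_prop) (by fun_prop))
  · exact fun q hq _ => ⟨hq.1.1.trans l1, hq.1.2.trans l1⟩
  · rintro q ⟨⟨h3, h4⟩, h5⟩ hq1 hq2 i r hr
    rw [abs_of_pos hq1] at h5
    exact hbox q (by rw [abs_of_pos hq1]; exact h3.trans l3) (h4.trans l3) i r (Finset.mem_range.2 hr) hq1 h5

lemma curve_inv {h : RR → RR} (hh : AnalyticAt RR h 0) (h0 : h 0 = 0) : ∃ (m : ℕ) (ψ : RR → RR), 0 < m ∧ AnalyticAt RR ψ 0 ∧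
    ∀ᶠ s in 𝓝 0, 0 ≤ s → ∀ τ > 0, τ ^ m = h s → s = ψ τ := by
  rcases hh.eventually_eq_zero_or_eventually_ne_zero with hz | hz
  · refine ⟨1, fun _ => 0, one_pos, analyticAt_const, ?_⟩
    filter_upwards [hz] with s hs _ τ hτ h1
    rw [hs] at h1
    exact absurd h1 (pow_pos hτ _).ne'
  obtain ⟨m, c, hc, hc0, hm⟩ := hh.exists_eventuallyEq_pow_smul_nonzero_iff.2
    (fun h => by obtain ⟨s, h1, h2⟩ := (hz.and (h.filter_mono nhdsWithin_le_nhds)).exists; exact h1 h2)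
  simp only [sub_zero, smul_eq_mul] at hm
  have hm0 : m ≠ 0 := by
    rintro rfl
    have := hm.self_of_nhds
    rw [h0] at this
    exact hc0 (by simpa using this.symm)
  rcases lt_or_gt_of_ne hc0 with hneg | hpos
  · refine ⟨1, fun _ => 0, one_pos, analyticAt_const, ?_⟩
    filter_upwards [hm, hc.continuousAt.eventually (gt_mem_nhds hneg)] with s hs hs' h1 τ hτ h2
    rw [hs, pow_one] at h2
    nlinarith [pow_nonneg h1 m]
  have hca : AnalyticAt RR (fun s => exp (log (c s) * (m:RR)⁻¹)) 0 :=
    ((hc.log hpos).fun_mul analyticAt_const).rexp'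
  set θ : RR → RR := fun s => s * exp (log (c s) * (m:RR)⁻¹) with hθ
  have hθa : AnalyticAt RR θ 0 := analyticAt_id.fun_mul hca
  have hθ0 : θ 0 = 0 := by simp [hθ]
  have hθd : deriv θ 0 ≠ 0 := by
    have := (hasDerivAt_id' (0:RR)).fun_mul hca.differentiableAt.hasDerivAt
    rw [this.deriv]
    simp [(exp_pos _).ne']
  refine ⟨m, _, Nat.pos_of_ne_zero hm0, hθ0 ▸ hθa.analyticAt_localInverse hθd, ?_⟩
  filter_upwards [hm, hc.continuousAt.eventually (lt_mem_nhds hpos), HasStrictDerivAt.eventually_left_inverse hθa.hasStrictDerivAt hθd] with s hs hs' h1 h2 τ hτ h3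
  have e : θ s ^ m = h s := by
    rw [hs, hθ]
    simp only [mul_pow, ← exp_nat_mul]
    rw [mul_comm (log (c s)), ← mul_assoc, mul_inv_cancel₀ (by exact_mod_cast hm0), one_mul, exp_log hs']
  rw [(pow_left_inj₀ hτ.le (mul_nonneg h2 (exp_pos _).le) hm0).1 (h3.trans e.symm)]
  exact h1.symm

/-- Puiseux half-curve (either orientation) -/
def Pz (C : Set Q2) : Prop := ∃ (N : ℕ) (h : RR → RR) (σ : RR), 0 < N ∧ AnalyticAt RR h 0 ∧ h 0 = 0 ∧ (σ = 1 ∨ σ = -1) ∧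
  ((∀ p ∈ C, 0 ≤ σ * p.1 ∧ p.2 = h (|p.1| ^ ((N:RR)⁻¹))) ∨ ∀ p ∈ C, 0 ≤ σ * p.2 ∧ p.1 = h (|p.2| ^ ((N:RR)⁻¹)))

lemma Pz.swap {C : Set Q2} (h : Pz C) : Pz (Prod.swap ⁻¹' C) := by
  obtain ⟨N, h, σ, h1, h2, h3, h4, h5⟩ := h
  exact ⟨N, h, σ, h1, h2, h3, h4, h5.symm.imp (fun H p hp => H p.swap hp) (fun H p hp => H p.swap hp)⟩

lemma Pz.neg {C : Set Q2} (h : Pz C) : Pz ((fun p => -p) ⁻¹' C) := by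
  obtain ⟨N, h, σ, h1, h2, h3, h4, h5⟩ := h
  refine ⟨N, fun s => -h s, -σ, h1, h2.neg, by simp [h3], by rcases h4 with rfl | rfl <;> simp, h5.imp (fun H p hp => ?_) (fun H p hp => ?_)⟩ <;>
  · obtain ⟨a, b⟩ := H _ hp
    simp only [Prod.fst_neg, Prod.snd_neg, abs_neg] at a b
    exact ⟨by linarith, by linarith⟩

lemma Pz.cu {C : Set Q2} (h : Pz C) : ∃ (m : ℕ) (k : RR → RR), 0 < m ∧ AnalyticAt RR k 0 ∧
    ∀ᶠ p : Q2 in 𝓝 0, p ∈ C → ∀ τ > 0, τ ^ m = p.1 → p.2 = k τ := by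
  obtain ⟨N, h, σ, h1, h2, h3, h4, h5 | h5⟩ := h
  · refine ⟨N, h, h1, h2, Eventually.of_forall fun p hp τ hτ e => ?_⟩
    rw [(h5 p hp).2, ← e, abs_of_pos (pow_pos hτ N), pow_rpow_inv_natCast hτ.le h1.ne']
  · obtain ⟨m, ψ, hm, hψ, H⟩ := curve_inv h2 h3
    refine ⟨m, fun t => σ * ψ t ^ N, hm, analyticAt_const.fun_mul (hψ.fun_pow N), ?_⟩
    have ht : Tendsto (fun p : Q2 => |p.2| ^ ((N:RR)⁻¹)) (𝓝 0) (𝓝 0) := by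
      have : ContinuousAt (fun p : Q2 => |p.2| ^ ((N:RR)⁻¹)) 0 :=
        ContinuousAt.rpow_const (by fun_prop) (Or.inr (by positivity))
      have e : (fun p : Q2 => |p.2| ^ ((N:RR)⁻¹)) 0 = 0 := by
        simp [zero_rpow (inv_ne_zero (Nat.cast_ne_zero.2 h1.ne'))]
      exact (congrArg 𝓝 e) ▸ this.tendsto
    filter_upwards [ht.eventually H] with p hp hpC τ hτ e
    obtain ⟨a, b⟩ := h5 p hpC
    have := hp (by positivity) τ hτ (e.trans b)
    rw [← this, rpow_inv_natCast_pow (abs_nonneg _) h1.ne']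
    rcases h4 with rfl | rfl
    · rw [abs_of_nonneg (by linarith)]; ring
    · rw [abs_of_nonpos (by linarith)]; ring

lemma blow_ne {f : Q2 → RR} (hf : AnalyticAt RR f 0) (hnt : ¬ ∀ᶠ p in 𝓝 0, f p = 0) {N : ℕ} (hN : 0 < N) (ω : RR) :
    ¬ ∀ᶠ q in 𝓝 0, f (chart N N (fun _ => 0) ω q) = 0 := by
  intro hz
  obtain ⟨r, hr, hB⟩ := Metric.eventually_nhds_iff_ball.1 hf.eventually_analyticAt
  refine hnt (Metric.eventually_nhds_iff_ball.2 ⟨r, hr, fun p hp => ?_⟩)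
  have hcc : Continuous (chart N N (fun _ => 0) ω) := by unfold chart; fun_prop
  have hc0 : chart N N (fun _ => 0) ω 0 = 0 := by simp [chart, hN.ne']
  have hb : ∀ᶠ q in 𝓝 0, chart N N (fun _ => 0) ω q ∈ ball 0 r :=
    hcc.continuousAt.eventually (by rw [hc0]; exact Metric.ball_mem_nhds _ hr)
  have ht : Tendsto (fun t : RR => (t, (0:RR))) (𝓝[>] 0) (𝓝 0) :=
    ((by fun_prop : Continuous fun t : RR => (t, (0:RR))).tendsto' 0 0 rfl).mono_left nhdsWithin_le_nhds
  obtain ⟨t, ⟨h1, h2⟩, h3⟩ := ((ht.eventually (hz.eventually_nhds.and hb)).and self_mem_nhdsWithin).exists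
  have h3 : 0 < t := h3
  set p1 := chart N N (fun _ => 0) ω (t, 0) with hp1
  have hp1' : 0 < p1.1 := pow_pos h3 N
  have hcont : ContinuousAt (fun p => (tinv N p, winv N N (fun _ => 0) ω p)) p1 := by
    have ht : ContinuousAt (tinv N) p1 := ContinuousAt.rpow_const (by fun_prop) (Or.inl hp1'.ne')
    refine ht.prodMk ?_
    unfold winv
    exact ContinuousAt.div₀ (by fun_prop) (ht.pow N) (pow_pos (tinv_pos hp1') N).ne'
  have e1 : (tinv N p1, winv N N (fun _ => 0) ω p1) = (t, 0) := by
    rw [hp1, tinv_chart hN _ _ h3, winv_chart hN _ _ h3]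
  have hev : f =ᶠ[𝓝 p1] 0 := by
    have h5 : ∀ᶠ p : Q2 in 𝓝 p1, 0 < p.1 := continuous_fst.continuousAt.eventually (lt_mem_nhds hp1')
    rw [ContinuousAt, e1] at hcont
    filter_upwards [hcont.eventually h1, h5] with p a b
    rwa [chart_inv hN _ _ b] at a
  exact AnalyticOnNhd.eqOn_zero_of_preconnected_of_eventuallyEq_zero hB (convex_ball 0 r).isPreconnected h2 hev hp

/-- local data -/
structure Sdt {n : ℕ} (g : Q2 → RR) (D : Set Q2) (f : Fin n → Q2 → RR) (γ : Fin n → RR) (δ : RR) (e : ℕ) : Prop where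
  int : Integrable g
  pos : ∀ p, 0 ≤ g p
  rep : ∀ᶠ p in 𝓝 0, g p = D.indicator 1 p * ∏ i, |f i p| ^ γ i
  an : ∀ i, AnalyticAt RR (f i) 0
  nt : ∀ i, ¬ ∀ᶠ p in 𝓝 0, f i p = 0
  fr : ∃ (k : ℕ) (Cs : Fin k → Set Q2), (∀ j, Pz (Cs j)) ∧ ∀ᶠ p in 𝓝 0, p ∈ frontier D → ∃ j, p ∈ Cs j
  st : ∀ a b : RR, a ^ 2 + b ^ 2 = 1 → ∃ R > 0, R ≤ 1 ∧ ∃ ρ > 0, ∃ c ≥ 0, ∀ r, 0 < r → r < R →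
    ∫ p in {p : Q2 | |a * p.1 + b * p.2| < r ∧ ‖p‖ < ρ}, g p ≤ c * r ^ δ * |log r| ^ e

lemma Sdt.claim {n : ℕ} {g : Q2 → RR} {D : Set Q2} {f : Fin n → Q2 → RR} {γ : Fin n → RR} {δ : RR} {e : ℕ}
    (h : Sdt g D f γ δ e) (ω : RR) {ρ : RR} (hρ : 0 < ρ) : ∃ N, 0 < N ∧ Claim ((ball 0 ρ).indicator g) ω N N (fun _ => 0) := by
  obtain ⟨J, Cs, hP, hfr⟩ := h.fr
  choose m κ hm hκ hcu using fun j => (hP j).cu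
  set N := ∏ j, m j with hNd
  have hN : 0 < N := Finset.prod_pos fun j _ => hm j
  have hd : ∀ j, m j * (N / m j) = N := fun j => Nat.mul_div_cancel' (Finset.dvd_prod_of_mem m (Finset.mem_univ j))
  have hd0 : ∀ j, N / m j ≠ 0 := fun j h0 => by have := hd j; rw [h0] at this; omega
  have hca : AnalyticAt RR (chart N N (fun _ => 0) ω) 0 := by
    unfold chart
    exact (analyticAt_fst.fun_pow N).prod (((analyticAt_const.fun_mul (analyticAt_fst.fun_pow N)).fun_add analyticAt_const).fun_add
      ((analyticAt_fst.fun_pow N).fun_mul analyticAt_snd))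
  have hc0 : chart N N (fun _ => 0) ω 0 = 0 := by simp [chart, hN.ne']
  have hct : Tendsto (chart N N (fun _ => 0) ω) (𝓝 0) (𝓝 0) := by
    have := hca.continuousAt.tendsto
    rwa [hc0] at this
  have f1 : ∀ i, ∃ (a k : ℕ) (F : Q2 → RR), Reg F k ∧ ∀ᶠ q in 𝓝 0, f i (chart N N (fun _ => 0) ω q) = q.1 ^ a * F q := fun i =>
    exists_factor (AnalyticAt.fun_comp (g := f i) (by rw [hc0]; exact h.an i) hca) (blow_ne (h.an i) (h.nt i) hN ω)
  have f2 : ∀ j, ∃ (a k : ℕ) (F : Q2 → RR), Reg F k ∧ ∀ᶠ q : Q2 in 𝓝 0,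
      (chart N N (fun _ => 0) ω q).2 - κ j (q.1 ^ (N / m j)) = q.1 ^ a * F q := fun j => by
    refine exists_factor ?_ ?_
    · refine (analyticAt_snd.fun_comp hca).fun_sub (AnalyticAt.fun_comp (g := κ j) (f := fun q : Q2 => q.1 ^ (N / m j)) ?_ (analyticAt_fst.fun_pow _))
      simpa [hd0 j] using hκ j
    · intro hz
      obtain ⟨ρ, hρ, hb⟩ := ev_box hz
      have e1 := hb (ρ, ρ) (abs_of_pos hρ).le (abs_of_pos hρ).le
      have e2 := hb (ρ, 0) (abs_of_pos hρ).le (by simpa using hρ.le)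
      have e3 : ρ ^ N * ρ = 0 := by simp only [chart] at e1 e2; linarith
      exact (by positivity : ρ ^ N * ρ ≠ 0) e3
  choose a k F hR hF using f1
  choose a' k' F' hR' hF' using f2
  refine ⟨N, hN, node_claim (h.int.indicator measurableSet_ball) (fun p => indicator_nonneg (fun p _ => h.pos p) p) _ N N _ (∑ i, a i * γ i) (Sum.elim F F') (Sum.elim k k')
    (D := D) (γ := Sum.elim γ (fun _ => 0)) ⟨hN, le_rfl, measurable_const, ⟨fun _ => 0, analyticAt_const, rfl, by simp⟩, ?_, ?_, ?_⟩ rfl⟩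
  · rintro (i | j)
    · exact hR i
    · exact hR' j
  · filter_upwards [hct.eventually h.rep, eventually_all.2 hF, hct.eventually (ball_mem_nhds 0 hρ)] with q h1 h2 h3 hq
    rw [indicator_of_mem (s := ball (0:RR×RR) ρ) (a := chart N N (fun _ => 0) ω q) h3, h1, Fintype.prod_sum_type]
    simp only [Sum.elim_inl, Sum.elim_inr, rpow_zero, Finset.prod_const_one, mul_one]
    rw [rpow_sum_of_pos (abs_pos.2 hq.ne'), ← Finset.prod_mul_distrib]
    congr 1
    refine Finset.prod_congr rfl fun i _ => ?_
    rw [h2 i, abs_mul, mul_rpow (abs_nonneg _) (abs_nonneg _), abs_pow, ← rpow_natCast, ← rpow_mul (abs_nonneg _)]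
  · filter_upwards [hct.eventually hfr, hct.eventually (eventually_all.2 hcu), eventually_all.2 hF'] with q h1 h2 h3 hq hf
    obtain ⟨j, hj⟩ := h1 hf
    refine ⟨Sum.inr j, ?_⟩
    have e1 := h2 j hj (q.1 ^ (N / m j)) (pow_pos hq _) (by rw [← pow_mul, mul_comm, hd]; rfl)
    have e2 := h3 j
    rw [e1, sub_self] at e2
    exact (mul_eq_zero.1 e2.symm).resolve_left (pow_pos hq _).ne'

/-- decay estimate -/
def Dg (g : Q2 → RR) (δ : RR) (e : ℕ) (Ψ : Q2 → RR) : Prop :=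
  ∃ C, ∀ μ1 μ2, ‖∫ p : Q2, ((g p * Ψ p : RR) : ℂ) * ee (μ1 * p.1 + μ2 * p.2)‖ ≤ C * dec δ e μ1 μ2

lemma Dg.add {g Ψ Ψ' : Q2 → RR} {δ : RR} {e : ℕ} (hg : Integrable g) (hΨ : Measurable Ψ) (hΨ' : Measurable Ψ')
    (hb : ∃ C, ∀ p, |Ψ p| ≤ C) (hb' : ∃ C, ∀ p, |Ψ' p| ≤ C) (h : Dg g δ e Ψ) (h' : Dg g δ e Ψ') :
    Dg g δ e (fun p => Ψ p + Ψ' p) := by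
  obtain ⟨C, h⟩ := h
  obtain ⟨C', h'⟩ := h'
  have hi : ∀ (Ψ : Q2 → RR) (μ1 μ2 : RR), Measurable Ψ → (∃ C, ∀ p, |Ψ p| ≤ C) →
      Integrable (fun p : Q2 => ((g p * Ψ p : RR) : ℂ) * ee (μ1 * p.1 + μ2 * p.2)) := by
    rintro Ψ μ1 μ2 hm ⟨C, hC⟩
    have h1 : Integrable (fun p => g p * Ψ p) := hg.mul_bdd hm.aestronglyMeasurable (Eventually.of_forall hC)
    refine h1.ofReal.mul_bdd (c := 1) ?_ (Eventually.of_forall fun p => (norm_ee _).le)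
    exact (continuous_ee.comp (by fun_prop)).aestronglyMeasurable
  refine ⟨C + C', fun μ1 μ2 => ?_⟩
  have : ∀ p : Q2, ((g p * (Ψ p + Ψ' p) : RR) : ℂ) * ee (μ1 * p.1 + μ2 * p.2) =
    ((g p * Ψ p : RR) : ℂ) * ee (μ1 * p.1 + μ2 * p.2) + ((g p * Ψ' p : RR) : ℂ) * ee (μ1 * p.1 + μ2 * p.2) := by
    intro p; push_cast; ring
  simp only [this]
  rw [integral_add (hi Ψ _ _ hΨ hb) (hi Ψ' _ _ hΨ' hb'), add_mul]
  exact (norm_add_le _ _).trans (add_le_add (h _ _) (h' _ _))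

/-- amplitudes before localization -/
def Ct (Φ : Q2 → RR) : Prop := Measurable Φ ∧ ∃ C, ∀ p, |Φ p| ≤ C ∧ (p ≠ 0 → DifferentiableAt RR Φ p ∧ ‖fderiv RR Φ p‖ * ‖p‖ ≤ C)

lemma Ct.amp {Φ : Q2 → RR} (h : Ct Φ) {η : RR} (hs : ∀ p, Φ p ≠ 0 → p.1 ≤ η) :
    Amp1 (chart 1 1 (fun _ => 0) 0) {q | q.1 ≤ η} (fun p => if 0 < p.1 then Φ p else 0) := by
  obtain ⟨hm, C, hC⟩ := h
  have hC0 : 0 ≤ C := (abs_nonneg _).trans (hC 0).1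
  refine ⟨Measurable.ite (measurableSet_lt measurable_const measurable_fst) hm measurable_const, fun p hp => by by_contra h0; simp [h0] at hp,
    fun q hq h1 => ?_, C, hC0, fun q hq => ?_⟩
  · have h2 : 0 < (chart 1 1 (fun _ => 0) 0 q).1 := by simpa [chart] using hq
    rw [if_pos h2] at h1
    have := hs _ h1
    simpa [chart] using this
  set p : Q2 := (q.1, q.1 * q.2) with hp
  have hp0 : p ≠ 0 := fun h0 => hq.ne' (congrArg Prod.fst h0)
  obtain ⟨hd, hb⟩ := (hC p).2 hp0
  have hev : (fun q => if 0 < (chart 1 1 (fun _ => 0) 0 q).1 then Φ (chart 1 1 (fun _ => 0) 0 q) else 0) =ᶠ[𝓝 q]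
      fun q => Φ (q.1, q.1 * q.2) := by
    filter_upwards [continuous_fst.continuousAt.eventually (lt_mem_nhds hq)] with q' hq'
    simp [chart, hq']
  have hM : HasFDerivAt (fun q : Q2 => (q.1, q.1 * q.2)) _ q := (hasFDerivAt_fst (𝕜 := RR)).prodMk ((hasFDerivAt_fst (𝕜 := RR)).fun_mul (hasFDerivAt_snd (𝕜 := RR)))
  have hD := ((hd.hasFDerivAt (x := (fun q : Q2 => (q.1, q.1 * q.2)) q)).comp q hM).congr_of_eventuallyEq hev
  have hle : ∀ v : Q2, ‖v‖ ≤ ‖p‖ → |fderiv RR Φ p v| ≤ C := fun v hv =>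
    ((fderiv RR Φ p).le_opNorm v).trans ((mul_le_mul_of_nonneg_left hv (norm_nonneg _)).trans hb)
  refine ⟨hD.differentiableAt, ?_, ?_, ?_⟩
  · rw [hev.eq_of_nhds]; exact (hC _).1
  · rw [hD.fderiv]
    refine hle _ (le_of_eq ?_)
    simp [hp, mul_comm]
  · rw [hD.fderiv]
    refine hle _ ?_
    simp [hp, Prod.norm_def]

lemma Sdt.cone {n : ℕ} {g : Q2 → RR} {D : Set Q2} {f : Fin n → Q2 → RR} {γ : Fin n → RR} {δ : RR} {e : ℕ}
    (h : Sdt g D f γ δ e) (hδ0 : 0 ≤ δ) (hδ : δ < 1 / 2) : ∃ η > 0, ∀ Φ β, Ct Φ → (∀ p, Φ p ≠ 0 → ‖p‖ ≤ η) → Cut β →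
      (∀ x, β x ≠ 0 → |x| ≤ 2) → Dg g δ e (fun p => (if 0 < p.1 then Φ p else 0) * β (p.2 / p.1)) := by
  obtain ⟨η, hη, H⟩ := glue (N := 1) (L := 1) (κ := fun _ => 0) (w0 := 0) one_pos measurable_const (G := Dg g δ e)
    (fun Ψ Ψ' h1 h2 h3 h4 h5 h6 => Dg.add h.int h1 h2 h3 h4 h5 h6) (K := Icc (-2) 2) isCompact_Icc (by
      intro ω
      have hω : 0 < √(1 + ω ^ 2) := by positivity
      have hs2 : √(1 + ω ^ 2) ^ 2 = 1 + ω ^ 2 := sq_sqrt (by positivity)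
      obtain ⟨R, hR, hR1, ρ, hρ, c, hc, hst⟩ := h.st (-ω / √(1 + ω ^ 2)) (1 / √(1 + ω ^ 2)) (by
        rw [div_pow, div_pow, hs2]; field_simp; ring)
      obtain ⟨N, hN, η, hη, hcl⟩ := h.claim ω hρ
      set g' := (ball (0 : Q2) ρ).indicator g with hg'
      have hi : Integrable g' := h.int.indicator measurableSet_ball
      have hp : ∀ p, 0 ≤ g' p := fun p => indicator_nonneg (fun p _ => h.pos p) p
      obtain ⟨C', hC', hw⟩ := weight_final (w0 := ω) hi hp hδ0 hδ hR hR1 hc (fun r hr hr' => by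
        rw [hg', setIntegral_indicator measurableSet_ball]
        refine (setIntegral_mono_set h.int.integrableOn (Eventually.of_forall h.pos) (LE.le.eventuallyLE ?_)).trans (hst r hr hr')
        rintro p ⟨hp, hp'⟩
        have hp : |p.2 - ω * p.1| < r := hp
        refine ⟨?_, by simpa using hp'⟩
        rw [show -ω / √(1 + ω ^ 2) * p.1 + 1 / √(1 + ω ^ 2) * p.2 = (p.2 - ω * p.1) / √(1 + ω ^ 2) by ring, abs_div, abs_of_pos hω]
        exact (div_le_self (abs_nonneg _) (one_le_sqrt.2 (by nlinarith))).trans_lt hp)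
      refine ⟨min (min (min η (η ^ N)) (ρ / (|ω| + 2))) 1, by positivity, fun Ψ hΨ => ?_⟩
      have h2 := hΨ.pullM (Q := N) (P := 0) (c := fun _ => 0) (ω := ω) (η := min (min (min η (η ^ N)) (ρ / (|ω| + 2))) 1) (R := |ω| + 1)
        (S' := {q | q.1 ≤ η ∧ |q.2| ≤ η}) hN (box_closed _ ω) (min_le_right _ _) (fun q hq => ⟨hq.1, ?_⟩)
        (fun t _ _ => ⟨differentiableAt_const _, by simp; positivity, by simp; positivity⟩) (fun q hq hq' => ?_)
      · have e1 : (fun q => chart 1 1 (fun _ => 0) 0 (Mp N 0 (fun _ => 0) ω q)) = chart N N (fun _ => 0) ω := by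
          funext q
          simp only [chart, Mp, Prod.mk.injEq]
          exact ⟨by ring, by ring⟩
        rw [e1] at h2
        obtain ⟨C, hC⟩ := hcl Ψ h2
        have hgΨ : ∀ p, g p * Ψ p = g' p * Ψ p := fun p => by
          by_cases h0 : Ψ p = 0
          · rw [h0, mul_zero, mul_zero]
          have hp0 := hΨ.pos p h0
          have e2 := chart_inv (N := 1) (L := 1) one_pos (fun _ => 0) 0 hp0
          obtain ⟨k1, k2⟩ := hΨ.supp (tinv 1 p, winv 1 1 (fun _ => 0) 0 p) (tinv_pos hp0) (by rwa [e2])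
          have hw : |ω| + 2 > 0 := by positivity
          have k1 := k1.trans ((min_le_left _ _).trans (min_le_right _ _))
          have k2 := k2.trans (min_le_right _ _)
          simp only [winv, tinv, Nat.cast_one, inv_one, rpow_one, zero_mul, sub_zero, pow_one] at k1 k2
          rw [le_div_iff₀ hw] at k1
          rw [abs_le] at k2
          have k3 : p.2 = p.1 * (p.2 / p.1) := by field_simp
          have k4 := le_abs_self ω
          have k5 := neg_abs_le ω
          rw [hg', indicator_of_mem]
          rw [mem_ball_zero_iff, Prod.norm_def]
          refine max_lt ?_ ?_
          · rw [norm_eq_abs, abs_of_pos hp0]; nlinarith [abs_nonneg ω]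
          · rw [norm_eq_abs, k3, abs_lt]; constructor <;> nlinarith [abs_nonneg ω]
        refine ⟨|C| * C', fun μ1 μ2 => ?_⟩
        simp only [hgΨ]
        refine (hC μ1 μ2).trans ?_
        rw [mul_assoc]
        have hI : 0 ≤ ∫ p : Q2, g' p * Wt (max |μ1 + ω * μ2| |μ2|) (p.2 - ω * p.1) :=
          integral_nonneg fun p => mul_nonneg (hp p) (Wt_pos _ _).le
        exact mul_le_mul (le_abs_self C) (hw μ1 μ2) hI (abs_nonneg C)
      · have h3 := hq.2.trans (min_le_right _ _)
        have h4 := abs_add_le (q.2 - ω) ω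
        rw [sub_add_cancel] at h4
        linarith
      · obtain ⟨h3, h4⟩ := hq'
        simp only [Mp, pow_zero, one_mul, zero_add, add_sub_cancel_left] at h3 h4
        exact ⟨le_of_pow_le_pow_left₀ hN.ne' hη.le (h3.trans ((min_le_left _ _).trans ((min_le_left _ _).trans (min_le_right _ _)))),
          h4.trans ((min_le_left _ _).trans ((min_le_left _ _).trans (min_le_left _ _)))⟩)
  refine ⟨η, hη, fun Φ β hΦ hs hβ hβ2 => ?_⟩
  have h1 := (hΦ.amp (η := η) fun p hp => (le_abs_self _).trans ((norm_fst_le p).trans (hs p hp))).mulW one_pos measurable_const hβ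
  have e1 : ∀ p : Q2, winv 1 1 (fun _ => 0) 0 p = p.2 / p.1 := fun p => by simp [winv, tinv]
  simp only [e1] at h1
  exact H _ (h1.mono fun q hq => ⟨hq.1, abs_le.1 (hβ2 _ hq.2)⟩)

/-- symmetries used to cover the plane -/
structure Sym2T (T : Q2 ≃L[RR] Q2) : Prop where
  mp : MeasurePreserving T
  inv : ∀ p, T (T p) = p
  iso : ∀ p, ‖T p‖ = ‖p‖
  lin : ∀ a b : RR, ∃ a' b', a' ^ 2 + b' ^ 2 = a ^ 2 + b ^ 2 ∧ ∀ p, a * (T p).1 + b * (T p).2 = a' * p.1 + b' * p.2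
  pz : ∀ C, Pz C → Pz (T ⁻¹' C)

lemma sym_swap : Sym2T (ContinuousLinearEquiv.prodComm RR RR RR) :=
  ⟨Measure.measurePreserving_swap, fun p => rfl, fun p => by simp [Prod.norm_def, max_comm],
    fun a b => ⟨b, a, by ring, fun p => by simp; ring⟩, fun C h => h.swap⟩

lemma sym_neg : Sym2T (ContinuousLinearEquiv.neg RR) :=
  ⟨Measure.measurePreserving_neg volume, fun p => by simp, fun p => by simp,
    fun a b => ⟨-a, -b, by ring, fun p => by simp⟩, fun C h => h.neg⟩

lemma Sdt.comp {n : ℕ} {g : Q2 → RR} {D : Set Q2} {f : Fin n → Q2 → RR} {γ : Fin n → RR} {δ : RR} {e : ℕ}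
    (h : Sdt g D f γ δ e) {T} (hT : Sym2T T) : Sdt (fun p => g (T p)) (T ⁻¹' D) (fun i p => f i (T p)) γ δ e := by
  have emb : MeasurableEmbedding T := T.toHomeomorph.measurableEmbedding
  have ht : Tendsto T (𝓝 0) (𝓝 0) := by simpa using T.continuous.tendsto 0
  refine ⟨(hT.mp.integrable_comp_emb emb).2 h.int, fun p => h.pos _, ht.eventually h.rep, fun i => ?_, fun i hz => h.nt i ?_, ?_, fun a b hab => ?_⟩
  · exact AnalyticAt.fun_comp (g := f i) (by rw [map_zero]; exact h.an i) (T.toContinuousLinearMap.analyticAt 0)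
  · filter_upwards [ht.eventually hz] with p hp
    rwa [hT.inv] at hp
  · obtain ⟨k, Cs, h1, h2⟩ := h.fr
    refine ⟨k, fun j => T ⁻¹' Cs j, fun j => hT.pz _ (h1 j), ?_⟩
    filter_upwards [ht.eventually h2] with p hp hf
    have := T.toHomeomorph.preimage_frontier D
    exact hp (this.symm.subset hf)
  · obtain ⟨a', b', h1, h2⟩ := hT.lin a b
    obtain ⟨R, hR, hR1, ρ, hρ, c, hc, H⟩ := h.st a' b' (h1.trans hab)
    refine ⟨R, hR, hR1, ρ, hρ, c, hc, fun r hr hr' => (le_of_eq ?_).trans (H r hr hr')⟩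
    rw [← hT.mp.setIntegral_preimage_emb emb g]
    congr 2
    ext p
    have := h2 (T p)
    rw [hT.inv] at this
    show |_| < r ∧ ‖p‖ < ρ ↔ |_| < r ∧ ‖T p‖ < ρ
    rw [this, hT.iso]

lemma Dg.comp {g Ψ : Q2 → RR} {δ : RR} {e : ℕ} {T} (hT : Sym2T T) (h : Dg (fun p => g (T p)) δ e (fun p => Ψ (T p))) : Dg g δ e Ψ := by
  obtain ⟨C, h⟩ := h
  refine ⟨C, fun μ1 μ2 => ?_⟩
  obtain ⟨a, b, h1, h2⟩ := hT.lin μ1 μ2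
  rw [← hT.mp.integral_comp T.toHomeomorph.measurableEmbedding]
  simp only [h2]
  refine (h a b).trans (le_of_eq ?_)
  unfold dec
  rw [h1]

lemma Ct.comp {Φ : Q2 → RR} (h : Ct Φ) {T} (hT : Sym2T T) : Ct (fun p => Φ (T p)) := by
  obtain ⟨hm, C, hC⟩ := h
  refine ⟨hm.comp T.continuous.measurable, C, fun p => ⟨(hC _).1, fun hp => ?_⟩⟩
  obtain ⟨h1, h2⟩ := (hC (T p)).2 (by simpa using hp)
  have hd := h1.hasFDerivAt.comp p T.hasFDerivAt
  refine ⟨hd.differentiableAt, ?_⟩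
  have e1 : fderiv RR (fun p => Φ (T p)) p = (fderiv RR Φ (T p)).comp (T : Q2 →L[RR] Q2) := hd.fderiv
  rw [e1, ← hT.iso p]
  refine le_trans (mul_le_mul_of_nonneg_right ?_ (norm_nonneg _)) h2
  refine ContinuousLinearMap.opNorm_le_bound _ (norm_nonneg _) fun v => ?_
  have := (fderiv RR Φ (T p)).le_opNorm (T v)
  rwa [hT.iso] at this

lemma Dg.congr {g Ψ Ψ' : Q2 → RR} {δ : RR} {e : ℕ} (h : Dg g δ e Ψ) (hh : ∀ p : Q2, p.1 ≠ 0 → p.2 ≠ 0 → Ψ p = Ψ' p) : Dg g δ e Ψ' := by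
  obtain ⟨C, h⟩ := h
  refine ⟨C, fun μ1 μ2 => (le_of_eq ?_).trans (h μ1 μ2)⟩
  congr 1
  refine integral_congr_ae ?_
  have h1 : ∀ᵐ p : Q2, p.1 ≠ 0 := (Measure.quasiMeasurePreserving_fst (μ := (volume : Measure RR)) (ν := (volume : Measure RR))).ae (Measure.ae_ne volume 0)
  have h2 : ∀ᵐ p : Q2, p.2 ≠ 0 := (Measure.quasiMeasurePreserving_snd (μ := (volume : Measure RR)) (ν := (volume : Measure RR))).ae (Measure.ae_ne volume 0)
  filter_upwards [h1, h2] with p a b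
  rw [hh p a b]

lemma Sdt.half {n : ℕ} {g : Q2 → RR} {D : Set Q2} {f : Fin n → Q2 → RR} {γ : Fin n → RR} {δ : RR} {e : ℕ}
    (h : Sdt g D f γ δ e) (hδ0 : 0 ≤ δ) (hδ : δ < 1 / 2) : ∃ η > 0, ∀ Φ β, Ct Φ → (∀ p, Φ p ≠ 0 → ‖p‖ ≤ η) → Cut β →
      (∀ x, β x ≠ 0 → |x| ≤ 2) → Dg g δ e (fun p => Φ p * β (p.2 / p.1)) := by
  obtain ⟨η1, h1, H1⟩ := h.cone hδ0 hδ
  obtain ⟨η2, h2, H2⟩ := (h.comp sym_neg).cone hδ0 hδ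
  refine ⟨min η1 η2, lt_min h1 h2, fun Φ β hΦ hs hβ hβ2 => ?_⟩
  have d1 := H1 Φ β hΦ (fun p hp => (hs p hp).trans (min_le_left _ _)) hβ hβ2
  have d2 : Dg g δ e (fun p => (if 0 < -p.1 then Φ p else 0) * β (p.2 / p.1)) := by
    refine Dg.comp sym_neg ?_
    have := H2 (fun p => Φ (ContinuousLinearEquiv.neg RR p)) β (hΦ.comp sym_neg)
      (fun p hp => by have := (hs _ hp).trans (min_le_right _ _); rwa [sym_neg.iso] at this) hβ hβ2
    simpa using this
  obtain ⟨hm, C, hC⟩ := hΦ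
  obtain ⟨hβd, B, hB⟩ := hβ
  have hβm := hβd.continuous.measurable
  have hC0 : 0 ≤ C := (abs_nonneg _).trans (hC 0).1
  have hb : ∀ (P : Q2 → Prop) [DecidablePred P], ∃ C, ∀ p : Q2, |(if P p then Φ p else 0) * β (p.2 / p.1)| ≤ C := fun P _ => by
    refine ⟨C * B, fun p => ?_⟩
    rw [abs_mul]
    refine mul_le_mul ?_ (hB _).1 (abs_nonneg _) hC0
    split_ifs
    exacts [(hC p).1, by simpa using hC0]
  have hmm : Measurable fun p : Q2 => β (p.2 / p.1) := hβm.comp (measurable_snd.div measurable_fst)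
  refine (Dg.add h.int ?_ ?_ (hb _) (hb _) d1 d2).congr fun p hp _ => ?_
  · exact (Measurable.ite (measurableSet_lt measurable_const measurable_fst) hm measurable_const).mul hmm
  · exact (Measurable.ite (measurableSet_lt measurable_const measurable_fst.neg) hm measurable_const).mul hmm
  · rcases lt_or_gt_of_ne hp with h | h
    · rw [if_neg (by linarith), if_pos (by linarith)]; ring
    · rw [if_pos (by linarith), if_neg (by linarith)]; ring

lemma cut_dual {β : RR → RR} (h : Cut β) (h0 : ∀ x, β x ≠ 0 → |x| < 2) : Cut (fun s => if s = 0 then 1 else 1 - β s⁻¹) := by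
  obtain ⟨hd, C, hC⟩ := h
  have hC0 : 0 ≤ C := (abs_nonneg _).trans (hC 0).1
  have key : ∀ s : RR, |if s = 0 then 1 else 1 - β s⁻¹| ≤ 1 + 4 * C ∧ ∃ d, HasDerivAt (fun s => if s = 0 then 1 else 1 - β s⁻¹) d s ∧ |d| ≤ 1 + 4 * C := by
    intro s
    refine ⟨?_, ?_⟩
    · split_ifs
      · rw [abs_one]; linarith
      · refine (abs_sub _ _).trans ?_
        rw [abs_one]
        linarith [(hC s⁻¹).1]
    by_cases hs : |s| < 1 / 2
    · refine ⟨0, (hasDerivAt_const s (1:RR)).congr_of_eventuallyEq ?_, by simp; positivity⟩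
      filter_upwards [continuous_abs.continuousAt.eventually (gt_mem_nhds hs)] with x hx
      split_ifs with h
      · rfl
      · have : β x⁻¹ = 0 := by
          by_contra h3
          have := h0 _ h3
          rw [abs_inv, inv_lt_comm₀ (abs_pos.2 h) two_pos] at this
          linarith
        rw [this, sub_zero]
    · have hs0 : s ≠ 0 := by rintro rfl; simp at hs
      refine ⟨-(deriv β s⁻¹ * (-(s ^ 2)⁻¹)), ?_, ?_⟩
      · refine (((hd s⁻¹).hasDerivAt.comp s (hasDerivAt_inv hs0)).const_sub 1).congr_of_eventuallyEq ?_
        filter_upwards [isOpen_ne.mem_nhds hs0] with x hx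
        exact if_neg hx
      · have h1 : (s ^ 2)⁻¹ ≤ 4 := by
          rw [inv_le_comm₀ (by positivity) (by norm_num), ← sq_abs]
          nlinarith [not_lt.1 hs]
        rw [abs_neg, abs_mul, abs_neg, abs_of_nonneg (by positivity : 0 ≤ (s ^ 2)⁻¹)]
        nlinarith [mul_le_mul (hC s⁻¹).2 h1 (by positivity) hC0]
  refine ⟨fun s => ?_, 1 + 4 * C, fun s => ⟨(key s).1, ?_⟩⟩ <;> obtain ⟨d, h1, h2⟩ := (key s).2
  exacts [h1.differentiableAt, by rwa [h1.deriv]]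

lemma Sdt.full {n : ℕ} {g : Q2 → RR} {D : Set Q2} {f : Fin n → Q2 → RR} {γ : Fin n → RR} {δ : RR} {e : ℕ}
    (h : Sdt g D f γ δ e) (hδ0 : 0 ≤ δ) (hδ : δ < 1 / 2) : ∃ η > 0, ∀ Φ, Ct Φ → (∀ p, Φ p ≠ 0 → ‖p‖ ≤ η) → Dg g δ e Φ := by
  obtain ⟨η1, h1, H1⟩ := h.half hδ0 hδ
  obtain ⟨η2, h2, H2⟩ := (h.comp sym_swap).half hδ0 hδ
  refine ⟨min η1 η2, lt_min h1 h2, fun Φ hΦ hs => ?_⟩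
  obtain ⟨β, hβ, hβ1, hβ2⟩ := exists_cut 0 (η := 2) two_pos
  simp only [sub_zero] at hβ1 hβ2
  have hβ' := cut_dual hβ hβ2
  set β' : RR → RR := fun s => if s = 0 then 1 else 1 - β s⁻¹ with hβd
  have d1 := H1 Φ β hΦ (fun p hp => (hs p hp).trans (min_le_left _ _)) hβ (fun x hx => (hβ2 x hx).le)
  have d2 : Dg g δ e (fun p => Φ p * β' (p.1 / p.2)) := by
    refine Dg.comp sym_swap ?_
    refine H2 (fun p => Φ (ContinuousLinearEquiv.prodComm RR RR RR p)) β' (hΦ.comp sym_swap)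
      (fun p hp => by have := (hs _ hp).trans (min_le_right _ _); rwa [sym_swap.iso] at this) hβ' fun x hx => ?_
    by_contra hx2
    rw [not_le] at hx2
    have hx0 : x ≠ 0 := by rintro rfl; norm_num at hx2
    refine hx ?_
    simp only [hβd, if_neg hx0]
    rw [hβ1 _ (by rw [abs_inv]; exact (inv_le_one_of_one_le₀ (by linarith)).trans (by norm_num)), sub_self]
  obtain ⟨hm, C, hC⟩ := hΦ
  have hb : ∀ (β : RR → RR) (u : Q2 → RR), Cut β → ∃ C, ∀ p : Q2, |Φ p * β (u p)| ≤ C := fun β u h => by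
    obtain ⟨-, B, hB⟩ := h
    refine ⟨C * B, fun p => ?_⟩
    rw [abs_mul]
    exact mul_le_mul (hC p).1 (hB _).1 (abs_nonneg _) ((abs_nonneg _).trans (hC p).1)
  refine (Dg.add h.int (hm.mul (hβ.1.continuous.measurable.comp (measurable_snd.div measurable_fst)))
    (hm.mul (hβ'.1.continuous.measurable.comp (measurable_fst.div measurable_snd))) (hb _ _ hβ) (hb _ _ hβ') d1 d2).congr fun p hp hp' => ?_
  simp only [hβd, Function.comp, Pi.mul_apply, Pi.div_apply, if_neg (div_ne_zero hp hp'), inv_div]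
  ring

lemma g_st {g0 : Q2 → RR} {ρ0 a b δv δm : RR} {ev em : ℕ} (hρ : 0 < ρ0) (hi : IntegrableOn g0 (ball 0 ρ0))
    (h0 : ∀ p, 0 ≤ g0 p) (hab : a ^ 2 + b ^ 2 = 1) (hs : StripBound g0 (a, b) δv ev) (hle : δm ≤ δv) (he : δv = δm → ev ≤ em) :
    ∃ R > 0, R ≤ 1 ∧ ∃ ρ > 0, ∃ c ≥ 0, ∀ r, 0 < r → r < R →
      ∫ p in {p : Q2 | |a * p.1 + b * p.2| < r ∧ ‖p‖ < ρ}, (ball 0 ρ0).indicator g0 p ≤ c * r ^ δm * |log r| ^ em := by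
  obtain ⟨hδ, he1, cv, hcv, H⟩ := hs
  have ha : |a| ≤ 1 := abs_le_one_iff_mul_self_le_one.2 (by nlinarith [sq_nonneg b])
  have hb : |b| ≤ 1 := abs_le_one_iff_mul_self_le_one.2 (by nlinarith [sq_nonneg a])
  set c := min (cv / 2) (ρ0 / 2) with hc
  have hc0 : 0 < c := by positivity
  obtain ⟨a1, ha1, b1, hb1, H⟩ := H c hc0 ((min_le_left _ _).trans_lt (by linarith))
  have hc2 : c ≤ ρ0 / 2 := min_le_right _ _
  have key : ∃ c' ≥ 0, ∀ r, 0 < r → r < 1 / 3 → r ^ δv * |log r| ^ ev ≤ c' * (r ^ δm * |log r| ^ em) := by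
    have hl : ∀ r : RR, 0 < r → r < 1 / 3 → 1 ≤ |log r| := by
      intro r hr hr1
      rw [← abs_neg, ← log_inv]
      refine le_trans ?_ (le_abs_self _)
      rw [le_log_iff_exp_le (by positivity)]
      have h3 : (3:RR) ≤ r⁻¹ := by rw [le_inv_comm₀ (by norm_num) hr]; linarith
      linarith [exp_one_lt_d9]
    rcases hle.eq_or_lt with h | h
    · refine ⟨1, zero_le_one, fun r hr hr1 => ?_⟩
      rw [one_mul, ← h]
      exact mul_le_mul_of_nonneg_left (pow_le_pow_right₀ (hl r hr hr1) (he h.symm)) (by positivity)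
    · refine ⟨1 / (δv - δm), one_div_nonneg.2 (by linarith), fun r hr hr1 => ?_⟩
      have e1 := abs_log_mul_self_rpow_lt r (δv - δm) hr (by linarith) (by linarith)
      rw [abs_mul, abs_of_pos (rpow_pos_of_pos hr _)] at e1
      calc r ^ δv * |log r| ^ ev ≤ r ^ δv * |log r| ^ 1 := by
            gcongr; exact hl r hr hr1
        _ = |log r| * r ^ (δv - δm) * r ^ δm := by
            rw [mul_assoc, ← rpow_add hr]; ring_nf
        _ ≤ 1 / (δv - δm) * r ^ δm := by gcongr
        _ ≤ 1 / (δv - δm) * (r ^ δm * |log r| ^ em) := by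
            refine mul_le_mul_of_nonneg_left ?_ (one_div_nonneg.2 (by linarith))
            exact le_mul_of_one_le_right (by positivity) (one_le_pow₀ (hl r hr hr1))
  obtain ⟨c', hc', K⟩ := key
  refine ⟨min c (1 / 3), by positivity, (min_le_right _ _).trans (by norm_num), c / 4, by positivity, b1 * c', by positivity, fun r hr hr1 => ?_⟩
  have hrc : r < c := hr1.trans_le (min_le_left _ _)
  have hsub : strip2 (a, b) r c ⊆ ball 0 ρ0 := by
    intro p hp
    obtain ⟨h1, h2⟩ := hp
    simp only [dot2, perp2] at h1 h2
    have aux : ∀ s t x y : RR, |s| < c → |t| < c → |x| ≤ 1 → |y| ≤ 1 → |s * x + t * y| < ρ0 := by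
      intro s t x y hs ht hx hy
      calc |s * x + t * y| ≤ |s| * |x| + |t| * |y| := by rw [← abs_mul, ← abs_mul]; exact abs_add_le _ _
        _ ≤ |s| * 1 + |t| * 1 := by gcongr
        _ < ρ0 := by linarith
    rw [mem_ball_zero_iff, Prod.norm_def, max_lt_iff]
    constructor
    · have := aux _ _ a b (h1.trans hrc) h2 ha hb
      rw [norm_eq_abs]
      calc |p.1| = _ := by congr 1; linear_combination (-p.1) * hab
        _ < ρ0 := this
    · have := aux _ _ b (-a) (h1.trans hrc) h2 hb (by rwa [abs_neg])
      rw [norm_eq_abs]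
      calc |p.2| = _ := by congr 1; linear_combination (-p.2) * hab
        _ < ρ0 := this
  have hsub2 : {p : Q2 | |a * p.1 + b * p.2| < r ∧ ‖p‖ < c / 4} ⊆ strip2 (a, b) r c := by
    intro p hp
    have h1 := hp.1
    have h2 := hp.2
    rw [Prod.norm_def, max_lt_iff, norm_eq_abs, norm_eq_abs] at h2
    refine ⟨by simp only [dot2]; convert h1 using 2; ring, ?_⟩
    simp only [dot2, perp2]
    calc |p.1 * b + p.2 * -a| ≤ |p.1| * |b| + |p.2| * |a| := by
          rw [← abs_neg a, ← abs_mul, ← abs_mul]; exact abs_add_le _ _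
      _ ≤ |p.1| * 1 + |p.2| * 1 := by gcongr
      _ < c := by linarith
  have hm : MeasurableSet (strip2 (a, b) r c) := by
    have : IsOpen (strip2 (a, b) r c) := by
      have e1 : ∀ w : Q2, Continuous fun p => |dot2 p w| := fun w => by unfold dot2; fun_prop
      exact (isOpen_lt (e1 _) continuous_const).inter (isOpen_lt (e1 _) continuous_const)
    exact this.measurableSet
  calc ∫ p in {p : Q2 | |a * p.1 + b * p.2| < r ∧ ‖p‖ < c / 4}, (ball 0 ρ0).indicator g0 p
      ≤ ∫ p in strip2 (a, b) r c, (ball 0 ρ0).indicator g0 p :=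
        setIntegral_mono_set (((integrable_indicator_iff measurableSet_ball).2 hi).integrableOn)
          (ae_of_all _ fun p => indicator_nonneg (fun p _ => h0 p) p) (LE.le.eventuallyLE hsub2)
    _ = ∫ p in strip2 (a, b) r c, g0 p := setIntegral_congr_fun hm fun p hp => indicator_of_mem (hsub hp) _
    _ ≤ b1 * r ^ δv * |log r| ^ ev := (H r hr hrc).2
    _ = b1 * (r ^ δv * |log r| ^ ev) := by ring
    _ ≤ b1 * (c' * (r ^ δm * |log r| ^ em)) := mul_le_mul_of_nonneg_left (K r hr (hr1.trans_le (min_le_right _ _))) hb1.le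
    _ = _ := by ring

lemma g_pz {r₀ : RR} (hr : 0 < r₀) {C : Set Q2} (h : IsPuiseuxBdryCurve r₀ C) : Pz C := by
  obtain ⟨N, h, I, σ, hN, hσ, hI, hsub, han, h0, hC, -⟩ := h
  refine ⟨N, h, σ, hN, han 0 (hsub ⟨le_rfl, by positivity⟩), h0, hσ, ?_⟩
  rcases hC with rfl | rfl
  · exact Or.inl fun p hp => hp.2
  · exact Or.inr fun p hp => hp.2

lemma g_fr {E : Set Q2} (h : IsStdDomain E) :
    ∃ (k : ℕ) (Cs : Fin k → Set Q2), (∀ j, Pz (Cs j)) ∧ ∀ᶠ p in 𝓝 0, p ∈ frontier E → ∃ j, p ∈ Cs j := by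
  have hop : ∀ r₀ : RR, IsOpen (disk2 r₀) := fun r₀ => isOpen_lt (by fun_prop) continuous_const
  have hd : ∀ r₀ : RR, 0 < r₀ → disk2 r₀ ∈ 𝓝 (0 : Q2) := fun r₀ hr =>
    (hop r₀).mem_nhds (show (0:RR) ^ 2 + 0 ^ 2 < r₀ ^ 2 by have := pow_pos hr 2; norm_num; exact this)
  rcases h with ⟨r₀, hr, rfl⟩ | ⟨r₀, hr, m, Es, Cs, rfl, -, hE, hC, -⟩
  · refine ⟨0, fun _ => ∅, fun j => j.elim0, ?_⟩
    filter_upwards [hd r₀ hr] with p hp hf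
    rw [(hop r₀).frontier_eq] at hf
    exact absurd hp hf.2
  · refine ⟨m * 2, fun j => Cs (finProdFinEquiv.symm j).1 (finProdFinEquiv.symm j).2, fun j => g_pz hr (hC _ _), ?_⟩
    filter_upwards [hd r₀ hr] with p hp hf
    have h1 : p ∈ ⋃ i, frontier (Es i) := by
      have ho : IsOpen (iUnion Es) := isOpen_iUnion fun i => (hE i).1
      rw [ho.frontier_eq, closure_iUnion_of_finite] at hf
      obtain ⟨i, hi⟩ := mem_iUnion.1 hf.1
      refine mem_iUnion.2 ⟨i, ?_⟩
      rw [(hE i).1.frontier_eq]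
      exact ⟨hi, fun h => hf.2 (mem_iUnion.2 ⟨i, h⟩)⟩
    obtain ⟨i, hi⟩ := mem_iUnion.1 h1
    have aux : ∀ j, p ∈ Cs i j → ∃ j, p ∈ Cs (finProdFinEquiv.symm j).1 (finProdFinEquiv.symm j).2 := fun j hj =>
      ⟨finProdFinEquiv (i, j), by rwa [Equiv.symm_apply_apply]⟩
    rcases (hE i).2.2.2 hi with (h | h) | h
    · exact aux 0 h
    · exact aux 1 h
    · exact absurd (show p.1 ^ 2 + p.2 ^ 2 = r₀ ^ 2 from h) (show p.1 ^ 2 + p.2 ^ 2 < r₀ ^ 2 from hp).ne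

lemma g_nrm (p : Q2) : ‖p‖ ≤ nrm2 p := by
  rw [Prod.norm_def, max_le_iff]
  exact ⟨abs_le_sqrt (by nlinarith [sq_nonneg p.2]), abs_le_sqrt (by nlinarith [sq_nonneg p.1])⟩

lemma g_ct {α φ : Q2 → RR} {A x₀ y₀ r : RR} (hA : 0 < A) (hα : AlphaBound α A) (hr : 0 < r) (hφ : IsBump φ x₀ y₀ r) :
    Ct (fun p => α p * φ ((x₀, y₀) + p)) ∧ ∀ p, φ ((x₀, y₀) + p) ≠ 0 → nrm2 p < r := by
  obtain ⟨h1, h2, h3⟩ := hα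
  obtain ⟨g1, g2, -, g4⟩ := hφ
  have hsup : ∀ p, (x₀, y₀) + p ∈ tsupport φ → nrm2 p < r := by
    intro p hp
    have h4 := g4 hp
    simp only [mem_ofPred_eq, Prod.fst_add, Prod.snd_add, add_sub_cancel_left] at h4
    exact (sqrt_lt' hr).2 h4
  refine ⟨⟨?_, ?_⟩, fun p hp => hsup p (subset_tsupport _ hp)⟩
  · have hα : Measurable α := by
      refine measurable_of_continuousOn_compl_singleton 0 h1.continuousOn
    exact hα.mul (g1.continuous.measurable.comp (measurable_const_add _))
  · obtain ⟨B, hB⟩ := g2.exists_bound_of_continuous g1.continuous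
    obtain ⟨B', hB'⟩ := (g2.fderiv (𝕜 := RR)).exists_bound_of_continuous (g1.continuous_fderiv (by simp))
    have hB0 : 0 ≤ B := (norm_nonneg _).trans (hB 0)
    have hB0' : 0 ≤ B' := (norm_nonneg _).trans (hB' 0)
    refine ⟨A * B + A * B' * r, fun p => ⟨?_, fun hp => ?_⟩⟩
    · rw [abs_mul]
      have : |α p| * |φ ((x₀, y₀) + p)| ≤ A * B := mul_le_mul (h2 p) (hB _) (abs_nonneg _) hA.le
      have : 0 ≤ A * B' * r := by positivity
      linarith
    · have da : DifferentiableAt RR α p := (h1.differentiableOn (by simp)).differentiableAt (isOpen_compl_singleton.mem_nhds hp)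
      have dφ : HasFDerivAt (fun p => φ ((x₀, y₀) + p)) (fderiv RR φ ((x₀, y₀) + p)) p := by
        have := (g1.differentiable (by simp) ((x₀, y₀) + p)).hasFDerivAt.comp p ((hasFDerivAt_id p).const_add (x₀, y₀))
        exact this
      have D := da.hasFDerivAt.mul dφ
      refine ⟨D.differentiableAt, ?_⟩
      have e0 : fderiv RR (fun p => α p * φ ((x₀, y₀) + p)) p = _ := D.fderiv
      rw [e0]
      have hpos : 0 < nrm2 p := (norm_pos_iff.2 hp).trans_le (g_nrm p)
      have e1 : ‖α p • fderiv RR φ ((x₀, y₀) + p)‖ * ‖p‖ ≤ A * B' * r := by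
        rw [norm_smul]
        by_cases hz : (x₀, y₀) + p ∈ tsupport φ
        · exact mul_le_mul (mul_le_mul (h2 p) (hB' _) (norm_nonneg _) hA.le) ((g_nrm p).trans (hsup p hz).le) (norm_nonneg _) (by positivity)
        · rw [image_eq_zero_of_notMem_tsupport (fun h => hz (tsupport_fderiv_subset RR h))]
          simp only [norm_zero, mul_zero, zero_mul]; positivity
      have e2 : ‖φ ((x₀, y₀) + p) • fderiv RR α p‖ * ‖p‖ ≤ A * B := by
        rw [norm_smul]
        calc ‖φ ((x₀, y₀) + p)‖ * ‖fderiv RR α p‖ * ‖p‖ ≤ B * (A * (nrm2 p)⁻¹) * nrm2 p := by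
              gcongr
              · exact hB _
              · exact h3 p hp
              · exact g_nrm p
          _ = A * B := by field_simp
      calc _ ≤ (‖α p • fderiv RR φ ((x₀, y₀) + p)‖ + ‖φ ((x₀, y₀) + p) • fderiv RR α p‖) * ‖p‖ := by
            gcongr; exact norm_add_le _ _
        _ ≤ _ := by rw [add_mul]; linarith

/-- **Theorem 1.4 b).** In the local multiplier setup with ball exponent `ε ≥ 1/2` and at
least one direction of strip exponent `< 1/2`, let `δ` be the minimum of the strip
exponents over all unit directions (so `δ < 1/2`) and `e` the maximum of `e_v` over the
minimizing directions. Then for bump functions `φ` with sufficiently small support there is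
`C'` with `|K_φ(t,u)| ≤ C' (2+|(t,u)|)^{−δ} (ln(2+|(t,u)|))^{e}` for all `(t,u)`. -/
theorem kernel_bound_global_eps_ge_half {n : ℕ} (f : Fin n → ℝ × ℝ → ℝ)
    (γ : Fin n → ℝ) (E : Set (ℝ × ℝ)) (hsf : StandardForm n f γ E)
    (x₀ y₀ A : ℝ) (hA : 0 < A) (α m : ℝ × ℝ → ℝ) (hα : AlphaBound α A)
    (U : Set (ℝ × ℝ)) (hU : U ∈ 𝓝 (0:ℝ×ℝ))
    (hm : ∀ p ∈ U, m ((x₀, y₀) + p) = α p * stdFun n f γ E p)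
    (ε : ℝ) (d : ℕ) (hball : BallBound (stdFun n f γ E) ε d) (hε : 1/2 ≤ ε)
    (δ : ℝ × ℝ → ℝ) (e : ℝ × ℝ → ℕ)
    (hstrip : ∀ v : ℝ × ℝ, nrm2 v = 1 → StripBound (stdFun n f γ E) v (δ v) (e v))
    (hex : ∃ w : ℝ × ℝ, nrm2 w = 1 ∧ δ w < 1/2)
    (δm : ℝ) (em : ℕ)
    (hδm : (∃ v, nrm2 v = 1 ∧ δ v = δm) ∧ ∀ v, nrm2 v = 1 → δm ≤ δ v)
    (hem : (∃ v, nrm2 v = 1 ∧ δ v = δm ∧ e v = em) ∧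
      ∀ v, nrm2 v = 1 → δ v = δm → e v ≤ em) :
    δm < 1/2 ∧
    ∃ r₁ > (0:ℝ), ∀ φ : ℝ × ℝ → ℝ, IsBump φ x₀ y₀ r₁ →
      ∃ C' > (0:ℝ), ∀ t u : ℝ,
        ‖Kphi φ m t u‖ ≤ C' * (2 + nrm2 (t, u)) ^ (-δm) *
          (Real.log (2 + nrm2 (t, u))) ^ em := by
  obtain ⟨w, hw, hw2⟩ := hex
  have hδ : δm < 1 / 2 := (hδm.2 w hw).trans_lt hw2
  have hδ0 : 0 < δm := by
    obtain ⟨v, hv, rfl⟩ := hδm.1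
    exact (hstrip v hv).1
  refine ⟨hδ, ?_⟩
  obtain ⟨V, hV, hint⟩ := hsf.integ
  obtain ⟨ρ0, hρ0, hball0⟩ := Metric.mem_nhds_iff.1 (inter_mem hV hU)
  set g0 := stdFun n f γ E with hg0
  have hpos : ∀ p, 0 ≤ g0 p := fun p =>
    indicator_nonneg (fun p _ => Finset.prod_nonneg fun i _ => rpow_nonneg (abs_nonneg _) _) p
  have hi : IntegrableOn g0 (ball 0 ρ0) := hint.mono_set (hball0.trans inter_subset_left)
  have hS : Sdt ((ball 0 ρ0).indicator g0) E f γ δm em := by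
    refine ⟨(integrable_indicator_iff measurableSet_ball).2 hi, fun p => indicator_nonneg (fun p _ => hpos p) p, ?_, ?_, hsf.nontriv,
      g_fr hsf.domain, fun a b hab => ?_⟩
    · filter_upwards [ball_mem_nhds 0 hρ0] with p hp
      rw [indicator_of_mem hp, hg0, stdFun]
      by_cases h : p ∈ E
      · simp [h]
      · simp [h]
    · obtain ⟨W, hW, han⟩ := hsf.analytic
      exact fun i => han i 0 (mem_of_mem_nhds hW)
    · have hv : nrm2 (a, b) = 1 := by simp only [nrm2]; rw [hab, sqrt_one]
      exact g_st hρ0 hi hpos hab (hstrip _ hv) (hδm.2 _ hv) (hem.2 _ hv)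
  obtain ⟨η, hη, H⟩ := hS.full hδ0.le hδ
  have hr1 : 0 < min η ρ0 := lt_min hη hρ0
  refine ⟨min η ρ0, hr1, fun φ hφ => ?_⟩
  obtain ⟨hct, hsup⟩ := g_ct hA hα hr1 hφ
  obtain ⟨C, hC⟩ := H _ hct fun p hp =>
    (g_nrm p).trans ((hsup p fun h0 => hp (by simp only [h0, mul_zero])).le.trans (min_le_left _ _))
  refine ⟨max C 1, by positivity, fun t u => ?_⟩
  have hd : 0 ≤ dec δm em t u := by
    have h2 : (0:RR) ≤ √(t ^ 2 + u ^ 2) := sqrt_nonneg _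
    exact mul_nonneg (rpow_nonneg (by linarith) _) (pow_nonneg (log_nonneg (by linarith)) _)
  have key : Kphi φ m t u = ee (t * x₀ + u * y₀) *
      ∫ p : Q2, (((ball 0 ρ0).indicator g0 p * (α p * φ ((x₀, y₀) + p)) : RR) : ℂ) * ee (t * p.1 + u * p.2) := by
    rw [Kphi, oscInt, setIntegral_univ, ← integral_add_left_eq_self _ ((x₀, y₀) : Q2), ← integral_const_mul]
    refine integral_congr_ae (ae_of_all _ fun p => ?_)
    have e1 : φ ((x₀, y₀) + p) * m ((x₀, y₀) + p) = (ball 0 ρ0).indicator g0 p * (α p * φ ((x₀, y₀) + p)) := by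
      by_cases h0 : φ ((x₀, y₀) + p) = 0
      · simp [h0]
      · have hb : p ∈ ball (0 : Q2) ρ0 := by
          rw [mem_ball_zero_iff]
          exact (g_nrm p).trans_lt ((hsup p h0).trans_le (min_le_right _ _))
        rw [indicator_of_mem hb, hm p (hball0 hb).2]; ring
    have e2 : Complex.exp (Complex.I * ((t : ℂ) * ((((x₀, y₀) : Q2) + p).1 : ℂ) + (u : ℂ) * ((((x₀, y₀) : Q2) + p).2 : ℂ)))
        = ee (t * x₀ + u * y₀) * ee (t * p.1 + u * p.2) := by
      rw [← ee_add, ee]; congr 2; simp only [Prod.fst_add, Prod.snd_add]; push_cast; ring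
    simp only [e1, e2]; ring
  rw [key, norm_mul, norm_ee, one_mul]
  calc _ ≤ C * dec δm em t u := hC t u
    _ ≤ max C 1 * dec δm em t u := mul_le_mul_of_nonneg_right (le_max_left _ _) hd
    _ = _ := by rw [dec, nrm2, mul_assoc]
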